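/- arXiv:1303.1789 — 2 statements merged into one kernel-verified Lean document; each statement's English description precedes it below -/
import Mathlib

section
/- Suppose n = 4 and p satisfies condition (A) at a with exponent k = 2 and coefficient β₂ > 0, and suppose moreover that the function θ(x) := (p(x) − p₀)/|x−a|² − β₂ satisfies ∫_{B(a,ρ)} θ(x)/|x−a|⁴ dx < ∞ for some ρ > 0 with B(a,ρ) ⊂ Ω. Then for every λ > 4β₂, S_λ(p) < p₀·S. -/
open MeasureTheory Filter Asymptotics
open scoped Topology

noncomputable section

/-- Euclidean space `ℝⁿ`. -/
abbrev Euc (n : ℕ) := EuclideanSpace ℝ (Fin n)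

/-- `u ∈ C_c^∞(Ω)`, `u ≢ 0`. -/
def IsTest {n : ℕ} (Ω : Set (Euc n)) (u : Euc n → ℝ) : Prop :=
  ContDiff ℝ (⊤ : ℕ∞) u ∧ HasCompactSupport u ∧ tsupport u ⊆ Ω ∧ u ≠ 0

/-- Condition (A): `lim_{x→a} (p(x) - p₀)/|x-a|^k = β`. -/
def CondA {n : ℕ} (p : Euc n → ℝ) (a : Euc n) (p₀ k β : ℝ) : Prop :=
  Tendsto (fun x => (p x - p₀) / ‖x - a‖ ^ k) (𝓝[≠] a) (𝓝 β)

/-- The best Sobolev constant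
`S = inf { ∫_Ω |∇u|² / (∫_Ω |u|^q)^{2/q} : u ∈ C_c^∞(Ω), u ≢ 0 }`. -/
def SobolevS {n : ℕ} (Ω : Set (Euc n)) (q : ℝ) : ℝ :=
  sInf {r : ℝ | ∃ u : Euc n → ℝ, IsTest Ω u ∧
    r = (∫ x in Ω, ‖gradient u x‖ ^ 2) / (∫ x in Ω, |u x| ^ q) ^ (2 / q)}

/-- `S_λ(p) = inf { (∫_Ω p|∇u|² - λ∫_Ω u²) / (∫_Ω |u|^q)^{2/q} : u ∈ C_c^∞(Ω), u ≢ 0 }`. -/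
def Slam {n : ℕ} (Ω : Set (Euc n)) (p : Euc n → ℝ) (q lam : ℝ) : ℝ :=
  sInf {r : ℝ | ∃ u : Euc n → ℝ, IsTest Ω u ∧
    r = ((∫ x in Ω, p x * ‖gradient u x‖ ^ 2) - lam * ∫ x in Ω, (u x) ^ 2) /
        (∫ x in Ω, |u x| ^ q) ^ (2 / q)}

/-- The cube `[-r, r]ⁿ`. -/
def cube (n : ℕ) (r : ℝ) : Set (Fin n → ℝ) := Set.Icc (fun _ => -r) (fun _ => r)

lemma isCompact_cube (n : ℕ) (r : ℝ) : IsCompact (cube n r) := isCompact_Icc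

lemma measurableSet_cube (n : ℕ) (r : ℝ) : MeasurableSet (cube n r) := measurableSet_Icc

lemma continuous_cons_uncurry (n : ℕ) :
    Continuous fun z : ℝ × (Fin n → ℝ) => (Fin.cons z.1 z.2 : Fin (n + 1) → ℝ) := by
  refine continuous_pi fun i => ?_
  refine Fin.cases ?_ (fun j => ?_) i
  · simpa using continuous_fst
  · simpa [Function.comp_def] using (continuous_apply j).comp (continuous_snd (X := ℝ))

lemma cube_succ_eq_preimage (n : ℕ) (r : ℝ) :
    cube (n + 1) r = MeasurableEquiv.piFinSuccAbove (fun _ => ℝ) 0 ⁻¹'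
      (Set.Icc (-r) r ×ˢ cube n r) := by
  ext x
  simp only [cube, Set.mem_preimage, Set.mem_prod, Set.mem_Icc, Pi.le_def, Fin.forall_fin_succ]
  simp [MeasurableEquiv.piFinSuccAbove, Fin.insertNthEquiv, Fin.tail]
  tauto

lemma setIntegral_cube_succ_prod (n : ℕ) (r : ℝ) (h : (Fin (n + 1) → ℝ) → ℝ) :
    ∫ x in cube (n + 1) r, h x =
      ∫ z in Set.Icc (-r) r ×ˢ cube n r, h (Fin.cons z.1 z.2) := by
  rw [cube_succ_eq_preimage,
    ← (volume_preserving_piFinSuccAbove (fun _ : Fin (n + 1) => ℝ) 0).setIntegral_preimage_emb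
      (MeasurableEquiv.measurableEmbedding _)]
  refine setIntegral_congr_fun ?_ fun x _ => ?_
  · exact (MeasurableEquiv.measurable _) (measurableSet_Icc.prod (measurableSet_cube n r))
  · congr 1
    refine ((Fin.cons_self_tail x).symm.trans ?_)
    rfl

lemma integrableOn_prod_cons {n : ℕ} (r : ℝ) {h : (Fin (n + 1) → ℝ) → ℝ} (hh : Continuous h) :
    IntegrableOn (fun z : ℝ × (Fin n → ℝ) => h (Fin.cons z.1 z.2))
      (Set.Icc (-r) r ×ˢ cube n r) :=
  (hh.comp (continuous_cons_uncurry n)).continuousOn.integrableOn_compact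
    (isCompact_Icc.prod (isCompact_cube n r))

lemma setIntegral_cube_succ {n : ℕ} {r : ℝ} (hr : 0 < r) {h : (Fin (n + 1) → ℝ) → ℝ}
    (hh : Continuous h) :
    ∫ x in cube (n + 1) r, h x = ∫ s in (-r)..r, ∫ x in cube n r, h (Fin.cons s x) := by
  rw [setIntegral_cube_succ_prod, intervalIntegral.integral_of_le (by linarith),
    ← integral_Icc_eq_integral_Ioc]
  exact setIntegral_prod _ (integrableOn_prod_cons r hh)

lemma setIntegral_cube_succ_swap {n : ℕ} {r : ℝ} (hr : 0 < r) {h : (Fin (n + 1) → ℝ) → ℝ}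
    (hh : Continuous h) :
    ∫ x in cube (n + 1) r, h x = ∫ x in cube n r, ∫ s in (-r)..r, h (Fin.cons s x) := by
  simp_rw [intervalIntegral.integral_of_le (show -r ≤ r by linarith),
    ← integral_Icc_eq_integral_Ioc]
  rw [setIntegral_cube_succ_prod]
  have h1 := integrableOn_prod_cons r hh
  rw [IntegrableOn, Measure.volume_eq_prod, ← Measure.prod_restrict] at h1
  rw [Measure.volume_eq_prod, ← Measure.prod_restrict]
  exact integral_prod_symm _ h1

lemma continuous_setIntegral_cube_cons {n : ℕ} (r : ℝ) {h : (Fin (n + 1) → ℝ) → ℝ}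
    (hh : Continuous h) : Continuous fun s => ∫ x in cube n r, h (Fin.cons s x) :=
  continuous_parametric_integral_of_continuous
    (f := fun s x => h (Fin.cons s x)) (hh.comp (continuous_cons_uncurry n)) (isCompact_cube n r)

lemma integrableOn_cube {n : ℕ} (r : ℝ) {h : (Fin n → ℝ) → ℝ} (hh : Continuous h) :
    IntegrableOn h (cube n r) := hh.continuousOn.integrableOn_compact (isCompact_cube n r)

lemma volume_real_cube (n : ℕ) {r : ℝ} (hr : 0 < r) :
    (volume : Measure (Fin n → ℝ)).real (cube n r) = (2 * r) ^ n := by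
  rw [cube, Measure.real, Real.volume_Icc_pi_toReal fun _ => by linarith]
  simp
  ring

lemma setIntegral_cube_pos {n : ℕ} {r : ℝ} (hr : 0 < r) {h : (Fin n → ℝ) → ℝ}
    (hh : Continuous h) (hpos : ∀ x, 0 < h x) : 0 < ∫ x in cube n r, h x := by
  refine (setIntegral_pos_iff_support_of_nonneg_ae ?_ (integrableOn_cube r hh)).2 ?_
  · exact Eventually.of_forall fun x => (hpos x).le
  · rw [show Function.support h = Set.univ from Set.eq_univ_of_forall fun x => (hpos x).ne',
      Set.univ_inter]
    by_contra h0
    have h1 := volume_real_cube n hr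
    rw [Measure.real, nonpos_iff_eq_zero.1 (not_lt.1 h0)] at h1
    have : (0:ℝ) < (2 * r) ^ n := by positivity
    simp at h1
    linarith

/-- Monotone rearrangement between two positive continuous densities on intervals. -/
lemma exists_monotone_transport {F G : ℝ → ℝ} (hF : Continuous F) (hG : Continuous G)
    (hF0 : ∀ s, 0 < F s) (hG0 : ∀ s, 0 < G s) {R M J : ℝ} (hM : 0 < M) (hJ : 0 < J)
    (hFG : ∫ s in (-R)..R, F s = J * ∫ y in (-M)..M, G y) :
    ∃ t t' : ℝ → ℝ, Continuous t ∧ Continuous t' ∧ (∀ s, HasDerivAt t (t' s) s) ∧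
      t (-R) = -M ∧ t R = M ∧ (∀ s, 0 < t' s) ∧
      ∀ s ∈ Set.Icc (-R) R, F s = J * G (t s) * t' s := by
  obtain ⟨y₀, -, hy₀⟩ := (isCompact_Icc (a := -M) (b := M)).exists_isMinOn
    ⟨0, by constructor <;> linarith⟩ hG.continuousOn
  set clip : ℝ → ℝ → ℝ := fun r s => max (-r) (min r s) with hclip
  have clip_cont : ∀ r, Continuous (clip r) := fun r => by fun_prop
  have clip_mem : ∀ r, 0 < r → ∀ s, clip r s ∈ Set.Icc (-r) r := fun r hr s =>
    ⟨le_max_left _ _, max_le (by linarith) (min_le_left _ _)⟩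
  have clip_eq : ∀ r s, s ∈ Set.Icc (-r) r → clip r s = s := fun r s hs => by
    simp only [hclip]; rw [min_eq_right hs.2, max_eq_right hs.1]
  have hG1 : Continuous fun y => G (clip M y) := hG.comp (clip_cont M)
  have hG1m : ∀ y, G y₀ ≤ G (clip M y) := fun y => hy₀ (clip_mem M hM y)
  set Φ : ℝ → ℝ := fun y => ∫ z in (-M)..y, G (clip M z) with hΦ
  have hΦd : ∀ y, HasDerivAt Φ (G (clip M y)) y := fun y =>
    intervalIntegral.integral_hasDerivAt_right (hG1.intervalIntegrable _ _)
      (hG1.stronglyMeasurableAtFilter _ _) hG1.continuousAt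
  have hΦc : Continuous Φ := continuous_iff_continuousAt.2 fun y => (hΦd y).continuousAt
  have hΦm : StrictMono Φ := strictMono_of_deriv_pos fun y => by
    rw [(hΦd y).deriv]; exact hG0 _
  have hgrow : Monotone fun y => Φ y - G y₀ * y := by
    refine monotone_of_deriv_nonneg
      (fun y => ((hΦd y).sub ((hasDerivAt_id y).const_mul (G y₀))).differentiableAt) fun y => ?_
    have := ((hΦd y).sub ((hasDerivAt_id y).const_mul (G y₀))).deriv
    simp only [id_eq] at this
    erw [this]
    linarith [hG1m y]
  have htop : Tendsto Φ atTop atTop := by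
    refine tendsto_atTop_mono' (f₁ := fun y => G y₀ * y + (Φ 0 - G y₀ * 0)) _ ?_ ?_
    · filter_upwards [eventually_ge_atTop 0] with y hy
      have := hgrow hy
      simp only at this
      linarith
    · exact tendsto_atTop_add_const_right _ _ (tendsto_id.const_mul_atTop (hG0 y₀))
  have hbot : Tendsto Φ atBot atBot := by
    refine tendsto_atBot_mono' (f₂ := Φ) (f₁ := fun y => G y₀ * y + (Φ 0 - G y₀ * 0)) _ ?_ ?_
    · filter_upwards [eventually_le_atBot 0] with y hy
      have := hgrow hy
      simp only at this
      linarith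
    · exact tendsto_atBot_add_const_right _ _ (tendsto_id.const_mul_atBot (hG0 y₀))
  have hsurj : Function.Surjective Φ := hΦc.surjective htop hbot
  set e : ℝ ≃o ℝ := hΦm.orderIsoOfSurjective Φ hsurj with he
  have heΦ : ∀ y, e y = Φ y := fun y => rfl
  set K : ℝ → ℝ := fun s => (∫ z in (-R)..s, F z) / J with hK
  have hKd : ∀ s, HasDerivAt K (F s / J) s := fun s =>
    (intervalIntegral.integral_hasDerivAt_right (hF.intervalIntegrable _ _)
      (hF.stronglyMeasurableAtFilter _ _) hF.continuousAt).div_const J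
  have hKc : Continuous K := continuous_iff_continuousAt.2 fun y => (hKd y).continuousAt
  have hinv : Continuous e.symm := e.symm.continuous
  have hte : ∀ s, Φ (e.symm s) = s := fun s => e.apply_symm_apply s
  have htd : ∀ s, HasDerivAt (fun s => e.symm (K s)) (F s / J / G (clip M (e.symm (K s)))) s := by
    intro s
    have h1 := HasDerivAt.of_local_left_inverse (f := Φ) (g := e.symm) hinv.continuousAt
      (hΦd (e.symm (K s))) (hG0 _).ne' (Eventually.of_forall hte)
    exact (h1.comp s (hKd s)).congr_deriv (div_eq_inv_mul _ _).symm
  have htc : Continuous fun s => e.symm (K s) := hinv.comp hKc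
  have hL : e.symm (K (-R)) = -M := by
    rw [OrderIso.symm_apply_eq, heΦ]; simp [hK, hΦ]
  have hRt : e.symm (K R) = M := by
    rw [OrderIso.symm_apply_eq, heΦ]
    simp only [hK, hΦ]
    rw [hFG, mul_div_cancel_left₀ _ hJ.ne']
    refine intervalIntegral.integral_congr fun y hy => ?_
    rw [Set.uIcc_of_le (by linarith)] at hy
    simp only [clip_eq M y hy]
  have hKm : Monotone fun s => e.symm (K s) := by
    refine e.symm.monotone.comp ?_
    refine monotone_of_deriv_nonneg (fun s => (hKd s).differentiableAt) fun s => ?_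
    rw [(hKd s).deriv]; exact (div_pos (hF0 s) hJ).le
  refine ⟨fun s => e.symm (K s), fun s => F s / J / G (clip M (e.symm (K s))), htc, ?_, htd, hL,
    hRt, fun s => div_pos (div_pos (hF0 s) hJ) (hG0 _), fun s hs => ?_⟩
  · exact (hF.div_const J).div (hG1.comp htc) fun s => (hG0 _).ne'
  · have hmem : e.symm (K s) ∈ Set.Icc (-M) M := by
      constructor
      · rw [← hL]; exact hKm hs.1
      · rw [← hRt]; exact hKm hs.2
    simp only [clip_eq M _ hmem]
    have := (hG0 (e.symm (K s))).ne'
    field_simp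

/-- Partial derivative along the `i`-th coordinate. -/
def partialDeriv {n : ℕ} (w : (Fin n → ℝ) → ℝ) (i : Fin n) (x : Fin n → ℝ) : ℝ :=
  fderiv ℝ w x (Pi.single i 1)

lemma continuous_partialDeriv {n : ℕ} {w : (Fin n → ℝ) → ℝ} (hw : ContDiff ℝ 1 w) (i : Fin n) :
    Continuous (partialDeriv w i) :=
  (hw.continuous_fderiv one_ne_zero).clm_apply continuous_const

lemma hasFDerivAt_cons {n : ℕ} (s : ℝ) (x : Fin n → ℝ) :
    HasFDerivAt (fun x : Fin n → ℝ => (Fin.cons s x : Fin (n + 1) → ℝ))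
      (ContinuousLinearMap.pi fun i => Fin.cases (0 : (Fin n → ℝ) →L[ℝ] ℝ)
        (fun j => ContinuousLinearMap.proj j) i) x := by
  rw [hasFDerivAt_pi]
  refine Fin.cases ?_ fun j => ?_
  · simpa using hasFDerivAt_const s x
  · simpa using hasFDerivAt_apply (𝕜 := ℝ) j x

lemma contDiff_cons {n : ℕ} (s : ℝ) :
    ContDiff ℝ 1 (fun x : Fin n → ℝ => (Fin.cons s x : Fin (n + 1) → ℝ)) := by
  rw [contDiff_pi]
  refine Fin.cases ?_ fun j => ?_
  · simpa using contDiff_const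
  · simpa using contDiff_apply ℝ ℝ j

lemma partialDeriv_cons {n : ℕ} {w : (Fin (n + 1) → ℝ) → ℝ} (hw : ContDiff ℝ 1 w) (s : ℝ)
    (i : Fin n) (x : Fin n → ℝ) :
    partialDeriv (fun x => w (Fin.cons s x)) i x = partialDeriv w i.succ (Fin.cons s x) := by
  have h1 : HasFDerivAt w (fderiv ℝ w (Fin.cons s x)) (Fin.cons s x) :=
    (hw.differentiable one_ne_zero _).hasFDerivAt
  have h2 := h1.comp x (hasFDerivAt_cons s x)
  rw [partialDeriv, partialDeriv]
  erw [h2.fderiv]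
  rw [ContinuousLinearMap.comp_apply]
  congr 1
  ext k
  refine Fin.cases ?_ (fun j => ?_) k
  · simp
  · by_cases h : j = i
    · subst h; simp
    · simp [h]

lemma hasDerivAt_cons_left {n : ℕ} {w : (Fin (n + 1) → ℝ) → ℝ} (hw : ContDiff ℝ 1 w) (s : ℝ)
    (x : Fin n → ℝ) :
    HasDerivAt (fun s => w (Fin.cons s x)) (partialDeriv w 0 (Fin.cons s x)) s := by
  have h1 : HasFDerivAt w (fderiv ℝ w (Fin.cons s x)) (Fin.cons s x) :=
    (hw.differentiable one_ne_zero _).hasFDerivAt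
  have h2 : HasDerivAt (fun s => (Fin.cons s x : Fin (n + 1) → ℝ)) (Pi.single 0 1) s := by
    rw [hasDerivAt_pi]
    refine Fin.cases ?_ fun j => ?_
    · simpa using hasDerivAt_id' s
    · simpa using hasDerivAt_const s (x j)
  exact h1.comp_hasDerivAt s h2

/-- Integration by parts in the first coordinate against a function of that coordinate. -/
lemma setIntegral_cube_deriv_mul_cube {n : ℕ} {w : (Fin (n + 1) → ℝ) → ℝ} (hw : ContDiff ℝ 1 w)
    {R M ε : ℝ} (hR : 0 < R) (hbd : ∀ x i, |x i| = R → w x = ε) {t t' : ℝ → ℝ}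
    (ht : Continuous t) (ht' : Continuous t') (htd : ∀ s, HasDerivAt t (t' s) s)
    (htl : t (-R) = -M) (htr : t R = M) :
    ∫ x in cube (n + 1) R, t' (x 0) * w x ^ 3 =
      2 * M * ε ^ 3 * (2 * R) ^ n
        - ∫ x in cube (n + 1) R, t (x 0) * (3 * w x ^ 2 * partialDeriv w 0 x) := by
  have hwc := hw.continuous
  have hpc := continuous_partialDeriv hw 0
  rw [setIntegral_cube_succ_swap hR (by fun_prop), setIntegral_cube_succ_swap hR (by fun_prop)]
  have key : ∀ x : Fin n → ℝ, ∫ s in (-R)..R,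
      t' ((Fin.cons s x : Fin (n + 1) → ℝ) 0) * w (Fin.cons s x) ^ 3 = 2 * M * ε ^ 3
      - ∫ s in (-R)..R, t ((Fin.cons s x : Fin (n + 1) → ℝ) 0) *
        (3 * w (Fin.cons s x) ^ 2 * partialDeriv w 0 (Fin.cons s x)) := by
    intro x
    have hcx : Continuous fun s : ℝ => (Fin.cons s x : Fin (n + 1) → ℝ) :=
      (continuous_cons_uncurry n).comp (Continuous.prodMk_left x)
    have hd : ∀ s, HasDerivAt (fun s => w (Fin.cons s x) ^ 3)
        (3 * w (Fin.cons s x) ^ 2 * partialDeriv w 0 (Fin.cons s x)) s := fun s => by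
      simpa using (hasDerivAt_cons_left hw s x).fun_pow 3
    have hi : Continuous fun s => 3 * w (Fin.cons s x) ^ 2 * partialDeriv w 0 (Fin.cons s x) :=
      (continuous_const.mul ((hwc.comp hcx).pow 2)).mul (hpc.comp hcx)
    have := intervalIntegral.integral_mul_deriv_eq_deriv_mul (a := -R) (b := R)
      (fun s _ => htd s) (fun s _ => hd s)
      (ht'.intervalIntegrable _ _) (hi.intervalIntegrable _ _)
    have e1 : w (Fin.cons R x) = ε := hbd _ 0 (by simp [abs_of_pos hR])
    have e2 : w (Fin.cons (-R) x) = ε := hbd _ 0 (by simp [abs_of_pos hR])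
    rw [e1, e2, htl, htr] at this
    simp only [Fin.cons_zero]
    linarith
  simp_rw [key]
  rw [integral_sub]
  · simp [volume_real_cube n hR]
    ring
  · exact integrableOn_cube R continuous_const
  · refine integrableOn_cube R ?_
    refine intervalIntegral.continuous_parametric_intervalIntegral_of_continuous' ?_ _ _
    have : Continuous fun z : (Fin n → ℝ) × ℝ => (Fin.cons z.2 z.1 : Fin (n + 1) → ℝ) :=
      (continuous_cons_uncurry n).comp continuous_swap
    simp only [Function.uncurry_def, Fin.cons_zero]
    exact (ht.comp continuous_snd).mul
      ((continuous_const.mul ((hwc.comp this).pow 2)).mul (hpc.comp this))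

/-- Sobolev-type inequality on cubes obtained by iterating one-dimensional monotone transport. -/
lemma transport_inequality {R M κ ε : ℝ} (hR : 0 < R) (hM : 0 < M) (hκ : 0 < κ) (n : ℕ) :
    ∀ w v : (Fin n → ℝ) → ℝ, ContDiff ℝ 1 w → Continuous v → (∀ x, 0 < w x) → (∀ x, 0 < v x) →
    (∀ x i, |x i| = R → w x = ε) → ∀ σ J : ℝ, 0 ≤ σ → 0 < J →
    (∀ t : Fin n → ℝ, (∀ i, 0 < t i) → 4 ^ 4 * (J * ∏ i, t i) ≤ (σ + ∑ i, t i) ^ 4) →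
    ∫ x in cube n R, w x ^ 4 = J * ∫ x in cube n M, v x ^ 4 →
    4 * J * ∫ x in cube n M, v x ^ 3 ≤ σ * (∫ x in cube n R, w x ^ 3)
      + 3 / (2 * κ) * (∫ x in cube n R, ∑ i, partialDeriv w i x ^ 2)
      + 3 * κ / 2 * J * (∫ x in cube n M, v x ^ 4 * ∑ i, x i ^ 2)
      + n * (2 * M * ε ^ 3) * (2 * R) ^ n / (2 * R) := by
  induction n with
  | zero =>
    intro w v _ _ hw0 hv0 _ σ J hσ hJ hσJ hmass
    have hc : ∀ r : ℝ, cube 0 r = Set.univ := fun r => by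
      ext x; simp [cube]
    simp only [hc, Measure.restrict_univ] at hmass ⊢
    simp only [Measure.volume_pi_eq_dirac (default : Fin 0 → ℝ), integral_dirac] at hmass ⊢
    have h := hσJ default (fun i => i.elim0)
    simp at h
    simp only [Finset.univ_eq_empty, Finset.sum_empty]
    set a := w default
    set b := v default
    have ha : 0 < a := hw0 _
    have hb : 0 < b := hv0 _
    have h4 : (4 * J * b ^ 3) ^ 4 ≤ (σ * a ^ 3) ^ 4 := by
      calc (4 * J * b ^ 3) ^ 4 = 4 ^ 4 * J * (J * b ^ 4) ^ 3 := by ring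
        _ = 4 ^ 4 * J * (a ^ 4) ^ 3 := by rw [hmass]
        _ ≤ σ ^ 4 * (a ^ 4) ^ 3 := by gcongr
        _ = _ := by ring
    have := (pow_le_pow_iff_left₀ (by positivity) (by positivity) four_ne_zero).1 h4
    simpa using this
  | succ n ih =>
    intro w v hw hv hw0 hv0 hbd σ J hσ hJ hσJ hmass
    have hwc := hw.continuous
    have hpc := fun i => continuous_partialDeriv hw i
    have hcs := continuous_cons_uncurry n
    have hcons : ∀ s : ℝ, Continuous fun x : Fin n → ℝ => (Fin.cons s x : Fin (n + 1) → ℝ) :=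
      fun s => hcs.comp (Continuous.prodMk_right s)
    have hw4 : Continuous fun x => w x ^ 4 := hwc.pow 4
    have hw3 : Continuous fun x => w x ^ 3 := hwc.pow 3
    have hv4 : Continuous fun x => v x ^ 4 := hv.pow 4
    have hv3 : Continuous fun x => v x ^ 3 := hv.pow 3
    have hE' : Continuous fun x => ∑ i : Fin n, partialDeriv w i.succ x ^ 2 :=
      continuous_finsetSum _ fun i _ => (hpc i.succ).pow 2
    have hC' : Continuous fun x : Fin (n + 1) → ℝ => v x ^ 4 * ∑ i : Fin n, x i.succ ^ 2 := by
      fun_prop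
    rw [setIntegral_cube_succ hR hw4, setIntegral_cube_succ hM hv4] at hmass
    have hF := continuous_setIntegral_cube_cons R hw4
    have hG := continuous_setIntegral_cube_cons M hv4
    have hA := continuous_setIntegral_cube_cons M hv3
    have hH := continuous_setIntegral_cube_cons R hw3
    have hE := continuous_setIntegral_cube_cons R hE'
    have hC := continuous_setIntegral_cube_cons M hC'
    obtain ⟨t, t', ht, ht', htd, htl, htr, ht0, hFG⟩ := exists_monotone_transport hF hG
      (fun s => setIntegral_cube_pos hR (hw4.comp (hcons s)) fun x => pow_pos (hw0 _) 4)
      (fun s => setIntegral_cube_pos hM (hv4.comp (hcons s)) fun x => pow_pos (hv0 _) 4)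
      hM hJ hmass
    set A := fun y => ∫ x in cube n M, v (Fin.cons y x) ^ 3 with hAdef
    set H := fun s => ∫ x in cube n R, w (Fin.cons s x) ^ 3 with hHdef
    set E := fun s => ∫ x in cube n R, ∑ i : Fin n, partialDeriv w i.succ (Fin.cons s x) ^ 2
      with hEdef
    set C := fun y => ∫ x in cube n M, v (Fin.cons y x) ^ 4 *
      ∑ i : Fin n, (Fin.cons y x : Fin (n + 1) → ℝ) i.succ ^ 2 with hCdef
    set F := fun s => ∫ x in cube n R, w (Fin.cons s x) ^ 4 with hFdef
    set G := fun y => ∫ x in cube n M, v (Fin.cons y x) ^ 4 with hGdef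
    set b : ℝ := n * (2 * M * ε ^ 3) * (2 * R) ^ n / (2 * R) with hb
    have hslice : ∀ s ∈ Set.Icc (-R) R, 4 * J * (A (t s) * t' s) ≤ σ * H s + t' s * H s +
        3 / (2 * κ) * E s + 3 * κ / 2 * J * (C (t s) * t' s) + b := by
      intro s hs
      have := ih (fun x => w (Fin.cons s x)) (fun x => v (Fin.cons (t s) x))
        (hw.comp (contDiff_cons s)) (hv.comp (hcons _)) (fun x => hw0 _) (fun x => hv0 _)
        (fun x i hx => hbd _ i.succ (by simpa using hx)) (σ + t' s) (J * t' s)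
        (by linarith [ht0 s]) (mul_pos hJ (ht0 s))
        (fun τ hτ => by
          have := hσJ (Fin.cons (t' s) τ) (Fin.cases (by simpa using ht0 s) (by simpa using hτ))
          rw [Fin.prod_univ_succ, Fin.sum_univ_succ] at this
          simp only [Fin.cons_zero, Fin.cons_succ] at this
          rw [mul_assoc, add_assoc]; exact this)
        (by have := hFG s hs; linarith)
      simp only [partialDeriv_cons hw] at this
      simp only [hAdef, hHdef, hEdef, hCdef, Fin.cons_succ]
      linarith
    have hInt : ∫ s in (-R)..R, 4 * J * (A (t s) * t' s) ≤ ∫ s in (-R)..R, (σ * H s + t' s * H s +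
        3 / (2 * κ) * E s + 3 * κ / 2 * J * (C (t s) * t' s) + b) := by
      refine intervalIntegral.integral_mono_on (by linarith) ?_ ?_ hslice
      · exact Continuous.intervalIntegrable (by fun_prop) _ _
      · exact Continuous.intervalIntegrable (by fun_prop) _ _
    have subst : ∀ K : ℝ → ℝ, Continuous K →
        ∫ s in (-R)..R, K (t s) * t' s = ∫ y in (-M)..M, K y := fun K hK => by
      have := intervalIntegral.integral_comp_mul_deriv (a := -R) (b := R) (fun s _ => htd s)
        ht'.continuousOn hK
      rwa [htl, htr] at this
    have i1 : IntervalIntegrable (fun s => σ * H s) volume (-R) R :=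
      Continuous.intervalIntegrable (by fun_prop) _ _
    have i2 : IntervalIntegrable (fun s => t' s * H s) volume (-R) R :=
      Continuous.intervalIntegrable (by fun_prop) _ _
    have i3 : IntervalIntegrable (fun s => 3 / (2 * κ) * E s) volume (-R) R :=
      Continuous.intervalIntegrable (by fun_prop) _ _
    have i4 : IntervalIntegrable (fun s => 3 * κ / 2 * J * (C (t s) * t' s)) volume (-R) R :=
      Continuous.intervalIntegrable (by fun_prop) _ _
    rw [intervalIntegral.integral_add (((i1.add i2).add i3).add i4) (by simp),
      intervalIntegral.integral_add ((i1.add i2).add i3) i4,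
      intervalIntegral.integral_add (i1.add i2) i3, intervalIntegral.integral_add i1 i2] at hInt
    simp only [intervalIntegral.integral_const_mul, intervalIntegral.integral_const] at hInt
    rw [subst A hA, subst C hC] at hInt
    have eA := setIntegral_cube_succ hM hv3
    have eH := setIntegral_cube_succ hR hw3
    have eE := setIntegral_cube_succ hR hE'
    have eC := setIntegral_cube_succ hM hC'
    rw [← hAdef] at eA
    have etH : ∫ s in (-R)..R, t' s * H s = ∫ x in cube (n + 1) R, t' (x 0) * w x ^ 3 := by
      rw [setIntegral_cube_succ hR (by fun_prop)]
      simp [hHdef, integral_const_mul]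
    have eT : ∫ x in cube (n + 1) R, t (x 0) ^ 2 * w x ^ 4 =
        J * ∫ x in cube (n + 1) M, v x ^ 4 * x 0 ^ 2 := by
      rw [setIntegral_cube_succ hR (by fun_prop), setIntegral_cube_succ hM (by fun_prop)]
      simp only [Fin.cons_zero, integral_const_mul, integral_mul_const]
      rw [← subst (fun y => (∫ x in cube n M, v (Fin.cons y x) ^ 4) * y ^ 2)
        (hG.mul (continuous_id.pow 2)), ← intervalIntegral.integral_const_mul]
      refine intervalIntegral.integral_congr fun s hs => ?_
      rw [Set.uIcc_of_le (by linarith)] at hs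
      have := hFG s hs
      rw [this]; ring
    have hyoung : -∫ x in cube (n + 1) R, t (x 0) * (3 * w x ^ 2 * partialDeriv w 0 x) ≤
        3 / (2 * κ) * (∫ x in cube (n + 1) R, partialDeriv w 0 x ^ 2) +
        3 * κ / 2 * ∫ x in cube (n + 1) R, t (x 0) ^ 2 * w x ^ 4 := by
      have hp0 := hpc 0
      rw [← integral_neg, ← integral_const_mul, ← integral_const_mul,
        ← integral_add (integrableOn_cube R (by fun_prop)) (integrableOn_cube R (by fun_prop))]
      refine setIntegral_mono (integrableOn_cube R (by fun_prop))
        (integrableOn_cube R (by fun_prop)) fun x => ?_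
      have h0 : 0 ≤ 3 / (2 * κ) * (partialDeriv w 0 x + κ * t (x 0) * w x ^ 2) ^ 2 := by positivity
      have h1 : 3 / (2 * κ) * (partialDeriv w 0 x + κ * t (x 0) * w x ^ 2) ^ 2 =
        3 / (2 * κ) * partialDeriv w 0 x ^ 2 + 3 * κ / 2 * (t (x 0) ^ 2 * w x ^ 4)
          + t (x 0) * (3 * w x ^ 2 * partialDeriv w 0 x) := by
        field_simp; ring
      simp only
      linarith
    have sE : ∫ x in cube (n + 1) R, ∑ i, partialDeriv w i x ^ 2 =
        (∫ x in cube (n + 1) R, partialDeriv w 0 x ^ 2) +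
          ∫ x in cube (n + 1) R, ∑ i : Fin n, partialDeriv w i.succ x ^ 2 := by
      rw [← integral_add (integrableOn_cube R (h := fun x => partialDeriv w 0 x ^ 2) ((hpc 0).pow 2))
        (integrableOn_cube R hE')]
      simp only [Fin.sum_univ_succ]
    have sC : ∫ x in cube (n + 1) M, v x ^ 4 * ∑ i, x i ^ 2 =
        (∫ x in cube (n + 1) M, v x ^ 4 * x 0 ^ 2) +
          ∫ x in cube (n + 1) M, v x ^ 4 * ∑ i : Fin n, x i.succ ^ 2 := by
      rw [← integral_add (integrableOn_cube M (by fun_prop)) (integrableOn_cube M hC')]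
      simp only [Fin.sum_univ_succ, mul_add]
    have hibp := setIntegral_cube_deriv_mul_cube hw hR hbd ht ht' htd htl htr
    rw [sE, sC, eA, eH, eE, eC]
    rw [etH, hibp] at hInt
    rw [eT] at hyoung
    have eb : ((n + 1 : ℕ) : ℝ) * (2 * M * ε ^ 3) * (2 * R) ^ (n + 1) / (2 * R) =
        2 * M * ε ^ 3 * (2 * R) ^ n + (R - -R) * b := by
      rw [hb]; push_cast; field_simp; ring
    rw [eb]
    simp only [smul_eq_mul] at hInt
    linarith

/-- The area of the unit sphere of `ℝ⁴`. -/
def sphereArea : ℝ := 4 * (volume : Measure (Euc 4)).real (Metric.ball 0 1)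

lemma sphereArea_pos : 0 < sphereArea := by
  refine mul_pos four_pos (ENNReal.toReal_pos ?_ measure_ball_lt_top.ne)
  exact (Metric.measure_ball_pos volume _ one_pos).ne'

lemma integral_radial (f : ℝ → ℝ) :
    ∫ x : Euc 4, f ‖x‖ = sphereArea * ∫ y in Set.Ioi (0 : ℝ), y ^ 3 * f y := by
  rw [integral_fun_norm_addHaar]
  simp [sphereArea, mul_assoc]

lemma integrable_radial_iff {f : ℝ → ℝ} :
    Integrable (fun x : Euc 4 => f ‖x‖) ↔
      IntegrableOn (fun y : ℝ => y ^ 3 * f y) (Set.Ioi (0 : ℝ)) := by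
  rw [integrable_fun_norm_addHaar]
  simp

lemma tendsto_inv_add_sq (ε : ℝ) : Tendsto (fun y : ℝ => ε / (ε + y ^ 2)) atTop (𝓝 0) :=
  Tendsto.const_div_atTop
    (tendsto_atTop_add_const_left _ _ (tendsto_pow_atTop two_ne_zero)) _

lemma tendsto_sq_div_add_sq {ε : ℝ} (hε : 0 < ε) :
    Tendsto (fun y : ℝ => y ^ 2 / (ε + y ^ 2)) atTop (𝓝 1) := by
  have := (tendsto_inv_add_sq ε).const_sub 1
  rw [sub_zero] at this
  refine this.congr fun y => ?_
  have : 0 < ε + y ^ 2 := by positivity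
  field_simp
  ring

lemma bubble_pow_four {ε : ℝ} (hε : 0 < ε) :
    Integrable (fun x : Euc 4 => 1 / (ε + ‖x‖ ^ 2) ^ 4) ∧
      ∫ x : Euc 4, 1 / (ε + ‖x‖ ^ 2) ^ 4 = sphereArea / (12 * ε ^ 2) := by
  set P : ℝ → ℝ := fun y => (y ^ 6 + 3 * ε * y ^ 4) / (12 * ε ^ 2 * (ε + y ^ 2) ^ 3) with hP
  have hd : ∀ y ∈ Set.Ici (0 : ℝ), HasDerivAt P (y ^ 3 * (1 / (ε + y ^ 2) ^ 4)) y := by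
    intro y _
    have h0 : 0 < ε + y ^ 2 := by positivity
    have h1 : HasDerivAt (fun y : ℝ => y ^ 6 + 3 * ε * y ^ 4) (6 * y ^ 5 + 3 * ε * (4 * y ^ 3)) y := by
      simpa using (hasDerivAt_pow 6 y).fun_add ((hasDerivAt_pow 4 y).const_mul (3 * ε))
    have h2 : HasDerivAt (fun y : ℝ => 12 * ε ^ 2 * (ε + y ^ 2) ^ 3)
        (12 * ε ^ 2 * (3 * (ε + y ^ 2) ^ 2 * (2 * y))) y := by
      simpa using (((hasDerivAt_pow 2 y).const_add ε).fun_pow 3).const_mul (12 * ε ^ 2)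
    refine (h1.div h2 (by positivity)).congr_deriv ?_
    field_simp
    ring
  have hnn : ∀ y ∈ Set.Ioi (0 : ℝ), 0 ≤ y ^ 3 * (1 / (ε + y ^ 2) ^ 4) := fun y hy => by
    have : (0 : ℝ) < y := hy
    positivity
  have hl : Tendsto P atTop (𝓝 (1 / (12 * ε ^ 2))) := by
    have h1 := tendsto_sq_div_add_sq hε
    have h2 := tendsto_inv_add_sq ε
    have := (((h1.pow 3).add (((h1.pow 2).mul h2).const_mul 3))).const_mul (1 / (12 * ε ^ 2))
    simp only [one_pow, mul_zero, add_zero, mul_one] at this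
    refine this.congr fun y => ?_
    have h0 : 0 < ε + y ^ 2 := by positivity
    simp only [hP]
    field_simp
  refine ⟨(integrable_radial_iff (f := fun y => 1 / (ε + y ^ 2) ^ 4)).2
    (integrableOn_Ioi_deriv_of_nonneg' hd hnn hl), ?_⟩
  rw [integral_radial (fun y => 1 / (ε + y ^ 2) ^ 4), integral_Ioi_of_hasDerivAt_of_nonneg' hd hnn hl]
  simp [hP]
  field_simp

lemma bubble_sq_mul_pow_four {ε : ℝ} (hε : 0 < ε) :
    Integrable (fun x : Euc 4 => ‖x‖ ^ 2 / (ε + ‖x‖ ^ 2) ^ 4) ∧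
      ∫ x : Euc 4, ‖x‖ ^ 2 / (ε + ‖x‖ ^ 2) ^ 4 = sphereArea / (6 * ε) := by
  set P : ℝ → ℝ := fun y => y ^ 6 / (6 * ε * (ε + y ^ 2) ^ 3) with hP
  have hd : ∀ y ∈ Set.Ici (0 : ℝ), HasDerivAt P (y ^ 3 * (y ^ 2 / (ε + y ^ 2) ^ 4)) y := by
    intro y _
    have h0 : 0 < ε + y ^ 2 := by positivity
    have h1 : HasDerivAt (fun y : ℝ => y ^ 6) (6 * y ^ 5) y := by
      simpa using hasDerivAt_pow 6 y
    have h2 : HasDerivAt (fun y : ℝ => 6 * ε * (ε + y ^ 2) ^ 3)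
        (6 * ε * (3 * (ε + y ^ 2) ^ 2 * (2 * y))) y := by
      simpa using (((hasDerivAt_pow 2 y).const_add ε).fun_pow 3).const_mul (6 * ε)
    refine (h1.div h2 (by positivity)).congr_deriv ?_
    field_simp
    ring
  have hnn : ∀ y ∈ Set.Ioi (0 : ℝ), 0 ≤ y ^ 3 * (y ^ 2 / (ε + y ^ 2) ^ 4) := fun y hy => by
    have : (0 : ℝ) < y := hy
    positivity
  have hl : Tendsto P atTop (𝓝 (1 / (6 * ε))) := by
    have := ((tendsto_sq_div_add_sq hε).pow 3).const_mul (1 / (6 * ε))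
    simp only [one_pow, mul_one] at this
    refine this.congr fun y => ?_
    have h0 : 0 < ε + y ^ 2 := by positivity
    simp only [hP]
    field_simp
  refine ⟨(integrable_radial_iff (f := fun y => y ^ 2 / (ε + y ^ 2) ^ 4)).2
    (integrableOn_Ioi_deriv_of_nonneg' hd hnn hl), ?_⟩
  rw [integral_radial (fun y => y ^ 2 / (ε + y ^ 2) ^ 4),
    integral_Ioi_of_hasDerivAt_of_nonneg' hd hnn hl]
  simp [hP]
  field_simp

lemma tendsto_setIntegral_cube {n : ℕ} {h : (Fin n → ℝ) → ℝ} (hh : Integrable h) :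
    Tendsto (fun k : ℕ => ∫ x in cube n (k + 1), h x) atTop (𝓝 (∫ x, h x)) := by
  have hU : ⋃ k : ℕ, cube n (k + 1) = Set.univ := by
    refine Set.eq_univ_of_forall fun x => Set.mem_iUnion.2 ?_
    obtain ⟨k, hk⟩ := exists_nat_ge ‖x‖
    refine ⟨k, ?_⟩
    have := fun i => abs_le.1 ((Real.norm_eq_abs (x i) ▸ norm_le_pi_norm x i).trans hk)
    exact ⟨fun i => by linarith [(this i).1], fun i => by linarith [(this i).2]⟩
  have := tendsto_setIntegral_of_monotone (μ := volume) (f := h) (s := fun k : ℕ => cube n (k + 1))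
    (fun k => measurableSet_cube n _) (fun k l hkl => ?_) (by rw [hU]; exact hh.integrableOn)
  · rwa [hU, Measure.restrict_univ] at this
  · have : (k : ℝ) ≤ l := by exact_mod_cast hkl
    exact Set.Icc_subset_Icc (fun i => by linarith) (fun i => by linarith)

lemma integral_comp_toLp {n : ℕ} (h : Euc n → ℝ) :
    ∫ y : Fin n → ℝ, h (WithLp.toLp 2 y) = ∫ x, h x :=
  (PiLp.volume_preserving_toLp (Fin n)).integral_comp
    (MeasurableEquiv.toLp 2 (Fin n → ℝ)).measurableEmbedding h

lemma integrable_comp_toLp {n : ℕ} {h : Euc n → ℝ} (hh : Integrable h) :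
    Integrable fun y : Fin n → ℝ => h (WithLp.toLp 2 y) :=
  ((PiLp.volume_preserving_toLp (Fin n)).integrable_comp_emb
    (MeasurableEquiv.toLp 2 (Fin n → ℝ)).measurableEmbedding).2 hh

lemma norm_toLp_sq {n : ℕ} (y : Fin n → ℝ) : ‖WithLp.toLp 2 y‖ ^ 2 = ∑ i, y i ^ 2 := by
  simp [EuclideanSpace.norm_sq_eq]

lemma sum_partialDeriv_sq {n : ℕ} {u : Euc n → ℝ} (hu : Differentiable ℝ u) (y : Fin n → ℝ) :
    ∑ i, partialDeriv (fun y => u (WithLp.toLp 2 y)) i y ^ 2 =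
      ‖gradient u (WithLp.toLp 2 y)‖ ^ 2 := by
  rw [← (EuclideanSpace.basisFun (Fin n) ℝ).sum_sq_norm_inner_right]
  refine Finset.sum_congr rfl fun i _ => ?_
  have h1 : HasFDerivAt (fun y : Fin n → ℝ => (WithLp.toLp 2 y : Euc n))
      ((PiLp.continuousLinearEquiv 2 ℝ (fun _ : Fin n => ℝ)).symm : (Fin n → ℝ) →L[ℝ] Euc n) y :=
    ((PiLp.continuousLinearEquiv 2 ℝ (fun _ : Fin n => ℝ)).symm).hasFDerivAt
  have h2 := (hu (WithLp.toLp 2 y)).hasFDerivAt.comp y h1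
  rw [partialDeriv]
  erw [h2.fderiv]
  rw [Real.norm_eq_abs, sq_abs, real_inner_comm]
  congr 1
  rw [gradient, InnerProductSpace.toDual_symm_apply]
  simp

lemma four_pow_four_mul_prod_le (t : Fin 4 → ℝ) (ht : ∀ i, 0 < t i) :
    4 ^ 4 * (1 * ∏ i, t i) ≤ (0 + ∑ i, t i) ^ 4 := by
  simp only [Fin.prod_univ_four, Fin.sum_univ_four, one_mul, zero_add]
  have h0 := ht 0
  have h1 := ht 1
  have h2 := ht 2
  have h3 := ht 3
  set a := t 0
  set b := t 1
  set c := t 2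
  set d := t 3
  have e1 : 4 * (a * b) ≤ (a + b) ^ 2 := by nlinarith [sq_nonneg (a - b)]
  have e2 : 4 * (c * d) ≤ (c + d) ^ 2 := by nlinarith [sq_nonneg (c - d)]
  have e3 : 4 * ((a + b) * (c + d)) ≤ (a + b + c + d) ^ 2 := by
    nlinarith [sq_nonneg (a + b - c - d)]
  calc 4 ^ 4 * (a * b * c * d) = 16 * ((4 * (a * b)) * (4 * (c * d))) := by ring
    _ ≤ 16 * ((a + b) ^ 2 * (c + d) ^ 2) := by gcongr
    _ = (4 * ((a + b) * (c + d))) ^ 2 := by ring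
    _ ≤ ((a + b + c + d) ^ 2) ^ 2 := by gcongr
    _ = _ := by ring

/-- The bubble `1 / (1 + |y|²)` in coordinates. -/
def bubble (y : Fin 4 → ℝ) : ℝ := 1 / (1 + ∑ i, y i ^ 2)

lemma bubble_pos (y : Fin 4 → ℝ) : 0 < bubble y := by
  rw [bubble]; positivity

lemma continuous_bubble : Continuous bubble := by
  refine continuous_const.div (by fun_prop) fun y => ?_
  positivity

lemma bubble_pow_three (y : Fin 4 → ℝ) :
    bubble y ^ 3 = bubble y ^ 4 + bubble y ^ 4 * ∑ i, y i ^ 2 := by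
  have : 0 < 1 + ∑ i, y i ^ 2 := by positivity
  rw [bubble]
  field_simp

lemma partialDeriv_sqrt_sq_le {n : ℕ} {f : (Fin n → ℝ) → ℝ} (hf : Differentiable ℝ f) {ε : ℝ}
    (hε : 0 < ε) (i : Fin n) (y : Fin n → ℝ) :
    partialDeriv (fun y => √(f y ^ 2 + ε ^ 2)) i y ^ 2 ≤ partialDeriv f i y ^ 2 := by
  have hpos : 0 < f y ^ 2 + ε ^ 2 := by positivity
  have h1 := ((((hf y).hasFDerivAt.pow 2).add_const (ε ^ 2)).sqrt hpos.ne').fderiv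
  rw [partialDeriv, partialDeriv]
  erw [h1]
  simp only [smul_apply, smul_eq_mul]
  set a := fderiv ℝ f y (Pi.single i 1)
  have hs : √(f y ^ 2 + ε ^ 2) ^ 2 = f y ^ 2 + ε ^ 2 := Real.sq_sqrt hpos.le
  have hs0 : 0 < √(f y ^ 2 + ε ^ 2) := Real.sqrt_pos.2 hpos
  have : (1 / (2 * √(f y ^ 2 + ε ^ 2)) * (2 • f y ^ (2 - 1) * a)) ^ 2 =
      f y ^ 2 / (f y ^ 2 + ε ^ 2) * a ^ 2 := by
    rw [← hs]; simp; field_simp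
  refine (le_of_eq ?_).trans (mul_le_of_le_one_left (sq_nonneg a)
    ((div_le_one hpos).2 (by nlinarith : f y ^ 2 ≤ f y ^ 2 + ε ^ 2)))
  rw [← this]

lemma sobolev_cube {f : (Fin 4 → ℝ) → ℝ} (hf : ContDiff ℝ 1 f) {R M : ℝ} (hR : 0 < R) (hM : 0 < M)
    (hbd : ∀ x i, |x i| = R → f x = 0) (hm : 0 < ∫ x in cube 4 R, f x ^ 4) :
    √((∫ x in cube 4 R, f x ^ 4) / ∫ x in cube 4 M, bubble x ^ 4) *
      (4 * (∫ x in cube 4 M, bubble x ^ 4) + ∫ x in cube 4 M, bubble x ^ 4 * ∑ i, x i ^ 2) ≤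
    3 / 4 * ∫ x in cube 4 R, ∑ i, partialDeriv f i x ^ 2 := by
  set m := ∫ x in cube 4 R, f x ^ 4
  set B := ∫ x in cube 4 M, bubble x ^ 4 with hBdef
  set C := ∫ x in cube 4 M, bubble x ^ 4 * ∑ i, x i ^ 2 with hCdef
  set D := ∫ x in cube 4 R, ∑ i, partialDeriv f i x ^ 2
  have hcb := continuous_bubble
  have hB : 0 < B := setIntegral_cube_pos hM (hcb.pow 4) fun x => pow_pos (bubble_pos x) 4
  have hC : 0 ≤ C := integral_nonneg fun x => by
    have := bubble_pos x
    positivity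
  have hA : ∫ x in cube 4 M, bubble x ^ 3 = B + C := by
    simp_rw [bubble_pow_three]
    exact integral_add (integrableOn_cube M (hcb.pow 4))
      (integrableOn_cube M (by fun_prop))
  set c₀ := √√(m / B) with hc₀def
  have hc₀ : 0 < c₀ := by positivity
  have hc₀2 : c₀ ^ 2 = √(m / B) := Real.sq_sqrt (Real.sqrt_nonneg _)
  have key : ∀ ε : ℝ, 0 < ε →
      c₀ * (c₀ ^ 2 * (4 * B + C) - 3 / 4 * D) ≤ 4 * (2 * M * ε ^ 3) * (2 * R) ^ 4 / (2 * R) := by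
    intro ε hε
    by_cases hneg : c₀ ^ 2 * (4 * B + C) - 3 / 4 * D ≤ 0
    · exact (mul_nonpos_of_nonneg_of_nonpos hc₀.le hneg).trans (by positivity)
    push Not at hneg
    set w : (Fin 4 → ℝ) → ℝ := fun y => √(f y ^ 2 + ε ^ 2) with hw
    have hpos : ∀ y, 0 < f y ^ 2 + ε ^ 2 := fun y => by positivity
    have hwC : ContDiff ℝ 1 w := ((hf.pow 2).add contDiff_const).sqrt fun y => (hpos y).ne'
    set W := ∫ x in cube 4 R, w x ^ 4 with hW
    have hmW : m ≤ W := by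
      refine integral_mono (integrableOn_cube R (hf.continuous.pow 4))
        (integrableOn_cube R (hwC.continuous.pow 4)) fun x => ?_
      have : w x ^ 4 = (f x ^ 2 + ε ^ 2) ^ 2 := by
        rw [← Real.sq_sqrt (hpos x).le, hw]; ring
      simp only
      rw [this]
      nlinarith [sq_nonneg (f x), sq_nonneg ε, mul_nonneg (sq_nonneg (f x)) (sq_nonneg ε)]
    have hW0 : 0 < W := hm.trans_le hmW
    set k := √√(W / B) with hk
    have hk0 : 0 < k := by positivity
    have hk4 : k ^ 4 * B = W := by
      have : k ^ 4 = W / B := by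
        rw [show k ^ 4 = (k ^ 2) ^ 2 by ring, hk, Real.sq_sqrt (Real.sqrt_nonneg _),
          Real.sq_sqrt (by positivity)]
      rw [this]; field_simp
    have hck : c₀ ≤ k := by
      rw [hc₀def, hk]; gcongr
    have T := transport_inequality hR hM (show 0 < 2 / k by positivity) 4 w (fun y => k * bubble y)
      hwC (continuous_const.mul hcb) (fun x => Real.sqrt_pos.2 (hpos x))
      (fun x => mul_pos hk0 (bubble_pos x)) (ε := ε)
      (fun x i hxi => by simp [hw, hbd x i hxi, hε.le]) 0 1 le_rfl one_pos
      four_pow_four_mul_prod_le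
      (by simp only [mul_pow]; rw [integral_const_mul, one_mul, ← hBdef, hk4])
    simp only [mul_pow, mul_assoc (k ^ 4)] at T
    rw [integral_const_mul, integral_const_mul, hA, ← hCdef] at T
    have hD : ∫ x in cube 4 R, ∑ i, partialDeriv w i x ^ 2 ≤ D := by
      refine integral_mono (integrableOn_cube R ?_) (integrableOn_cube R ?_) fun x => ?_
      · exact continuous_finsetSum _ fun i _ => (continuous_partialDeriv hwC i).pow 2
      · exact continuous_finsetSum _ fun i _ => (continuous_partialDeriv hf i).pow 2
      · exact Finset.sum_le_sum fun i _ =>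
          partialDeriv_sqrt_sq_le (hf.differentiable one_ne_zero) hε i x
    have e1 : 3 / (2 * (2 / k)) = 3 / 4 * k := by field_simp; norm_num
    have e2 : 3 * (2 / k) / 2 * 1 * (k ^ 4 * C) = 3 * k ^ 3 * C := by field_simp
    rw [e1, e2] at T
    have e3 : 3 / 4 * k * ∫ x in cube 4 R, ∑ i, partialDeriv w i x ^ 2 ≤ 3 / 4 * k * D := by
      gcongr
    have e4 : k * (k ^ 2 * (4 * B + C) - 3 / 4 * D) ≤
        4 * (2 * M * ε ^ 3) * (2 * R) ^ 4 / (2 * R) := by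
      push_cast at T
      simp only [zero_mul, zero_add, mul_one, mul_pow] at T ⊢
      linarith
    refine le_trans ?_ e4
    have : c₀ ^ 2 * (4 * B + C) ≤ k ^ 2 * (4 * B + C) := by gcongr
    exact mul_le_mul hck (by linarith) hneg.le hk0.le
  have hlim : Tendsto (fun ε : ℝ => 4 * (2 * M * ε ^ 3) * (2 * R) ^ 4 / (2 * R)) (𝓝[>] 0) (𝓝 0) := by
    have : Continuous fun ε : ℝ => 4 * (2 * M * ε ^ 3) * (2 * R) ^ 4 / (2 * R) := by fun_prop
    have h := (this.tendsto 0).mono_left (nhdsWithin_le_nhds (s := Set.Ioi 0))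
    simpa using h
  have h0 := ge_of_tendsto hlim (eventually_mem_nhdsWithin.mono fun ε hε => key ε hε)
  rw [← hc₀2]
  nlinarith [nonpos_of_mul_nonpos_right h0 hc₀]

/-- The sharp Sobolev inequality in dimension four. -/
lemma sobolev_sharp {u : Euc 4 → ℝ} (hu : ContDiff ℝ (⊤ : ℕ∞) u) (hs : HasCompactSupport u) :
    8 * √(sphereArea / 12) * √(∫ x, u x ^ 4) ≤ ∫ x, ‖gradient u x‖ ^ 2 := by
  have hDn : 0 ≤ ∫ x, ‖gradient u x‖ ^ 2 := integral_nonneg fun x => by positivity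
  rcases (integral_nonneg fun x => by positivity : 0 ≤ ∫ x, u x ^ 4).eq_or_lt with hm | hm
  · rw [← hm]; simpa using hDn
  obtain ⟨R, hR, hRs⟩ := hs.isCompact.isBounded.exists_pos_norm_lt
  set f : (Fin 4 → ℝ) → ℝ := fun y => u (WithLp.toLp 2 y) with hfdef
  have hu1 : ContDiff ℝ 1 u := hu.of_le (by exact_mod_cast le_top)
  have hf : ContDiff ℝ 1 f := hu1.comp (PiLp.contDiff_toLp)
  have hz : ∀ y : Fin 4 → ℝ, ∀ i, R ≤ |y i| → WithLp.toLp 2 y ∉ tsupport u := by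
    intro y i hi hy
    have h1 := hRs _ hy
    have h2 := PiLp.norm_apply_le (WithLp.toLp 2 y : Euc 4) i
    simp only [Real.norm_eq_abs] at h2
    linarith
  have hout : ∀ y, y ∉ cube 4 R → WithLp.toLp 2 y ∉ tsupport u := by
    intro y hy hmem
    apply hy
    have : ∀ i, |y i| ≤ R := fun i => le_of_not_ge fun h => hz y i h hmem
    exact ⟨fun i => (abs_le.1 (this i)).1, fun i => (abs_le.1 (this i)).2⟩
  have hm' : ∫ x in cube 4 R, f x ^ 4 = ∫ x, u x ^ 4 := by
    rw [← integral_comp_toLp fun x => u x ^ 4]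
    refine setIntegral_eq_integral_of_forall_compl_eq_zero fun y hy => ?_
    simp [hfdef, image_eq_zero_of_notMem_tsupport (hout y hy)]
  have hD' : ∫ x in cube 4 R, ∑ i, partialDeriv f i x ^ 2 = ∫ x, ‖gradient u x‖ ^ 2 := by
    rw [← integral_comp_toLp fun x => ‖gradient u x‖ ^ 2]
    simp_rw [hfdef, sum_partialDeriv_sq (hu1.differentiable one_ne_zero)]
    refine setIntegral_eq_integral_of_forall_compl_eq_zero fun y hy => ?_
    have : fderiv ℝ u (WithLp.toLp 2 y) = 0 :=
      image_eq_zero_of_notMem_tsupport fun h => hout y hy (tsupport_fderiv_subset ℝ h)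
    simp [gradient, this]
  obtain ⟨i1, v1⟩ := bubble_pow_four one_pos
  obtain ⟨i2, v2⟩ := bubble_sq_mul_pow_four one_pos
  have b1 : ∀ y : Fin 4 → ℝ, bubble y ^ 4 = 1 / (1 + ‖WithLp.toLp 2 y‖ ^ 2) ^ 4 := fun y => by
    rw [norm_toLp_sq, bubble, div_pow, one_pow]
  have b2 : ∀ y : Fin 4 → ℝ, bubble y ^ 4 * ∑ i, y i ^ 2 =
      ‖WithLp.toLp 2 y‖ ^ 2 / (1 + ‖WithLp.toLp 2 y‖ ^ 2) ^ 4 := fun y => by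
    rw [b1, norm_toLp_sq]; ring
  have t1 : Tendsto (fun k : ℕ => ∫ x in cube 4 (k + 1), bubble x ^ 4) atTop
      (𝓝 (sphereArea / 12)) := by
    have := tendsto_setIntegral_cube (integrable_comp_toLp i1)
    rw [integral_comp_toLp (fun x : Euc 4 => 1 / (1 + ‖x‖ ^ 2) ^ 4), v1] at this
    simpa only [b1, one_pow, mul_one] using this
  have t2 : Tendsto (fun k : ℕ => ∫ x in cube 4 (k + 1), bubble x ^ 4 * ∑ i, x i ^ 2) atTop
      (𝓝 (sphereArea / 6)) := by
    have := tendsto_setIntegral_cube (integrable_comp_toLp i2)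
    rw [integral_comp_toLp (fun x : Euc 4 => ‖x‖ ^ 2 / (1 + ‖x‖ ^ 2) ^ 4), v2] at this
    simpa only [b2, mul_one] using this
  have hc := sphereArea_pos
  set B := sphereArea / 12 with hB
  have hB0 : 0 < B := by positivity
  set m := ∫ x, u x ^ 4
  set D := ∫ x, ‖gradient u x‖ ^ 2
  have hlim : √(m / B) * (4 * B + sphereArea / 6) ≤ 3 / 4 * D := by
    refine le_of_tendsto (((tendsto_const_nhds.div t1 hB0.ne').sqrt).mul
      ((t1.const_mul 4).add t2)) (Eventually.of_forall fun k => ?_)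
    have := sobolev_cube hf hR (show (0 : ℝ) < k + 1 by positivity)
      (fun x i hi => image_eq_zero_of_notMem_tsupport (f := u) (hz x i hi.ge)) (hm'.symm ▸ hm)
    rwa [hm', hD'] at this
  have h6 : sphereArea / 6 = 2 * B := by rw [hB]; ring
  rw [h6, Real.sqrt_div hm.le] at hlim
  have hsB : √B * √B = B := Real.mul_self_sqrt hB0.le
  have hsB0 : 0 < √B := Real.sqrt_pos.2 hB0
  have : √m / √B * (4 * B + 2 * B) = 6 * √B * √m := by
    field_simp
    nlinarith
  rw [this] at hlim
  linarith

lemma setIntegral_ball_radial (g : ℝ → ℝ) (a : Euc 4) {r : ℝ} (hr : 0 < r) :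
    ∫ x in Metric.ball a r, g ‖x - a‖ = sphereArea * ∫ y in (0 : ℝ)..r, y ^ 3 * g y := by
  have h1 : ∀ x, (Metric.ball a r).indicator (fun x => g ‖x - a‖) x =
      (fun z : Euc 4 => (Set.Iio r).indicator g ‖z‖) (x - a) := fun x => by
    simp [Set.indicator, dist_eq_norm]
  rw [← integral_indicator measurableSet_ball, integral_congr_ae (Eventually.of_forall h1),
    integral_sub_right_eq_self (fun z : Euc 4 => (Set.Iio r).indicator g ‖z‖) a,
    integral_radial, intervalIntegral.integral_of_le hr.le, integral_Ioc_eq_integral_Ioo]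
  have h2 : (fun y => y ^ 3 * (Set.Iio r).indicator g y) =
      (Set.Iio r).indicator fun y => y ^ 3 * g y := by
    ext y; by_cases hy : y < r <;> simp [hy]
  rw [h2, setIntegral_indicator measurableSet_Iio, Set.Ioi_inter_Iio]

lemma log_le_setIntegral_ball {ε r : ℝ} (hε : 0 < ε) (hr : 0 < r) (a : Euc 4) :
    sphereArea / 2 * (Real.log (r ^ 2) - Real.log ε - 1) ≤
      ∫ x in Metric.ball a r, 1 / (ε + ‖x - a‖ ^ 2) ^ 2 := by
  rw [setIntegral_ball_radial (fun y => 1 / (ε + y ^ 2) ^ 2) a hr]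
  have hpos : ∀ y : ℝ, 0 < ε + y ^ 2 := fun y => by positivity
  have hd : ∀ y ∈ Set.uIcc 0 r, HasDerivAt
      (fun y : ℝ => (Real.log (ε + y ^ 2) + ε / (ε + y ^ 2)) / 2)
      (y ^ 3 * (1 / (ε + y ^ 2) ^ 2)) y := fun y _ => by
    have h0 : HasDerivAt (fun y : ℝ => ε + y ^ 2) (2 * y) y := by
      simpa using (hasDerivAt_pow 2 y).const_add ε
    have := ((h0.log (hpos y).ne').add
      ((hasDerivAt_const y ε).div h0 (hpos y).ne')).div_const 2
    refine this.congr_deriv ?_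
    have := (hpos y).ne'
    field_simp
    ring
  rw [intervalIntegral.integral_eq_sub_of_hasDerivAt hd]
  · have h1 : Real.log (r ^ 2) ≤ Real.log (ε + r ^ 2) :=
      Real.log_le_log (by positivity) (by linarith)
    have h2 : 0 ≤ ε / (ε + r ^ 2) := by positivity
    have h3 : ε / (ε + 0 ^ 2) = 1 := by simp [hε.ne']
    rw [h3, div_mul_eq_mul_div, mul_div_assoc]
    refine mul_le_mul_of_nonneg_left ?_ sphereArea_pos.le
    simp only [ne_eq, OfNat.ofNat_ne_zero, not_false_eq_true, zero_pow, add_zero]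
    linarith
  · refine Continuous.intervalIntegrable ?_ _ _
    exact (continuous_pow 3).mul (continuous_const.div (by fun_prop) fun y => by
      have := hpos y; positivity)

/-- Extraction of a small parameter from the expansions of the truncated bubbles. -/
lemma exists_small_parameter {B K K' δ p₀ : ℝ} (hB : 0 < B) (hK' : 0 ≤ K') (hδ : 0 < δ)
    (hp₀ : 0 < p₀) {l : ℝ → ℝ} (hl : Tendsto l (𝓝[>] 0) atTop) :
    ∃ ε : ℝ, 0 < ε ∧ ∀ N L V : ℝ, l ε ≤ L → N ≤ 8 * p₀ * B / ε - δ * L + K →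
      B / ε ^ 2 - K' ≤ V → N < p₀ * (8 * √B * √V) := by
  have h1 : ∀ᶠ ε : ℝ in 𝓝[>] 0, ε < 1 :=
    (eventually_lt_nhds (by norm_num)).filter_mono nhdsWithin_le_nhds
  have h2 : ∀ᶠ ε : ℝ in 𝓝[>] 0, K' * ε ^ 2 < B := by
    have : Continuous fun ε : ℝ => K' * ε ^ 2 := by fun_prop
    have h := (this.tendsto 0).mono_left (nhdsWithin_le_nhds (s := Set.Ioi 0))
    exact h.eventually (eventually_lt_nhds (by simpa using hB))
  obtain ⟨ε, ⟨⟨hε1, hεB⟩, hεl⟩, hε⟩ := (((h1.and h2).and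
    (hl.eventually_gt_atTop ((K + 8 * p₀ * K') / δ))).and eventually_mem_nhdsWithin).exists
  have hε : 0 < ε := hε
  refine ⟨ε, hε, fun N L V hL hN hV => hN.trans_lt ?_⟩
  have h3 : B / ε - K' * ε ≤ √B * √V := by
    rw [← Real.sqrt_mul hB.le]
    refine Real.le_sqrt_of_sq_le ?_
    have e1 : (B / ε - K' * ε) ^ 2 = B * (B / ε ^ 2 - K') - K' * (B - K' * ε ^ 2) := by
      field_simp
    have e2 : B * (B / ε ^ 2 - K') ≤ B * V := by gcongr
    have e3 : 0 ≤ K' * (B - K' * ε ^ 2) := mul_nonneg hK' (by linarith)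
    linarith
  rw [div_lt_iff₀ hδ] at hεl
  have h4 : l ε * δ ≤ L * δ := by gcongr
  have h5 : K' * ε ≤ K' := by nlinarith
  have h6 : 8 * p₀ * (K' * ε) ≤ 8 * p₀ * K' := by gcongr
  have h7 : 8 * p₀ * (B / ε - K' * ε) ≤ 8 * p₀ * (√B * √V) := by gcongr
  have h8 : 8 * p₀ * B / ε = 8 * p₀ * (B / ε) := by ring
  rw [h8]
  nlinarith

lemma norm_gradient_eq (u : Euc 4 → ℝ) (x : Euc 4) : ‖gradient u x‖ = ‖fderiv ℝ u x‖ := by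
  simp [gradient]

lemma hasFDerivAt_inv_add_sq {ε : ℝ} (hε : 0 < ε) (a x : Euc 4) :
    HasFDerivAt (fun x => (ε + ‖x - a‖ ^ 2)⁻¹)
      (-(2 / (ε + ‖x - a‖ ^ 2) ^ 2) • innerSL ℝ (x - a)) x := by
  have h1 : HasFDerivAt (fun x : Euc 4 => ε + ‖x - a‖ ^ 2) (2 • innerSL ℝ (x - a)) x := by
    simpa using (((hasFDerivAt_id x).sub_const a).norm_sq).const_add ε
  have h0 : ε + ‖x - a‖ ^ 2 ≠ 0 := by positivity
  refine ((hasDerivAt_inv h0).comp_hasFDerivAt x h1).congr_fderiv ?_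
  ext y
  simp
  field_simp

lemma norm_fderiv_inv_add_sq {ε : ℝ} (hε : 0 < ε) (a x : Euc 4) :
    ‖fderiv ℝ (fun x => (ε + ‖x - a‖ ^ 2)⁻¹) x‖ = 2 * ‖x - a‖ / (ε + ‖x - a‖ ^ 2) ^ 2 := by
  rw [(hasFDerivAt_inv_add_sq hε a x).fderiv, norm_smul, innerSL_apply_norm, norm_neg,
    Real.norm_of_nonneg (by positivity)]
  ring

/-- The truncated bubble `φ(x) / (ε + |x - a|²)`. -/
def truncBubble {a : Euc 4} (φ : ContDiffBump a) (ε : ℝ) (x : Euc 4) : ℝ :=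
  φ x * (ε + ‖x - a‖ ^ 2)⁻¹

section TruncBubble

variable {a : Euc 4} (φ : ContDiffBump a) {ε : ℝ}

lemma contDiff_truncBubble (hε : 0 < ε) : ContDiff ℝ (⊤ : ℕ∞) (truncBubble φ ε) := by
  refine φ.contDiff.mul (ContDiff.inv ?_ fun x => by positivity)
  exact contDiff_const.add ((contDiff_id.sub contDiff_const).norm_sq ℝ)

lemma tsupport_truncBubble_subset : tsupport (truncBubble φ ε) ⊆ Metric.closedBall a φ.rOut :=
  (tsupport_mul_subset_left).trans_eq φ.tsupport_eq

lemma hasCompactSupport_truncBubble : HasCompactSupport (truncBubble φ ε) :=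
  φ.hasCompactSupport.mul_right

lemma truncBubble_eq {x : Euc 4} (hx : x ∈ Metric.ball a φ.rIn) :
    truncBubble φ ε x = (ε + ‖x - a‖ ^ 2)⁻¹ := by
  rw [truncBubble, φ.one_of_mem_closedBall (Metric.ball_subset_closedBall hx), one_mul]

lemma norm_gradient_truncBubble_sq (hε : 0 < ε) {x : Euc 4} (hx : x ∈ Metric.ball a φ.rIn) :
    ‖gradient (truncBubble φ ε) x‖ ^ 2 = 4 * (‖x - a‖ ^ 2 / (ε + ‖x - a‖ ^ 2) ^ 4) := by
  have h : truncBubble φ ε =ᶠ[𝓝 x] fun x => (ε + ‖x - a‖ ^ 2)⁻¹ :=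
    Filter.mem_of_superset (Metric.isOpen_ball.mem_nhds hx) fun y hy => truncBubble_eq φ hy
  rw [norm_gradient_eq, h.fderiv_eq, norm_fderiv_inv_add_sq hε, div_pow, mul_pow, ← pow_mul]
  ring

lemma exists_bound_gradient_truncBubble : ∃ K : ℝ, ∀ ε : ℝ, 0 < ε → ∀ x ∉ Metric.ball a φ.rIn,
    ‖gradient (truncBubble φ ε) x‖ ^ 2 ≤ K := by
  have hφ : ContDiff ℝ 1 φ := φ.contDiff
  obtain ⟨N, hN⟩ := (φ.hasCompactSupport.fderiv (𝕜 := ℝ)).exists_bound_of_continuous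
    (hφ.continuous_fderiv one_ne_zero)
  have hN0 : 0 ≤ N := (norm_nonneg _).trans (hN a)
  have hr := φ.rIn_pos
  refine ⟨(2 / φ.rIn ^ 3 + N / φ.rIn ^ 2) ^ 2, fun ε hε x hx => ?_⟩
  have hx' : φ.rIn ≤ ‖x - a‖ := by simpa [dist_eq_norm] using hx
  have hr0 : 0 < ‖x - a‖ := hr.trans_le hx'
  gcongr
  rw [norm_gradient_eq]
  have hd := ((hφ.differentiable one_ne_zero x).hasFDerivAt.mul
    (hasFDerivAt_inv_add_sq hε a x).differentiableAt.hasFDerivAt).fderiv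
  have hd' : fderiv ℝ (truncBubble φ ε) x = _ := hd
  rw [hd']
  refine (norm_add_le _ _).trans ?_
  rw [norm_smul, norm_smul, norm_fderiv_inv_add_sq hε, Real.norm_of_nonneg φ.nonneg,
    Real.norm_of_nonneg (by positivity)]
  refine add_le_add ?_ ?_
  · refine (mul_le_of_le_one_left (by positivity) φ.le_one).trans ?_
    calc 2 * ‖x - a‖ / (ε + ‖x - a‖ ^ 2) ^ 2 ≤ 2 * ‖x - a‖ / (0 + ‖x - a‖ ^ 2) ^ 2 := by gcongr
      _ = 2 / ‖x - a‖ ^ 3 := by field_simp; ring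
      _ ≤ 2 / φ.rIn ^ 3 := by gcongr
  · rw [inv_mul_eq_div]
    refine div_le_div₀ hN0 (hN x) (by positivity) ?_
    nlinarith

lemma le_integral_truncBubble_pow_four : ∃ K : ℝ, 0 ≤ K ∧ ∀ ε : ℝ, 0 < ε →
    sphereArea / 12 / ε ^ 2 - K ≤ ∫ x, truncBubble φ ε x ^ 4 := by
  have hr := φ.rIn_pos
  have hc := sphereArea_pos
  obtain ⟨i1, v1⟩ := bubble_pow_four one_pos
  set d := (φ.rIn ^ 2 / (1 + φ.rIn ^ 2)) ^ 4 with hd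
  have hd0 : 0 < d := by positivity
  refine ⟨sphereArea / 12 / d, by positivity, fun ε hε => ?_⟩
  obtain ⟨i2, v2⟩ := bubble_pow_four hε
  have i1' := (i1.comp_sub_right a).div_const d
  have i2' := i2.comp_sub_right a
  have i3 : Integrable fun x => truncBubble φ ε x ^ 4 :=
    ((contDiff_truncBubble φ hε).continuous.pow 4).integrable_of_hasCompactSupport <| by
      simpa [pow_succ] using (hasCompactSupport_truncBubble φ (ε := ε)).mul_left
  have e1 := integral_sub_right_eq_self (μ := volume)
    (fun x : Euc 4 => 1 / (1 + ‖x‖ ^ 2) ^ 4) a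
  have e2 := integral_sub_right_eq_self (μ := volume)
    (fun x : Euc 4 => 1 / (ε + ‖x‖ ^ 2) ^ 4) a
  have key : ∫ x : Euc 4, 1 / (ε + ‖x - a‖ ^ 2) ^ 4 ≤
      ∫ x, (truncBubble φ ε x ^ 4 + 1 / (1 + ‖x - a‖ ^ 2) ^ 4 / d) := by
    refine integral_mono i2' (i3.add i1') fun x => ?_
    by_cases hx : x ∈ Metric.ball a φ.rIn
    · simp only [truncBubble_eq φ hx, inv_pow, one_div]
      exact le_add_of_nonneg_right (by positivity)
    · have hx' : φ.rIn ≤ ‖x - a‖ := by simpa [dist_eq_norm] using hx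
      have h4 : 0 ≤ truncBubble φ ε x ^ 4 := by positivity
      refine le_trans ?_ (le_add_of_nonneg_left h4)
      rw [div_div]
      refine one_div_le_one_div_of_le (by positivity) ?_
      rw [hd, ← mul_pow]
      gcongr
      rw [mul_div_assoc', div_le_iff₀ (by positivity)]
      have : φ.rIn ^ 2 ≤ ‖x - a‖ ^ 2 := by gcongr
      nlinarith [mul_pos hε (pow_pos hr 2)]
  rw [integral_add i3 i1', integral_div, e1, e2, v1, v2] at key
  have : sphereArea / 12 / ε ^ 2 = sphereArea / (12 * ε ^ 2) := by rw [div_div]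
  rw [this]
  simp only [one_pow, mul_one] at key
  linarith

end TruncBubble

lemma integral_gradient_sq_le {Ω : Set (Euc 4)} (hΩb : Bornology.IsBounded Ω)
    {a : Euc 4} {p : Euc 4 → ℝ} (hpc : ContinuousOn p (closure Ω)) {p₀ : ℝ} (hp₀ : 0 < p₀)
    {β : ℝ} (hβ : 0 < β) (φ : ContDiffBump a)
    (hφ : Metric.ball a φ.rIn ⊆ Ω)
    (hθ : IntegrableOn (fun x => ((p x - p₀) / ‖x - a‖ ^ 2 - β) / ‖x - a‖ ^ 4)
      (Metric.ball a φ.rIn)) :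
    ∃ K : ℝ, ∀ ε : ℝ, 0 < ε → ∫ x in Ω, p x * ‖gradient (truncBubble φ ε) x‖ ^ 2 ≤
      8 * p₀ * (sphereArea / 12) / ε +
      4 * β * (∫ x in Metric.ball a φ.rIn, 1 / (ε + ‖x - a‖ ^ 2) ^ 2) + K := by
  obtain ⟨K, hK⟩ := exists_bound_gradient_truncBubble φ
  have hcomp : IsCompact (closure Ω) := hΩb.isCompact_closure
  obtain ⟨P, hP⟩ := hcomp.exists_bound_of_continuousOn hpc
  set b := Metric.ball a φ.rIn with hb
  set Θ : Euc 4 → ℝ := fun x => ((p x - p₀) / ‖x - a‖ ^ 2 - β) / ‖x - a‖ ^ 4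
  refine ⟨4 * (∫ x in b, |Θ x|) + P * K * volume.real (Ω \ b), fun ε hε => ?_⟩
  have hInt : IntegrableOn (fun x => p x * ‖gradient (truncBubble φ ε) x‖ ^ 2) Ω := by
    refine (ContinuousOn.integrableOn_compact hcomp (hpc.mul ?_)).mono_set subset_closure
    have h1 : ContDiff ℝ 1 (truncBubble φ ε) :=
      (contDiff_truncBubble φ hε).of_le (by exact_mod_cast le_top)
    simp_rw [norm_gradient_eq]
    exact ((h1.continuous_fderiv one_ne_zero).norm.pow 2).continuousOn
  rw [← integral_inter_add_sdiff measurableSet_ball hInt, Set.inter_eq_right.2 hφ]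
  have houter : ∫ x in Ω \ b, p x * ‖gradient (truncBubble φ ε) x‖ ^ 2 ≤
      P * K * volume.real (Ω \ b) := by
    refine (Real.le_norm_self _).trans (norm_setIntegral_le_of_norm_le_const
      ((measure_mono Set.sdiff_subset).trans_lt hΩb.measure_lt_top) fun x hx => ?_)
    rw [norm_mul, Real.norm_of_nonneg (sq_nonneg ‖gradient (truncBubble φ ε) x‖)]
    have h1 := hP x (subset_closure hx.1)
    exact mul_le_mul h1 (hK ε hε x hx.2) (by positivity) ((norm_nonneg _).trans h1)
  obtain ⟨i2, v2⟩ := bubble_sq_mul_pow_four hε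
  have i2' := (i2.comp_sub_right a)
  have hL : IntegrableOn (fun x : Euc 4 => 1 / (ε + ‖x - a‖ ^ 2) ^ 2) b := by
    refine (Continuous.continuousOn ?_).integrableOn_compact (isCompact_closedBall a φ.rIn)
      |>.mono_set Metric.ball_subset_closedBall
    exact continuous_const.div (by fun_prop) fun x => by positivity
  have j1 := (i2'.const_mul (p₀ * 4)).integrableOn (s := b)
  have j2 := hL.const_mul (4 * β)
  have j12 : IntegrableOn (fun x => p₀ * 4 * (‖x - a‖ ^ 2 / (ε + ‖x - a‖ ^ 2) ^ 4) +
      4 * β * (1 / (ε + ‖x - a‖ ^ 2) ^ 2)) b := j1.add j2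
  have j3 : IntegrableOn (fun x => 4 * |Θ x|) b := hθ.abs.const_mul 4
  have hinner : ∫ x in b, p x * ‖gradient (truncBubble φ ε) x‖ ^ 2 ≤
      ∫ x in b, (p₀ * 4 * (‖x - a‖ ^ 2 / (ε + ‖x - a‖ ^ 2) ^ 4) +
        4 * β * (1 / (ε + ‖x - a‖ ^ 2) ^ 2) + 4 * |Θ x|) := by
    refine setIntegral_mono_on (hInt.mono_set hφ) (j12.add j3) measurableSet_ball
      fun x hx => ?_
    rw [norm_gradient_truncBubble_sq φ hε hx]
    rcases eq_or_ne x a with rfl | hxa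
    · simp only [sub_self, norm_zero]
      have := abs_nonneg (Θ x)
      norm_num
      positivity
    · have hr : 0 < ‖x - a‖ := norm_pos_iff.2 (sub_ne_zero.2 hxa)
      have hp : p x = p₀ + ‖x - a‖ ^ 2 * β + ‖x - a‖ ^ 6 * Θ x := by
        simp only [Θ]; field_simp; ring
      set r := ‖x - a‖
      have hs : 0 < ε + r ^ 2 := by positivity
      have hrs : r ^ 2 ≤ ε + r ^ 2 := by linarith
      have q1 : r ^ 4 / (ε + r ^ 2) ^ 4 ≤ 1 / (ε + r ^ 2) ^ 2 := by
        rw [div_le_div_iff₀ (by positivity) (by positivity)]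
        have : r ^ 4 ≤ (ε + r ^ 2) ^ 2 := by
          rw [show r ^ 4 = (r ^ 2) ^ 2 by ring]; gcongr
        calc r ^ 4 * (ε + r ^ 2) ^ 2 ≤ (ε + r ^ 2) ^ 2 * (ε + r ^ 2) ^ 2 := by gcongr
          _ = _ := by ring
      have q2 : r ^ 8 / (ε + r ^ 2) ^ 4 ≤ 1 := by
        rw [div_le_one (by positivity), show r ^ 8 = (r ^ 2) ^ 4 by ring]; gcongr
      have q3 : r ^ 8 / (ε + r ^ 2) ^ 4 * Θ x ≤ |Θ x| :=
        (mul_le_mul_of_nonneg_left (le_abs_self _) (by positivity)).trans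
          (mul_le_of_le_one_left (abs_nonneg _) q2)
      have q4 : β * (r ^ 4 / (ε + r ^ 2) ^ 4) ≤ β * (1 / (ε + r ^ 2) ^ 2) := by gcongr
      have : p x * (4 * (r ^ 2 / (ε + r ^ 2) ^ 4)) =
          p₀ * 4 * (r ^ 2 / (ε + r ^ 2) ^ 4) + 4 * (β * (r ^ 4 / (ε + r ^ 2) ^ 4)) +
          4 * (r ^ 8 / (ε + r ^ 2) ^ 4 * Θ x) := by
        rw [hp]; ring
      rw [this]
      linarith
  rw [integral_add j12 j3, integral_add j1 j2, integral_const_mul, integral_const_mul,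
    integral_const_mul] at hinner
  have hfull : ∫ x in b, ‖x - a‖ ^ 2 / (ε + ‖x - a‖ ^ 2) ^ 4 ≤ sphereArea / (6 * ε) := by
    refine (setIntegral_le_integral i2' (Eventually.of_forall fun x => by
      simp only [Pi.zero_apply]; positivity)).trans_eq ?_
    rw [← v2]
    exact integral_sub_right_eq_self (fun x : Euc 4 => ‖x‖ ^ 2 / (ε + ‖x‖ ^ 2) ^ 4) a
  have : p₀ * 4 * ∫ x in b, ‖x - a‖ ^ 2 / (ε + ‖x - a‖ ^ 2) ^ 4 ≤
      p₀ * 4 * (sphereArea / (6 * ε)) := by gcongr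
  have e : p₀ * 4 * (sphereArea / (6 * ε)) = 8 * p₀ * (sphereArea / 12) / ε := by
    field_simp; ring
  linarith

lemma setIntegral_eq_of_tsupport_subset {n : ℕ} {Ω : Set (Euc n)} {u g : Euc n → ℝ}
    (hu : tsupport u ⊆ Ω) (hg : ∀ x ∉ tsupport u, g x = 0) : ∫ x in Ω, g x = ∫ x, g x :=
  setIntegral_eq_integral_of_forall_compl_eq_zero fun x hx => hg x fun h => hx (hu h)

lemma integral_rpow_four {Ω : Set (Euc 4)} {u : Euc 4 → ℝ} (hu : tsupport u ⊆ Ω) :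
    (∫ x in Ω, |u x| ^ (4 : ℝ)) ^ (2 / (4 : ℝ)) = √(∫ x, u x ^ 4) := by
  have h1 : ∀ x, |u x| ^ (4 : ℝ) = u x ^ 4 := fun x => by
    rw [show (4 : ℝ) = ((4 : ℕ) : ℝ) by norm_num, Real.rpow_natCast, Even.pow_abs (by decide)]
  simp_rw [h1]
  rw [setIntegral_eq_of_tsupport_subset hu fun x hx => by
    simp [image_eq_zero_of_notMem_tsupport hx], Real.sqrt_eq_rpow]
  norm_num

lemma integral_pow_four_pos {Ω : Set (Euc 4)} {u : Euc 4 → ℝ} (hu : IsTest Ω u) :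
    0 < ∫ x, u x ^ 4 := by
  obtain ⟨hc, hs, -, h0⟩ := hu
  obtain ⟨x, hx⟩ := Function.ne_iff.1 h0
  refine (hc.continuous.pow 4).integral_pos_of_hasCompactSupport_nonneg_nonzero ?_ ?_
    (x := x) ?_
  · exact hs.comp_left (g := fun t : ℝ => t ^ 4) (by simp)
  · exact fun x => by simp only [Pi.zero_apply]; positivity
  · exact pow_ne_zero 4 hx

lemma integral_gradient_of_tsupport_subset {Ω : Set (Euc 4)} {u : Euc 4 → ℝ}
    (hu : tsupport u ⊆ Ω) : ∫ x in Ω, ‖gradient u x‖ ^ 2 = ∫ x, ‖gradient u x‖ ^ 2 := by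
  refine setIntegral_eq_of_tsupport_subset hu fun x hx => ?_
  have : fderiv ℝ u x = 0 :=
    image_eq_zero_of_notMem_tsupport fun h => hx (tsupport_fderiv_subset ℝ h)
  simp [gradient, this]

lemma isTest_truncBubble {Ω : Set (Euc 4)} {a : Euc 4} (φ : ContDiffBump a)
    (hφ : Metric.closedBall a φ.rOut ⊆ Ω) {ε : ℝ} (hε : 0 < ε) : IsTest Ω (truncBubble φ ε) := by
  refine ⟨contDiff_truncBubble φ hε, hasCompactSupport_truncBubble φ,
    (tsupport_truncBubble_subset φ).trans hφ, Function.ne_iff.2 ⟨a, ?_⟩⟩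
  rw [truncBubble_eq φ (Metric.mem_ball_self φ.rIn_pos)]
  simp [hε.ne']

lemma le_sobolevS {Ω : Set (Euc 4)} (hne : ∃ u, IsTest Ω u) :
    8 * √(sphereArea / 12) ≤ SobolevS Ω 4 := by
  obtain ⟨u, hu⟩ := hne
  refine le_csInf ⟨_, u, hu, rfl⟩ ?_
  rintro r ⟨v, hv, rfl⟩
  rw [integral_rpow_four hv.2.2.1, integral_gradient_of_tsupport_subset hv.2.2.1,
    le_div_iff₀ (Real.sqrt_pos.2 (integral_pow_four_pos hv))]
  exact sobolev_sharp hv.1 hv.2.1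

theorem stmt_7
    (Ω : Set (Euc 4)) (hΩo : IsOpen Ω) (hΩb : Bornology.IsBounded Ω)
    (a : Euc 4) (ha : a ∈ Ω)
    (p : Euc 4 → ℝ) (hpc : ContinuousOn p (closure Ω))
    (p₀ : ℝ) (hp₀ : 0 < p₀) (hpa : p a = p₀) (hmin : ∀ x ∈ closure Ω, p₀ ≤ p x)
    (β : ℝ) (hβ : 0 < β) (hA : CondA p a p₀ 2 β)
    (ρ : ℝ) (hρ : 0 < ρ) (hball : Metric.ball a ρ ⊆ Ω)
    (hθ : IntegrableOn
      (fun x => ((p x - p₀) / ‖x - a‖ ^ 2 - β) / ‖x - a‖ ^ 4) (Metric.ball a ρ))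
    (q : ℝ) (hq : q = 2 * (4 : ℝ) / ((4 : ℝ) - 2))
    (lam : ℝ) (hlam : 4 * β < lam) :
    Slam Ω p q lam < p₀ * SobolevS Ω q := by
  obtain rfl : q = 4 := by rw [hq]; norm_num
  let φ : ContDiffBump a := ⟨ρ / 4, ρ / 2, by positivity, by linarith⟩
  have hOut : Metric.closedBall a φ.rOut ⊆ Ω :=
    (Metric.closedBall_subset_ball (by simp only [φ]; linarith)).trans hball
  have hIn : Metric.ball a φ.rIn ⊆ Metric.ball a ρ :=
    Metric.ball_subset_ball (by simp only [φ]; linarith)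
  have hS := le_sobolevS ⟨_, isTest_truncBubble φ hOut one_pos⟩
  have hc := sphereArea_pos
  by_cases hbdd : BddBelow {r : ℝ | ∃ u : Euc 4 → ℝ, IsTest Ω u ∧
    r = ((∫ x in Ω, p x * ‖gradient u x‖ ^ 2) - lam * ∫ x in Ω, (u x) ^ 2) /
        (∫ x in Ω, |u x| ^ (4 : ℝ)) ^ (2 / (4 : ℝ))}
  swap
  · rw [Slam, Real.sInf_of_not_bddBelow hbdd]
    have : 0 < 8 * √(sphereArea / 12) := by positivity
    exact mul_pos hp₀ (this.trans_le hS)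
  obtain ⟨K, hK⟩ := integral_gradient_sq_le hΩb hpc hp₀ hβ φ (hIn.trans hball)
    (hθ.mono_set hIn)
  obtain ⟨K', hK', hV⟩ := le_integral_truncBubble_pow_four φ
  have hl : Tendsto (fun ε => sphereArea / 2 * (Real.log (φ.rIn ^ 2) - Real.log ε - 1))
      (𝓝[>] 0) atTop := by
    refine Tendsto.const_mul_atTop (by positivity) ?_
    simp only [sub_eq_add_neg]
    exact tendsto_atTop_add_const_right _ _
      (tendsto_atTop_add_const_left _ _ (tendsto_neg_atBot_atTop.comp Real.tendsto_log_nhdsGT_zero))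
  obtain ⟨ε, hε, h⟩ := exists_small_parameter (B := sphereArea / 12) (K := K) (by positivity) hK'
    (sub_pos.2 hlam) hp₀ hl
  have hu := isTest_truncBubble φ hOut hε
  have hL : ∫ x in Metric.ball a φ.rIn, 1 / (ε + ‖x - a‖ ^ 2) ^ 2 ≤
      ∫ x in Ω, truncBubble φ ε x ^ 2 := by
    have hi : IntegrableOn (fun x => truncBubble φ ε x ^ 2) Ω := by
      refine (((hu.1.continuous.pow 2).integrable_of_hasCompactSupport ?_)).integrableOn
      simpa [pow_two] using (hasCompactSupport_truncBubble φ (ε := ε)).mul_left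
    refine le_trans (le_of_eq ?_) (setIntegral_mono_set hi
      (Eventually.of_forall fun x => sq_nonneg _) (hIn.trans hball).eventuallyLE)
    refine setIntegral_congr_fun measurableSet_ball fun x hx => ?_
    simp only [truncBubble_eq φ hx, one_div, inv_pow]
  have hlam0 : 0 < lam := by linarith
  have hN := h ((∫ x in Ω, p x * ‖gradient (truncBubble φ ε) x‖ ^ 2) -
      lam * ∫ x in Ω, truncBubble φ ε x ^ 2) _ _ (log_le_setIntegral_ball hε φ.rIn_pos a)
    (by nlinarith [hK ε hε, mul_le_mul_of_nonneg_left hL hlam0.le]) (hV ε hε)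
  have hm := Real.sqrt_pos.2 (integral_pow_four_pos hu)
  refine (csInf_le hbdd ⟨_, hu, rfl⟩).trans_lt ?_
  rw [integral_rpow_four hu.2.2.1, div_lt_iff₀ hm]
  refine hN.trans_le ?_
  rw [mul_assoc p₀]
  gcongr
end
end

section
/- Suppose n ≥ 5 and p satisfies condition (A) at a with exponent k = 2 and coefficient β₂ > 0. Then for every λ > (n−2)n(n+2)β₂ / (4(n−1)), S_λ(p) < p₀·S. -/
open MeasureTheory Filter Asymptotics
open scoped Topology

noncomputable section

/-- A continuous family of normalized distribution functions has a jointly continuous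
quantile. -/
lemma continuousAt_of_comp_cdf {Z Y : Type*} [TopologicalSpace Z] [TopologicalSpace Y]
    {b : Y → ℝ → ℝ} (hb : ∀ s, Continuous fun y => b y s) (hmono : ∀ y, StrictMono (b y))
    {y : Z → Y} {c τ : Z → ℝ} {z₀ : Z} (hy : ContinuousAt y z₀) (hc : ContinuousAt c z₀)
    (hτ : ∀ᶠ z in 𝓝 z₀, b (y z) (τ z) = c z) : ContinuousAt τ z₀ := by
  have h0 : b (y z₀) (τ z₀) = c z₀ := hτ.self_of_nhds
  rw [ContinuousAt, tendsto_order]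
  constructor
  · intro s hs
    have h1 : ContinuousAt (fun z => b (y z) s) z₀ := (hb s).continuousAt.comp hy
    have h2 : b (y z₀) s < c z₀ := h0 ▸ hmono _ hs
    filter_upwards [h1.eventually_lt hc h2, hτ] with z hz hz'
    exact (hmono (y z)).lt_iff_lt.1 (hz' ▸ hz)
  · intro s hs
    have h1 : ContinuousAt (fun z => b (y z) s) z₀ := (hb s).continuousAt.comp hy
    have h2 : c z₀ < b (y z₀) s := h0 ▸ hmono _ hs
    filter_upwards [hc.eventually_lt h1 h2, hτ] with z hz hz'
    exact (hmono (y z)).lt_iff_lt.1 (hz' ▸ hz)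

/-- A strictly increasing solution `τ` of `b ∘ τ = a` is differentiable with derivative
`a' / b'`. -/
lemma hasDerivAt_of_comp_cdf {a b τ : ℝ → ℝ} {a' b' t : ℝ} (hτ : ∀ s, b (τ s) = a s)
    (hτc : ContinuousAt τ t) (ha : HasDerivAt a a' t) (hb : HasDerivAt b b' (τ t)) (hb' : b' ≠ 0) :
    HasDerivAt τ (a' / b') t := by
  rw [hasDerivAt_iff_tendsto_slope] at ha ⊢
  have hds : Tendsto (fun s => dslope b (τ t) (τ s)) (𝓝[≠] t) (𝓝 b') := by
    have h1 : ContinuousAt (dslope b (τ t)) (τ t) :=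
      continuousAt_dslope_same.2 hb.differentiableAt
    have h2 : Tendsto (fun s => dslope b (τ t) (τ s)) (𝓝 t) (𝓝 (dslope b (τ t) (τ t))) :=
      h1.tendsto.comp hτc
    rw [dslope_same, hb.deriv] at h2
    exact h2.mono_left nhdsWithin_le_nhds
  refine (ha.div hds hb').congr' ?_
  filter_upwards [hds.eventually_ne hb', self_mem_nhdsWithin] with s hs hst
  have hst : s - t ≠ 0 := sub_ne_zero.2 hst
  have key : (τ s - τ t) * dslope b (τ t) (τ s) = a s - a t := by
    rw [← hτ, ← hτ]; exact sub_smul_dslope b (τ t) (τ s)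
  simp only [Pi.div_apply]
  rw [slope_def_field, slope_def_field, ← key]
  field_simp

/-- Positive continuous functions on `ℝᵐ` dominated by a product Cauchy density. -/
def NiceDensity {m : ℕ} (F : (Fin m → ℝ) → ℝ) : Prop :=
  Continuous F ∧ (∀ x, 0 < F x) ∧ ∃ C : ℝ, ∀ x, F x ≤ C * ∏ i, (1 + x i ^ 2)⁻¹

/-- The marginal of `F` obtained by integrating out the first coordinate. -/
def marg {m : ℕ} (F : (Fin (m + 1) → ℝ) → ℝ) (x : Fin m → ℝ) : ℝ :=
  ∫ t : ℝ, F (Fin.cons t x)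

/-- The normalized conditional distribution function of the first coordinate. -/
def condCdf {m : ℕ} (F : (Fin (m + 1) → ℝ) → ℝ) (x : Fin m → ℝ) (t : ℝ) : ℝ :=
  (∫ s in Set.Iic t, F (Fin.cons s x)) / marg F x

namespace NiceDensity

variable {m : ℕ} {F : (Fin (m + 1) → ℝ) → ℝ}

lemma continuous_cons_left (hF : NiceDensity F) (x : Fin m → ℝ) :
    Continuous fun t : ℝ => F (Fin.cons t x) :=
  hF.1.comp (Continuous.finCons (A := fun _ => ℝ) (f := fun t : ℝ => t) continuous_id
    continuous_const)

lemma exists_bound (hF : NiceDensity F) :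
    ∃ C : ℝ, 0 ≤ C ∧ ∀ t (x : Fin m → ℝ), F (Fin.cons t x) ≤
      (C * ∏ i, (1 + x i ^ 2)⁻¹) * (1 + t ^ 2)⁻¹ := by
  obtain ⟨C, hC⟩ := hF.2.2
  refine ⟨C, ?_, fun t x => ?_⟩
  · have := (hF.2.1 0).trans_le (hC 0)
    simp at this
    exact this.le
  · have := hC (Fin.cons t x)
    rw [Fin.prod_univ_succ] at this
    simp only [Fin.cons_zero, Fin.cons_succ] at this
    linarith

lemma exists_bound' (hF : NiceDensity F) :
    ∃ C : ℝ, 0 ≤ C ∧ ∀ t (x : Fin m → ℝ), ‖F (Fin.cons t x)‖ ≤ C * (1 + t ^ 2)⁻¹ := by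
  obtain ⟨C, hC0, hC⟩ := hF.exists_bound
  refine ⟨C, hC0, fun t x => ?_⟩
  rw [Real.norm_of_nonneg (hF.2.1 _).le]
  refine (hC t x).trans ?_
  gcongr
  refine mul_le_of_le_one_right hC0 (Finset.prod_le_one (fun i _ => by positivity) fun i _ => ?_)
  exact inv_le_one_of_one_le₀ (by nlinarith [sq_nonneg (x i)])

lemma integrable_cons (hF : NiceDensity F) (x : Fin m → ℝ) :
    Integrable fun t : ℝ => F (Fin.cons t x) := by
  obtain ⟨C, _, hC⟩ := hF.exists_bound'
  exact (integrable_inv_one_add_sq.const_mul C).mono'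
    (hF.continuous_cons_left x).aestronglyMeasurable (Eventually.of_forall fun t => hC t x)

lemma marg_pos (hF : NiceDensity F) (x : Fin m → ℝ) : 0 < marg F x := by
  refine (integral_pos_iff_support_of_nonneg (fun t => (hF.2.1 _).le) (hF.integrable_cons x)).2 ?_
  have : Function.support (fun t : ℝ => F (Fin.cons t x)) = Set.univ :=
    Set.eq_univ_of_forall fun t => (hF.2.1 _).ne'
  rw [this]; simp

protected lemma marg (hF : NiceDensity F) : NiceDensity (marg F) := by
  refine ⟨?_, hF.marg_pos, ?_⟩
  · obtain ⟨C, _, hC⟩ := hF.exists_bound'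
    refine continuous_of_dominated (fun x => (hF.continuous_cons_left x).aestronglyMeasurable)
      (fun x => Eventually.of_forall fun t => hC t x) (integrable_inv_one_add_sq.const_mul C)
      (Eventually.of_forall fun t => hF.1.comp (continuous_const.finCons continuous_id))
  · obtain ⟨C, hC0, hC⟩ := hF.exists_bound
    refine ⟨C * Real.pi, fun x => ?_⟩
    have := integral_mono (hF.integrable_cons x)
      (integrable_inv_one_add_sq.const_mul (C * ∏ i, (1 + x i ^ 2)⁻¹)) (fun t => hC t x)
    rw [integral_const_mul, integral_univ_inv_one_add_sq] at this
    unfold _root_.marg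
    linarith

lemma continuous_condCdf (hF : NiceDensity F) :
    Continuous fun z : (Fin m → ℝ) × ℝ => condCdf F z.1 z.2 := by
  refine Continuous.div ?_ (hF.marg.1.comp continuous_fst) fun z => (hF.marg_pos _).ne'
  obtain ⟨C, hC0, hC⟩ := hF.exists_bound'
  rw [continuous_iff_continuousAt]
  intro z₀
  simp_rw [← integral_indicator measurableSet_Iic]
  refine continuousAt_of_dominated (bound := fun t => C * (1 + t ^ 2)⁻¹)
    (Eventually.of_forall fun z => ((hF.continuous_cons_left z.1).aestronglyMeasurable.indicator
      measurableSet_Iic))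
    (Eventually.of_forall fun z => Eventually.of_forall fun t => ?_)
    (integrable_inv_one_add_sq.const_mul C) ?_
  · exact (norm_indicator_le_norm_self _ _).trans (hC t z.1)
  · have hne : ∀ᵐ t : ℝ, t ≠ z₀.2 := by simp [ae_iff, measure_singleton]
    filter_upwards [hne] with t ht
    have hcont : ContinuousAt (fun z : (Fin m → ℝ) × ℝ => F (Fin.cons t z.1)) z₀ :=
      (hF.1.comp (continuous_const.finCons continuous_fst)).continuousAt
    rcases lt_or_gt_of_ne ht with h | h
    · refine hcont.congr ?_
      filter_upwards [continuous_snd.continuousAt.eventually (lt_mem_nhds h)] with z hz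
      rw [Set.indicator_of_mem (Set.mem_Iic.2 (le_of_lt hz))]
    · refine (continuousAt_const (y := (0 : ℝ))).congr ?_
      filter_upwards [continuous_snd.continuousAt.eventually (gt_mem_nhds h)] with z hz
      rw [Set.indicator_of_notMem (by simpa using hz)]

lemma hasDerivAt_condCdf (hF : NiceDensity F) (x : Fin m → ℝ) (t : ℝ) :
    HasDerivAt (condCdf F x) (F (Fin.cons t x) / marg F x) t := by
  unfold condCdf
  refine HasDerivAt.div_const ?_ _
  have hcons := hF.integrable_cons x
  have h1 : ∀ s : ℝ, ∫ r in Set.Iic s, F (Fin.cons r x) =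
      (∫ r in Set.Iic 0, F (Fin.cons r x)) + ∫ r in (0 : ℝ)..s, F (Fin.cons r x) := by
    intro s
    rw [← intervalIntegral.integral_Iic_sub_Iic hcons.integrableOn hcons.integrableOn]; ring
  rw [funext h1]
  refine HasDerivAt.const_add _ ?_
  exact intervalIntegral.integral_hasDerivAt_right (hcons.intervalIntegrable)
    ((hF.continuous_cons_left x).stronglyMeasurableAtFilter _ _)
    (hF.continuous_cons_left x).continuousAt

lemma strictMono_condCdf (hF : NiceDensity F) (x : Fin m → ℝ) : StrictMono (condCdf F x) :=
  strictMono_of_hasDerivAt_pos (hF.hasDerivAt_condCdf x)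
    fun _ => div_pos (hF.2.1 _) (hF.marg_pos x)

lemma tendsto_condCdf_atTop (hF : NiceDensity F) (x : Fin m → ℝ) :
    Tendsto (condCdf F x) atTop (𝓝 1) := by
  have h : Tendsto (fun t : ℝ => ∫ s in Set.Iic t, F (Fin.cons s x)) atTop (𝓝 (marg F x)) :=
    (aecover_Iic tendsto_id).integral_tendsto_of_countably_generated (hF.integrable_cons x)
  have h2 := h.div_const (marg F x)
  rwa [div_self (hF.marg_pos x).ne'] at h2

lemma tendsto_condCdf_atBot (hF : NiceDensity F) (x : Fin m → ℝ) :
    Tendsto (condCdf F x) atBot (𝓝 0) := by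
  have h : Tendsto (fun t : ℝ => ∫ s in Set.Ioi t, F (Fin.cons s x)) atBot (𝓝 (marg F x)) :=
    (aecover_Ioi tendsto_id).integral_tendsto_of_countably_generated (hF.integrable_cons x)
  have h2 : condCdf F x = fun t => (marg F x - ∫ s in Set.Ioi t, F (Fin.cons s x)) / marg F x := by
    funext t
    have := integral_add_compl (μ := volume) (s := Set.Iic t) measurableSet_Iic
      (hF.integrable_cons x)
    rw [Set.compl_Iic] at this
    unfold condCdf
    congr 1
    rw [eq_sub_iff_add_eq]
    exact this
  rw [h2]
  simpa using (h.const_sub (marg F x)).div_const (marg F x)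

lemma condCdf_mem_Ioo (hF : NiceDensity F) (x : Fin m → ℝ) (t : ℝ) :
    condCdf F x t ∈ Set.Ioo (0 : ℝ) 1 := by
  have hm := hF.strictMono_condCdf x
  refine ⟨?_, ?_⟩
  · exact (hm.monotone.le_of_tendsto (hF.tendsto_condCdf_atBot x) (t - 1)).trans_lt
      (hm (by linarith))
  · exact (hm (by linarith)).trans_le
      (hm.monotone.ge_of_tendsto (hF.tendsto_condCdf_atTop x) (t + 1))

lemma exists_condCdf_eq (hF : NiceDensity F) (x : Fin m → ℝ) {c : ℝ} (hc : c ∈ Set.Ioo (0 : ℝ) 1) :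
    ∃ t, condCdf F x t = c := by
  have hcont : Continuous (condCdf F x) :=
    hF.continuous_condCdf.comp (continuous_const.prodMk continuous_id)
  obtain ⟨s, hs⟩ := ((hF.tendsto_condCdf_atBot x).eventually (gt_mem_nhds hc.1)).exists
  obtain ⟨t, ht⟩ := ((hF.tendsto_condCdf_atTop x).eventually (lt_mem_nhds hc.2)).exists
  exact mem_range_of_exists_le_of_exists_ge hcont ⟨s, hs.le⟩ ⟨t, ht.le⟩

end NiceDensity

lemma lintegral_fin_succ {m : ℕ} {k : (Fin (m + 1) → ℝ) → ENNReal} (hk : Measurable k) :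
    ∫⁻ x, k x = ∫⁻ x : Fin m → ℝ, ∫⁻ t : ℝ, k (Fin.cons t x) := by
  have e := (volume_preserving_piFinSuccAbove (fun _ : Fin (m + 1) => ℝ) 0).symm
  rw [← e.lintegral_comp_emb (MeasurableEquiv.measurableEmbedding _),
    Measure.volume_eq_prod, lintegral_prod_symm]
  · simp [MeasurableEquiv.piFinSuccAbove, Fin.insertNthEquiv]
  · exact (hk.comp (MeasurableEquiv.measurable _)).aemeasurable

lemma NiceDensity.ofReal_marg {m : ℕ} {F : (Fin (m + 1) → ℝ) → ℝ} (hF : NiceDensity F)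
    (x : Fin m → ℝ) : ENNReal.ofReal (marg F x) = ∫⁻ t : ℝ, ENNReal.ofReal (F (Fin.cons t x)) :=
  ofReal_integral_eq_lintegral_ofReal (hF.integrable_cons x)
    (Eventually.of_forall fun _ => (hF.2.1 _).le)

/-- The Knothe rearrangement between two nice densities of equal mass: a triangular map
transporting one to the other, with positive diagonal derivatives. -/
theorem exists_knothe (m : ℕ) : ∀ F G : (Fin m → ℝ) → ℝ, NiceDensity F → NiceDensity G →
    ∫⁻ x, ENNReal.ofReal (F x) = ∫⁻ x, ENNReal.ofReal (G x) →
    ∃ (T : (Fin m → ℝ) → Fin m → ℝ) (d : (Fin m → ℝ) → Fin m → ℝ),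
      Continuous T ∧ Continuous d ∧ (∀ x i, 0 < d x i) ∧ (∀ x, (∏ i, d x i) * G (T x) = F x) ∧
      (∀ x i, HasDerivAt (fun t => T (Function.update x i t) i) (d x i) (x i)) ∧
      ∀ h : (Fin m → ℝ) → ENNReal, Measurable h →
        ∫⁻ x, h (T x) * ENNReal.ofReal (F x) = ∫⁻ y, h y * ENNReal.ofReal (G y) := by
  induction m with
  | zero =>
    intro F G hF hG hFG
    have hFG' : F = G := by
      funext x
      have hx : ∀ K : (Fin 0 → ℝ) → ℝ, ∫⁻ x, ENNReal.ofReal (K x) = ENNReal.ofReal (K x) := by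
        intro K
        rw [volume_pi, Measure.pi_of_empty _ x, lintegral_dirac]
      rw [hx, hx, ENNReal.ofReal_eq_ofReal_iff (hF.2.1 _).le (hG.2.1 _).le] at hFG
      exact hFG
    subst hFG'
    exact ⟨id, 0, continuous_id, continuous_const, fun _ i => i.elim0, fun x => by simp,
      fun _ i => i.elim0, fun h _ => rfl⟩
  | succ m ih =>
    intro F G hF hG hFG
    rw [lintegral_fin_succ (by have := hF.1; fun_prop),
      lintegral_fin_succ (by have := hG.1; fun_prop)] at hFG
    simp_rw [← hF.ofReal_marg, ← hG.ofReal_marg] at hFG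
    obtain ⟨T', d', hTc, hdc, hdpos, hprod, hder, htr⟩ := ih _ _ hF.marg hG.marg hFG
    choose τ hτ using fun z : (Fin m → ℝ) × ℝ =>
      hG.exists_condCdf_eq (T' z.1) (hF.condCdf_mem_Ioo z.1 z.2)
    have hτc : Continuous τ := by
      rw [continuous_iff_continuousAt]
      intro z
      exact continuousAt_of_comp_cdf (b := condCdf G) (y := fun z => T' z.1)
        (fun s => hG.continuous_condCdf.comp (continuous_id.prodMk continuous_const))
        hG.strictMono_condCdf (hTc.comp continuous_fst).continuousAt
        hF.continuous_condCdf.continuousAt (Eventually.of_forall hτ)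
    set d₀ : (Fin m → ℝ) × ℝ → ℝ := fun z => (F (Fin.cons z.2 z.1) / marg F z.1) /
      (G (Fin.cons (τ z) (T' z.1)) / marg G (T' z.1)) with hd₀
    have hcons : ∀ {Z : Type} [TopologicalSpace Z] {f : Z → ℝ} {g : Z → Fin m → ℝ},
        Continuous f → Continuous g → Continuous fun z => (Fin.cons (f z) (g z) : Fin (m + 1) → ℝ) :=
      fun hf hg => Continuous.finCons (A := fun _ => ℝ) hf hg
    have hd₀c : Continuous d₀ := by
      refine Continuous.div (Continuous.div ?_ ?_ ?_) (Continuous.div ?_ ?_ ?_) ?_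
      · exact hF.1.comp (hcons continuous_snd continuous_fst)
      · exact hF.marg.1.comp continuous_fst
      · exact fun z => (hF.marg_pos _).ne'
      · exact hG.1.comp (hcons hτc (hTc.comp continuous_fst))
      · exact hG.marg.1.comp (hTc.comp continuous_fst)
      · exact fun z => (hG.marg_pos _).ne'
      · exact fun z => (div_pos (hG.2.1 _) (hG.marg_pos _)).ne'
    have hd₀pos : ∀ z, 0 < d₀ z := fun z => div_pos (div_pos (hF.2.1 _) (hF.marg_pos _))
      (div_pos (hG.2.1 _) (hG.marg_pos _))
    have hτder : ∀ x t, HasDerivAt (fun s => τ (x, s)) (d₀ (x, t)) t := fun x t =>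
      hasDerivAt_of_comp_cdf (a := condCdf F x) (b := condCdf G (T' x)) (fun s => hτ (x, s))
        (hτc.comp (continuous_const.prodMk continuous_id)).continuousAt
        (hF.hasDerivAt_condCdf x t) (hG.hasDerivAt_condCdf _ _)
        (div_pos (hG.2.1 _) (hG.marg_pos _)).ne'
    have hτinj : ∀ x, Function.Injective fun s => τ (x, s) := fun x =>
      (strictMono_of_hasDerivAt_pos (hτder x) fun t => hd₀pos _).injective
    have hτsurj : ∀ x, Function.Surjective fun s => τ (x, s) := by
      intro x s
      obtain ⟨t, ht⟩ := hF.exists_condCdf_eq x (hG.condCdf_mem_Ioo (T' x) s)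
      exact ⟨t, (hG.strictMono_condCdf (T' x)).injective ((hτ (x, t)).trans ht)⟩
    have htail : Continuous (Fin.tail : (Fin (m + 1) → ℝ) → Fin m → ℝ) :=
      continuous_pi fun i => continuous_apply _
    have hpair : Continuous fun x : Fin (m + 1) → ℝ => (Fin.tail x, x 0) :=
      htail.prodMk (continuous_apply 0)
    have hTcont : Continuous fun x : Fin (m + 1) → ℝ =>
        (Fin.cons (τ (Fin.tail x, x 0)) (T' (Fin.tail x)) : Fin (m + 1) → ℝ) :=
      hcons (hτc.comp hpair) (hTc.comp htail)
    refine ⟨fun x => Fin.cons (τ (Fin.tail x, x 0)) (T' (Fin.tail x)),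
      fun x => Fin.cons (d₀ (Fin.tail x, x 0)) (d' (Fin.tail x)),
      hTcont, hcons (hd₀c.comp hpair) (hdc.comp htail), ?_, ?_, ?_, ?_⟩
    · intro x i
      refine Fin.cases ?_ (fun j => ?_) i
      · exact hd₀pos _
      · exact hdpos _ j
    · intro x
      rw [Fin.prod_univ_succ]
      simp only [Fin.cons_zero, Fin.cons_succ]
      have h1 := hprod (Fin.tail x)
      have h2 := (hG.2.1 (Fin.cons (τ (Fin.tail x, x 0)) (T' (Fin.tail x)))).ne'
      have h3 := (hF.marg_pos (Fin.tail x)).ne'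
      have h4 := (hG.marg_pos (T' (Fin.tail x))).ne'
      simp only [hd₀]
      rw [Fin.cons_self_tail]
      field_simp
      linear_combination F x * h1
    · intro x i
      refine Fin.cases ?_ (fun j => ?_) i
      · simp only [Fin.cons_zero, Function.update_self, Fin.tail_update_zero]
        exact hτder _ _
      · simp only [Fin.cons_succ, Fin.tail_update_succ]
        exact hder (Fin.tail x) j
    · intro h hh
      rw [lintegral_fin_succ (by have := hF.1; have := hTcont.measurable; fun_prop),
        lintegral_fin_succ (by have := hG.1; fun_prop)]
      set k : (Fin m → ℝ) → ENNReal := fun y =>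
        (∫⁻ s : ℝ, h (Fin.cons s y) * ENNReal.ofReal (G (Fin.cons s y))) *
          (ENNReal.ofReal (marg G y))⁻¹ with hk
      have hcm : Measurable fun z : (Fin m → ℝ) × ℝ => (Fin.cons z.2 z.1 : Fin (m + 1) → ℝ) :=
        (hcons continuous_snd continuous_fst).measurable
      have hkm : Measurable k := by
        refine Measurable.mul ?_ (hG.marg.1.measurable.ennreal_ofReal.inv)
        refine Measurable.lintegral_prod_right' (f := fun z : (Fin m → ℝ) × ℝ =>
          h (Fin.cons z.2 z.1) * ENNReal.ofReal (G (Fin.cons z.2 z.1))) ?_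
        exact (hh.comp hcm).mul (hG.1.measurable.comp hcm).ennreal_ofReal
      have key := htr k hkm
      have hR : ∀ y, k y * ENNReal.ofReal (marg G y) =
          ∫⁻ s : ℝ, h (Fin.cons s y) * ENNReal.ofReal (G (Fin.cons s y)) := by
        intro y
        rw [hk, mul_assoc, ENNReal.inv_mul_cancel, mul_one]
        · exact (ENNReal.ofReal_pos.2 (hG.marg_pos y)).ne'
        · exact ENNReal.ofReal_ne_top
      have hL : ∀ x, k (T' x) * ENNReal.ofReal (marg F x) =
          ∫⁻ t : ℝ, h (Fin.cons (τ (x, t)) (T' x)) * ENNReal.ofReal (F (Fin.cons t x)) := by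
        intro x
        have hcv := lintegral_image_eq_lintegral_abs_deriv_mul MeasurableSet.univ
          (fun t _ => (hτder x t).hasDerivWithinAt) (hτinj x).injOn
          (fun s => h (Fin.cons s (T' x)) * ENNReal.ofReal (G (Fin.cons s (T' x))) )
        rw [Set.image_univ, (hτsurj x).range_eq, setLIntegral_univ, setLIntegral_univ] at hcv
        rw [hk]
        simp only
        rw [hcv, mul_assoc, ← lintegral_mul_const']
        · refine lintegral_congr fun t => ?_
          rw [abs_of_pos (hd₀pos _), ← ENNReal.ofReal_inv_of_pos (hG.marg_pos _),
            ← ENNReal.ofReal_mul (inv_nonneg.2 (hG.marg_pos _).le)]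
          have h2 := hG.2.1 (Fin.cons (τ (x, t)) (T' x))
          have h3 := hF.marg_pos x
          have h4 := hG.marg_pos (T' x)
          have : F (Fin.cons t x) = d₀ (x, t) * G (Fin.cons (τ (x, t)) (T' x)) *
              ((marg G (T' x))⁻¹ * marg F x) := by
            simp only [hd₀]
            field_simp
          rw [this, ENNReal.ofReal_mul (mul_pos (hd₀pos _) h2).le, ENNReal.ofReal_mul (hd₀pos _).le,
            ENNReal.ofReal_mul (inv_pos.2 h4).le]
          ring
        · rw [← ENNReal.ofReal_inv_of_pos (hG.marg_pos _)]
          exact ENNReal.mul_ne_top ENNReal.ofReal_ne_top ENNReal.ofReal_ne_top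
      simp_rw [hL, hR] at key
      simpa using key

/-- The power `(1 + ‖x‖²)^(-s)`. -/
def jap {n : ℕ} (s : ℝ) (x : Euc n) : ℝ := (1 + ‖x‖ ^ 2) ^ (-s)

section Jap

variable {n : ℕ} {s t : ℝ}

lemma one_add_norm_sq_pos (x : Euc n) : 0 < 1 + ‖x‖ ^ 2 := by positivity

lemma jap_pos (s : ℝ) (x : Euc n) : 0 < jap s x := Real.rpow_pos_of_pos (one_add_norm_sq_pos x) _

lemma jap_mul (s t : ℝ) (x : Euc n) : jap s x * jap t x = jap (s + t) x := by
  unfold jap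
  rw [← Real.rpow_add (one_add_norm_sq_pos x)]
  ring_nf

lemma jap_rpow (s t : ℝ) (x : Euc n) : jap s x ^ t = jap (s * t) x := by
  unfold jap
  rw [← Real.rpow_mul (one_add_norm_sq_pos x).le]
  ring_nf

lemma jap_sq (s : ℝ) (x : Euc n) : jap s x ^ 2 = jap (2 * s) x := by
  rw [sq, jap_mul]; ring_nf

lemma jap_neg_one (x : Euc n) : jap (-1) x = 1 + ‖x‖ ^ 2 := by
  unfold jap; simp

lemma normSq_mul_jap (s : ℝ) (x : Euc n) : ‖x‖ ^ 2 * jap s x = jap (s - 1) x - jap s x := by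
  have : jap (s - 1) x = (1 + ‖x‖ ^ 2) * jap s x := by
    rw [← jap_neg_one, jap_mul]; ring_nf
  rw [this]; ring

lemma normSq_mul_jap_le (s : ℝ) (x : Euc n) : ‖x‖ ^ 2 * jap s x ≤ jap (s - 1) x := by
  rw [normSq_mul_jap]; linarith [jap_pos s x]

lemma contDiff_jap (s : ℝ) {k : WithTop ℕ∞} : ContDiff ℝ k (jap s : Euc n → ℝ) :=
  (contDiff_const.add (contDiff_norm_sq ℝ)).rpow_const_of_ne fun x => (one_add_norm_sq_pos x).ne'

lemma continuous_jap (s : ℝ) : Continuous (jap s : Euc n → ℝ) := (contDiff_jap s (k := 0)).continuous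

lemma integrable_jap (h : n < 2 * s) : Integrable (jap s : Euc n → ℝ) := by
  have := integrable_rpow_neg_one_add_norm_sq (E := Euc n) (μ := volume) (r := 2 * s) (by simpa using h)
  refine this.congr (Eventually.of_forall fun x => ?_)
  simp only [jap]; ring_nf

lemma fderiv_jap (s : ℝ) (x : Euc n) :
    fderiv ℝ (jap s) x = (-2 * s * jap (s + 1) x) • innerSL ℝ x := by
  have h1 : HasFDerivAt (fun y : Euc n => 1 + ‖y‖ ^ 2) ((2 : ℝ) • innerSL ℝ x) x := by
    have := (hasStrictFDerivAt_norm_sq x).hasFDerivAt.const_add (1 : ℝ)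
    simpa [two_smul] using this
  have h2 := h1.rpow_const (p := -s) (Or.inl (one_add_norm_sq_pos x).ne')
  have h3 : jap (s + 1) x = (1 + ‖x‖ ^ 2) ^ (-s - 1) := by unfold jap; ring_nf
  rw [h3]
  refine h2.fderiv.trans ?_
  rw [smul_smul]
  congr 1
  ring

lemma norm_fderiv_jap (hs : 0 ≤ s) (x : Euc n) :
    ‖fderiv ℝ (jap s) x‖ = 2 * s * jap (s + 1) x * ‖x‖ := by
  rw [fderiv_jap, norm_smul, innerSL_apply_norm, Real.norm_eq_abs, neg_mul, neg_mul, abs_neg,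
    abs_of_nonneg (mul_nonneg (by positivity) (jap_pos _ x).le)]

lemma norm_gradient {f : Euc n → ℝ} (x : Euc n) : ‖gradient f x‖ = ‖fderiv ℝ f x‖ := by
  unfold gradient; simp

lemma integral_Ioi_pow_mul_jap (k : ℕ) (hk : 0 < k) (hs : (k : ℝ) < 2 * s)
    (h1 : IntegrableOn (fun r : ℝ => r ^ (k - 1) * (1 + r ^ 2) ^ (-s)) (Set.Ioi 0))
    (h2 : IntegrableOn (fun r : ℝ => r ^ (k + 1) * (1 + r ^ 2) ^ (-(s + 1))) (Set.Ioi 0)) :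
    k * ∫ r in Set.Ioi (0 : ℝ), r ^ (k - 1) * (1 + r ^ 2) ^ (-s) =
      2 * s * ∫ r in Set.Ioi (0 : ℝ), r ^ (k + 1) * (1 + r ^ 2) ^ (-(s + 1)) := by
  have hpos : ∀ r : ℝ, 0 < 1 + r ^ 2 := fun r => by positivity
  have hder : ∀ r : ℝ, HasDerivAt (fun r : ℝ => r ^ k * (1 + r ^ 2) ^ (-s))
      (k * (r ^ (k - 1) * (1 + r ^ 2) ^ (-s)) -
        2 * s * (r ^ (k + 1) * (1 + r ^ 2) ^ (-(s + 1)))) r := by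
    intro r
    have ha : HasDerivAt (fun r : ℝ => 1 + r ^ 2) (2 * r) r := by
      simpa using (hasDerivAt_pow 2 r).const_add 1
    have := (hasDerivAt_pow k r).mul (ha.rpow_const (p := -s) (Or.inl (hpos r).ne'))
    convert! this using 1
    rw [show -s - 1 = -(s + 1) by ring]
    ring
  have hlim : Tendsto (fun r : ℝ => r ^ k * (1 + r ^ 2) ^ (-s)) atTop (𝓝 0) := by
    have h0 : Tendsto (fun r : ℝ => r ^ (-(2 * s - k))) atTop (𝓝 0) :=
      tendsto_rpow_neg_atTop (by linarith)
    refine squeeze_zero' ?_ ?_ h0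
    · filter_upwards [eventually_ge_atTop 0] with r hr
      have := hpos r
      positivity
    · filter_upwards [eventually_gt_atTop 0] with r hr
      have hs0 : 0 < s := by have : (0 : ℝ) < k := by exact_mod_cast hk
                             linarith
      calc r ^ k * (1 + r ^ 2) ^ (-s) ≤ r ^ k * (r ^ 2) ^ (-s) := by
            refine mul_le_mul_of_nonneg_left ?_ (by positivity)
            exact Real.rpow_le_rpow_of_nonpos (by positivity) (by linarith) (by linarith)
        _ = r ^ (-(2 * s - k)) := by
            rw [← Real.rpow_natCast r 2, ← Real.rpow_mul hr.le, ← Real.rpow_natCast r k,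
              ← Real.rpow_add hr]
            congr 1; push_cast; ring
  have := integral_Ioi_of_hasDerivAt_of_tendsto' (a := 0) (fun r _ => hder r)
    ((h1.const_mul _).sub (h2.const_mul _)) hlim
  rw [integral_sub (h1.const_mul _) (h2.const_mul _), integral_const_mul, integral_const_mul] at this
  simp only [zero_pow hk.ne', zero_mul, sub_zero] at this
  linarith

lemma integral_norm_pow_mul_jap (hn : 0 < n) (j : ℕ) (hs : (n : ℝ) + j < 2 * s)
    (h1 : Integrable fun x : Euc n => ‖x‖ ^ j * jap s x)
    (h2 : Integrable fun x : Euc n => ‖x‖ ^ (j + 2) * jap (s + 1) x) :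
    (n + j) * ∫ x : Euc n, ‖x‖ ^ j * jap s x =
      2 * s * ∫ x : Euc n, ‖x‖ ^ (j + 2) * jap (s + 1) x := by
  have : Nonempty (Fin n) := ⟨⟨0, hn⟩⟩
  have : Nontrivial (Euc n) := inferInstance
  have e1 := (integrable_fun_norm_addHaar (volume : Measure (Euc n))
    (f := fun r : ℝ => r ^ j * (1 + r ^ 2) ^ (-s))).1 h1
  have e2 := (integrable_fun_norm_addHaar (volume : Measure (Euc n))
    (f := fun r : ℝ => r ^ (j + 2) * (1 + r ^ 2) ^ (-(s + 1)))).1 h2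
  have i1 := integral_fun_norm_addHaar (volume : Measure (Euc n))
    (fun r : ℝ => r ^ j * (1 + r ^ 2) ^ (-s))
  have i2 := integral_fun_norm_addHaar (volume : Measure (Euc n))
    (fun r : ℝ => r ^ (j + 2) * (1 + r ^ 2) ^ (-(s + 1)))
  simp only [finrank_euclideanSpace, Fintype.card_fin, smul_eq_mul, nsmul_eq_mul] at e1 e2 i1 i2
  have t1 : ∀ r : ℝ, r ^ (n - 1) * (r ^ j * (1 + r ^ 2) ^ (-s)) =
      r ^ (n + j - 1) * (1 + r ^ 2) ^ (-s) := by
    intro r; rw [← mul_assoc, ← pow_add]; congr 2; omega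
  have t2 : ∀ r : ℝ, r ^ (n - 1) * (r ^ (j + 2) * (1 + r ^ 2) ^ (-(s + 1))) =
      r ^ (n + j + 1) * (1 + r ^ 2) ^ (-(s + 1)) := by
    intro r; rw [← mul_assoc, ← pow_add]; congr 2; omega
  simp only [t1] at e1 i1
  simp only [t2] at e2 i2
  have key := integral_Ioi_pow_mul_jap (n + j) (by omega) (by push_cast; exact hs) e1 e2
  unfold jap
  rw [i1, i2]
  push_cast at key
  linear_combination (volume.real (Metric.ball (0 : Euc n) 1) * n) * key

/-- Product form of the decay of `jap`. -/
lemma jap_le_prod (x : Euc n) : jap n x ≤ ∏ i, (1 + x i ^ 2)⁻¹ := by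
  have h : ∏ i : Fin n, (1 + x i ^ 2) ≤ (1 + ‖x‖ ^ 2) ^ n := by
    calc ∏ i : Fin n, (1 + x i ^ 2) ≤ ∏ _i : Fin n, (1 + ‖x‖ ^ 2) := by
          refine Finset.prod_le_prod (fun i _ => by positivity) fun i _ => ?_
          have := PiLp.norm_apply_le x i
          have h2 : x i ^ 2 = ‖x i‖ ^ 2 := by simp
          rw [h2]; gcongr
      _ = _ := by simp
  unfold jap
  rw [Real.rpow_neg (one_add_norm_sq_pos x).le, Real.rpow_natCast, Finset.prod_inv_distrib]
  exact inv_anti₀ (Finset.prod_pos fun i _ => by positivity) h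

end Jap

/-- The Knothe rearrangement on Euclidean space, for densities with the decay of the bubble. -/
theorem exists_knothe_euc {n : ℕ} {F G : Euc n → ℝ} (hFc : Continuous F) (hGc : Continuous G)
    (hF0 : ∀ x, 0 < F x) (hG0 : ∀ x, 0 < G x) {C : ℝ} (hF : ∀ x, F x ≤ C * jap n x)
    (hG : ∀ x, G x ≤ C * jap n x)
    (hFG : ∫⁻ x, ENNReal.ofReal (F x) = ∫⁻ x, ENNReal.ofReal (G x)) :
    ∃ (T : Euc n → Euc n) (d : Fin n → Euc n → ℝ),
      Continuous T ∧ (∀ i, Continuous (d i)) ∧ (∀ i x, 0 < d i x) ∧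
      (∀ x, (∏ i, d i x) * G (T x) = F x) ∧
      (∀ i x, HasLineDerivAt ℝ (fun y => T y i) (d i x) x (EuclideanSpace.single i 1)) ∧
      ∀ h : Euc n → ENNReal, Measurable h →
        ∫⁻ x, h (T x) * ENNReal.ofReal (F x) = ∫⁻ y, h y * ENNReal.ofReal (G y) := by
  have nice : ∀ K : Euc n → ℝ, Continuous K → (∀ x, 0 < K x) → (∀ x, K x ≤ C * jap n x) →
      NiceDensity fun z : Fin n → ℝ => K (WithLp.toLp 2 z) := by
    intro K hKc hK0 hK
    refine ⟨hKc.comp (PiLp.continuous_toLp 2 _), fun _ => hK0 _, C, fun z => (hK _).trans ?_⟩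
    have hC : 0 ≤ C := by
      by_contra hC
      have := (hK0 0).trans_le (hK 0)
      nlinarith [jap_pos n (0 : Euc n)]
    exact mul_le_mul_of_nonneg_left (jap_le_prod _) hC
  have hvol := EuclideanSpace.volume_preserving_symm_measurableEquiv_toLp (Fin n)
  have hcv : ∀ k : Euc n → ENNReal, ∫⁻ z : Fin n → ℝ, k (WithLp.toLp 2 z) = ∫⁻ x, k x := by
    intro k
    exact hvol.symm.lintegral_comp_emb (MeasurableEquiv.measurableEmbedding _) k
  obtain ⟨T, d, hT, hd, hpos, hprod, hder, htr⟩ := exists_knothe n _ _ (nice F hFc hF0 hF)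
    (nice G hGc hG0 hG) (by rw [hcv (fun x => ENNReal.ofReal (F x)), hFG, ← hcv])
  have hofLp : Continuous fun x : Euc n => (WithLp.ofLp x : Fin n → ℝ) := PiLp.continuous_ofLp 2 _
  refine ⟨fun x => WithLp.toLp 2 (T (WithLp.ofLp x)), fun i x => d (WithLp.ofLp x) i,
    (PiLp.continuous_toLp 2 _).comp (hT.comp hofLp),
    fun i => (continuous_apply i).comp (hd.comp hofLp), fun i x => hpos _ i, fun x => hprod _,
    fun i x => ?_, fun h hh => ?_⟩
  · have h1 := hder (WithLp.ofLp x) i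
    have h2 : HasDerivAt (fun t : ℝ => x i + t) 1 0 := by
      simpa using (hasDerivAt_id (0 : ℝ)).const_add (x i)
    have h3 := HasDerivAt.comp (0 : ℝ) (h₂ := fun t => T (Function.update (WithLp.ofLp x) i t) i)
      (h := fun t : ℝ => x i + t) (by simpa using h1) h2
    rw [mul_one] at h3
    refine HasDerivAt.congr_of_eventuallyEq h3 (Eventually.of_forall fun t => ?_)
    simp only [Function.comp]
    congr 2
    funext j
    by_cases hj : j = i
    · subst hj; simp
    · simp [hj]
  · rw [← hcv, ← hcv]
    exact htr (fun z => h (WithLp.toLp 2 z)) (hh.comp (PiLp.continuous_toLp 2 _).measurable)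

lemma exists_cutoff_seq (n : ℕ) : ∃ (χ : ℕ → Euc n → ℝ) (C : ℝ), (∀ k, ContDiff ℝ 1 (χ k)) ∧
    (∀ k, HasCompactSupport (χ k)) ∧ (∀ k x, 0 ≤ χ k x) ∧ (∀ k x, χ k x ≤ 1) ∧
    (∀ k x, ‖fderiv ℝ (χ k) x‖ ≤ C / (k + 1)) ∧ ∀ x, Tendsto (fun k => χ k x) atTop (𝓝 1) := by
  let b : ContDiffBump (0 : Euc n) := ⟨1, 2, one_pos, one_lt_two⟩
  have hb : ContDiff ℝ 1 b := b.contDiff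
  obtain ⟨C, hC⟩ := (hb.continuous_fderiv one_ne_zero).bounded_above_of_compact_support
    (b.hasCompactSupport.fderiv (𝕜 := ℝ))
  refine ⟨fun k x => b (((k : ℝ) + 1)⁻¹ • x), C, fun k => hb.comp (contDiff_const_smul _),
    fun k => b.hasCompactSupport.comp_smul (by positivity), fun k x => b.nonneg, fun k x => b.le_one,
    fun k x => ?_, fun x => ?_⟩
  · have h := (hb.differentiable one_ne_zero (((k : ℝ) + 1)⁻¹ • x)).hasFDerivAt.comp x
      ((((k : ℝ) + 1)⁻¹ • ContinuousLinearMap.id ℝ (Euc n)).hasFDerivAt)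
    have h2 : fderiv ℝ (fun x => b (((k : ℝ) + 1)⁻¹ • x)) x =
        (fderiv ℝ b (((k : ℝ) + 1)⁻¹ • x)).comp
          (((k : ℝ) + 1)⁻¹ • ContinuousLinearMap.id ℝ (Euc n)) := h.fderiv
    rw [h2, ContinuousLinearMap.comp_smul, ContinuousLinearMap.comp_id, norm_smul, norm_inv,
      Real.norm_of_nonneg (by positivity), div_eq_inv_mul]
    exact mul_le_mul_of_nonneg_left (hC _) (by positivity)
  · have h1 : Tendsto (fun k : ℕ => ((k : ℝ) + 1)⁻¹ • x) atTop (𝓝 ((0 : ℝ) • x)) :=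
      (tendsto_inv_atTop_zero.comp (tendsto_natCast_atTop_atTop.atTop_add tendsto_const_nhds)).smul_const x
    rw [zero_smul] at h1
    have h2 := hb.continuous.continuousAt.tendsto.comp h1
    have h3 : b 0 = 1 := b.one_of_mem_closedBall (by simp [b])
    rwa [h3] at h2

lemma amgm_jacobian {n : ℕ} (hn : 0 < n) {d : Fin n → ℝ} (hd : ∀ i, 0 < d i) {F G : ℝ}
    (hG : 0 < G) (hF : (∏ i, d i) * G = F) :
    n * (G ^ (-(1 / n : ℝ)) * F) ≤ F ^ (1 - 1 / n : ℝ) * ∑ i, d i := by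
  have hn' : (0 : ℝ) < n := by exact_mod_cast hn
  have hp : 0 < ∏ i, d i := Finset.prod_pos fun i _ => hd i
  have hF0 : 0 < F := hF ▸ mul_pos hp hG
  have h := Real.geom_mean_le_arith_mean_weighted Finset.univ (fun _ => (1 / n : ℝ)) d
    (fun _ _ => by positivity) (by simp [hn'.ne']) (fun i _ => (hd i).le)
  rw [Real.finsetProd_rpow _ _ (fun i _ => (hd i).le), ← Finset.mul_sum] at h
  have h2 : G ^ (-(1 / n : ℝ)) * F = F ^ (1 - 1 / n : ℝ) * (∏ i, d i) ^ (1 / n : ℝ) := by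
    have e : ∏ i, d i = F / G := by field_simp; exact hF
    rw [e, Real.div_rpow hF0.le hG.le, Real.rpow_sub hF0, Real.rpow_one, Real.rpow_neg hG.le]
    have := (Real.rpow_pos_of_pos hF0 (1 / n : ℝ)).ne'
    field_simp
  rw [h2]
  calc _ = F ^ (1 - 1 / n : ℝ) * (n * (∏ i, d i) ^ (1 / n : ℝ)) := by ring
    _ ≤ F ^ (1 - 1 / n : ℝ) * (n * (1 / n * ∑ i, d i)) := by gcongr
    _ = _ := by field_simp

lemma integral_comp_of_lintegral_comp {n : ℕ} {F G : Euc n → ℝ} {T : Euc n → Euc n}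
    (hFc : Continuous F) (hTc : Continuous T)
    (hF0 : ∀ x, 0 < F x) (hG0 : ∀ x, 0 < G x)
    (htr : ∀ h : Euc n → ENNReal, Measurable h →
        ∫⁻ x, h (T x) * ENNReal.ofReal (F x) = ∫⁻ y, h y * ENNReal.ofReal (G y))
    {h : Euc n → ℝ} (hc : Continuous h) (h0 : ∀ x, 0 ≤ h x) (hi : Integrable fun x => h x * G x) :
    Integrable (fun x => h (T x) * F x) ∧ ∫ x, h (T x) * F x = ∫ x, h x * G x := by
  have key := htr (fun x => ENNReal.ofReal (h x)) hc.measurable.ennreal_ofReal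
  simp_rw [← ENNReal.ofReal_mul (h0 _)] at key
  have hm : AEStronglyMeasurable (fun x => h (T x) * F x) volume :=
    ((hc.comp hTc).mul hFc).aestronglyMeasurable
  have hn1 : 0 ≤ᵐ[volume] fun x => h (T x) * F x :=
    Eventually.of_forall fun x => mul_nonneg (h0 _) (hF0 _).le
  have hn2 : 0 ≤ᵐ[volume] fun x => h x * G x :=
    Eventually.of_forall fun x => mul_nonneg (h0 _) (hG0 _).le
  constructor
  · rw [← lintegral_ofReal_ne_top_iff_integrable hm hn1, key]
    exact (lintegral_ofReal_ne_top_iff_integrable hi.1 hn2).2 hi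
  · rw [integral_eq_lintegral_of_nonneg_ae hn1 hm, integral_eq_lintegral_of_nonneg_ae hn2 hi.1, key]

/-- Integration by parts against a triangular map. -/
lemma integral_mul_sum_diag {n : ℕ} {ψ : Euc n → ℝ} (hψ : ContDiff ℝ 1 ψ)
    (hψc : HasCompactSupport ψ) {T : Euc n → Euc n} {d : Fin n → Euc n → ℝ} (hT : Continuous T)
    (hd : ∀ i, Continuous (d i))
    (hder : ∀ i x, HasLineDerivAt ℝ (fun y => T y i) (d i x) x (EuclideanSpace.single i 1)) :
    ∫ x, ψ x * ∑ i, d i x = - ∫ x, fderiv ℝ ψ x (T x) := by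
  have hTi : ∀ i, Continuous fun x => T x i := fun i => (PiLp.continuous_apply 2 _ i).comp hT
  have hfd : ∀ v : Euc n, Continuous fun x => fderiv ℝ ψ x v := fun v =>
    (hψ.continuous_fderiv one_ne_zero).clm_apply continuous_const
  have hfc : ∀ v : Euc n, HasCompactSupport fun x => fderiv ℝ ψ x v := fun v =>
    hψc.fderiv_apply ℝ v
  have i1 : ∀ i, Integrable fun x => ψ x * d i x := fun i =>
    (hψ.continuous.mul (hd i)).integrable_of_hasCompactSupport hψc.mul_right
  have i2 : ∀ i, Integrable fun x => fderiv ℝ ψ x (EuclideanSpace.single i 1) * T x i := fun i =>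
    ((hfd _).mul (hTi i)).integrable_of_hasCompactSupport (hfc _).mul_right
  have hexp : ∀ x, fderiv ℝ ψ x (T x) =
      ∑ i, fderiv ℝ ψ x (EuclideanSpace.single i 1) * T x i := by
    intro x
    conv_lhs => rw [← (EuclideanSpace.basisFun (Fin n) ℝ).sum_repr (T x)]
    simp [mul_comm]
  simp_rw [hexp, Finset.mul_sum]
  rw [integral_finsetSum _ fun i _ => i1 i, integral_finsetSum _ fun i _ => i2 i,
    ← Finset.sum_neg_distrib]
  refine Finset.sum_congr rfl fun i _ => ?_
  exact integral_bilinear_hasLineDerivAt_right_eq_neg_left_of_integrable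
    (B := ContinuousLinearMap.mul ℝ ℝ) (f := ψ) (g := fun x => T x i) (g' := d i)
    (v := EuclideanSpace.single i 1) (i2 i) (i1 i)
    ((hψ.continuous.mul (hTi i)).integrable_of_hasCompactSupport hψc.mul_right)
    (fun x _ => (hψ.differentiable one_ne_zero x).hasFDerivAt.hasLineDerivAt _)
    (fun x _ => hder i x)

/-- The mass `∫ (1 + ‖x‖²)^(-n)`. -/
def bubbleMass (n : ℕ) : ℝ := ∫ x : Euc n, jap n x

/-- The second moment `∫ ‖x‖² (1 + ‖x‖²)^(-n)`. -/
def bubbleMoment (n : ℕ) : ℝ := ∫ x : Euc n, ‖x‖ ^ 2 * jap n x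

lemma integrable_normSq_mul_jap {n : ℕ} {s : ℝ} (h : n < 2 * (s - 1)) :
    Integrable fun x : Euc n => ‖x‖ ^ 2 * jap s x := by
  refine (integrable_jap h).mono' ((continuous_norm.pow 2).mul (continuous_jap s)).aestronglyMeasurable
    (Eventually.of_forall fun x => ?_)
  rw [Real.norm_of_nonneg (mul_nonneg (by positivity) (jap_pos _ _).le)]
  exact normSq_mul_jap_le s x

lemma integral_pos_of_continuous_pos {n : ℕ} {f : Euc n → ℝ} (hi : Integrable f)
    (h0 : ∀ x, x ≠ 0 → 0 < f x) (hn : 0 < n) : 0 < ∫ x, f x := by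
  have : Nonempty (Fin n) := ⟨⟨0, hn⟩⟩
  have hae : ∀ᵐ x : Euc n, x ≠ 0 := by simp [ae_iff, measure_singleton]
  have hnn : 0 ≤ᵐ[volume] f := by filter_upwards [hae] with x hx using (h0 x hx).le
  refine (integral_pos_iff_support_of_nonneg_ae hnn hi).2 ?_
  have : Function.support f =ᵐ[volume] Set.univ := by
    refine eventuallyEq_univ.2 ?_
    filter_upwards [hae] with x hx using (h0 x hx).ne'
  rw [measure_congr this]
  exact Measure.measure_univ_pos.2 (NeZero.ne _)

lemma bubbleMass_pos {n : ℕ} (hn : 0 < n) : 0 < bubbleMass n :=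
  integral_pos_of_continuous_pos (integrable_jap (by have : (0 : ℝ) < n := by exact_mod_cast hn
                                                     linarith)) (fun x _ => jap_pos _ x) hn

lemma bubbleMoment_pos {n : ℕ} (hn : 5 ≤ n) : 0 < bubbleMoment n := by
  have hn' : (5 : ℝ) ≤ n := by exact_mod_cast hn
  exact integral_pos_of_continuous_pos (integrable_normSq_mul_jap (by linarith))
    (fun x hx => mul_pos (by have := norm_pos_iff.2 hx; positivity) (jap_pos _ x)) (by omega)

lemma integral_jap_sub_one {n : ℕ} (hn : 5 ≤ n) :
    n * ∫ x : Euc n, jap (n - 1) x = 2 * (n - 1) * bubbleMoment n := by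
  have hn' : (5 : ℝ) ≤ n := by exact_mod_cast hn
  have := integral_norm_pow_mul_jap (n := n) (s := n - 1) (by omega) 0 (by push_cast; linarith)
    (by simpa using integrable_jap (by linarith))
    (by simpa using integrable_normSq_mul_jap (by linarith))
  simpa [bubbleMoment] using this

/-- Integrals of products of square-integrable continuous functions. -/
lemma integral_mul_sq_le {n : ℕ} {f g : Euc n → ℝ} (hf : Continuous f) (hg : Continuous g)
    (hf0 : ∀ x, 0 ≤ f x) (hg0 : ∀ x, 0 ≤ g x) (hfi : Integrable fun x => f x ^ 2)
    (hgi : Integrable fun x => g x ^ 2) :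
    Integrable (fun x => f x * g x) ∧
      (∫ x, f x * g x) ^ 2 ≤ (∫ x, f x ^ 2) * ∫ x, g x ^ 2 := by
  have hf2 := (memLp_two_iff_integrable_sq hf.aestronglyMeasurable (μ := volume)).2 hfi
  have hg2 := (memLp_two_iff_integrable_sq hg.aestronglyMeasurable (μ := volume)).2 hgi
  refine ⟨hf2.integrable_mul hg2, ?_⟩
  have h := integral_mul_le_Lp_mul_Lq_of_nonneg (μ := volume) Real.HolderConjugate.two_two
    (Eventually.of_forall hf0) (Eventually.of_forall hg0) (by simpa using hf2) (by simpa using hg2)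
  simp only [Real.rpow_two, ← Real.sqrt_eq_rpow] at h
  have h0 : 0 ≤ ∫ x, f x * g x := integral_nonneg fun x => mul_nonneg (hf0 x) (hg0 x)
  calc _ ≤ (√(∫ x, f x ^ 2) * √(∫ x, g x ^ 2)) ^ 2 := by gcongr
    _ = _ := by
      rw [mul_pow, Real.sq_sqrt (integral_nonneg fun x => sq_nonneg _),
        Real.sq_sqrt (integral_nonneg fun x => sq_nonneg _)]

/-- The sharp Sobolev inequality for positive functions with the decay of the bubble. -/
theorem sobolev_of_pos {n : ℕ} (hn : 5 ≤ n) {q : ℝ} (hq : q = 2 * (n : ℝ) / ((n : ℝ) - 2))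
    {f : Euc n → ℝ} (hf : ContDiff ℝ 1 f) (hf0 : ∀ x, 0 < f x) {C : ℝ}
    (hfC : ∀ x, f x ≤ C * jap ((n - 2) / 2) x) (hfi : Integrable fun x => ‖fderiv ℝ f x‖ ^ 2) :
    (n - 2) ^ 2 * bubbleMoment n * ((∫ x, f x ^ q) / bubbleMass n) ^ (2 / q) ≤
      ∫ x, ‖fderiv ℝ f x‖ ^ 2 := by
  have hn' : (5 : ℝ) ≤ n := by exact_mod_cast hn
  have hq0 : 0 < q := by rw [hq]; exact div_pos (by linarith) (by linarith)
  have hC : 0 < C := by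
    by_contra hC
    have := (hf0 0).trans_le (hfC 0)
    nlinarith [jap_pos ((n - 2) / 2) (0 : Euc n)]
  have hrpow : ∀ s : ℝ, Continuous fun x => f x ^ s := fun s =>
    hf.continuous.rpow_const fun x => Or.inl (hf0 x).ne'
  have hfq : ∀ x, f x ^ q ≤ C ^ q * jap n x := by
    intro x
    refine (Real.rpow_le_rpow (hf0 x).le (hfC x) hq0.le).trans_eq ?_
    rw [Real.mul_rpow hC.le (jap_pos _ _).le, jap_rpow]
    congr 2
    rw [hq]; field_simp [show (n : ℝ) - 2 ≠ 0 by linarith]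
  have hfqi : Integrable fun x => f x ^ q :=
    ((integrable_jap (s := n) (by linarith)).const_mul (C ^ q)).mono' (hrpow q).aestronglyMeasurable
      (Eventually.of_forall fun x => by
        rw [Real.norm_of_nonneg (Real.rpow_nonneg (hf0 x).le _)]; exact hfq x)
  set M := ∫ x, f x ^ q with hM
  set N := bubbleMass n with hN
  set P := bubbleMoment n with hP
  have hM0 : 0 < M := integral_pos_of_continuous_pos hfqi
    (fun x _ => Real.rpow_pos_of_pos (hf0 x) _) (by omega)
  have hN0 : 0 < N := bubbleMass_pos (by omega)
  have hP0 : 0 < P := bubbleMoment_pos hn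
  set F : Euc n → ℝ := fun x => f x ^ q / M with hF
  set G : Euc n → ℝ := fun x => jap n x / N with hG
  have hFc : Continuous F := (hrpow q).div_const _
  have hGc : Continuous G := (continuous_jap _).div_const _
  have hF0 : ∀ x, 0 < F x := fun x => div_pos (Real.rpow_pos_of_pos (hf0 x) _) hM0
  have hG0 : ∀ x, 0 < G x := fun x => div_pos (jap_pos _ _) hN0
  have hGi : Integrable G := (integrable_jap (by linarith)).div_const _
  have hmass : ∫⁻ x, ENNReal.ofReal (F x) = ∫⁻ x, ENNReal.ofReal (G x) := by
    rw [← ofReal_integral_eq_lintegral_ofReal (hfqi.div_const _)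
        (Eventually.of_forall fun x => (hF0 x).le),
      ← ofReal_integral_eq_lintegral_ofReal hGi (Eventually.of_forall fun x => (hG0 x).le)]
    congr 1
    simp only [hG]
    rw [integral_div, integral_div, div_self hM0.ne']
    exact (div_self hN0.ne').symm
  obtain ⟨T, d, hTc, hdc, hdpos, hprod, hder, htr⟩ := exists_knothe_euc hFc hGc hF0 hG0
    (C := max (C ^ q / M) (1 / N))
    (fun x => by
      refine le_trans ?_ (mul_le_mul_of_nonneg_right (le_max_left _ _) (jap_pos _ _).le)
      simp only [hF]
      rw [div_mul_eq_mul_div]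
      exact div_le_div_of_nonneg_right (hfq x) hM0.le)
    (fun x => by
      refine le_trans ?_ (mul_le_mul_of_nonneg_right (le_max_right _ _) (jap_pos _ _).le)
      simp only [hG]
      rw [div_mul_eq_mul_div, one_mul]) hmass
  set w : Euc n → ℝ := fun y => G y ^ (-(1 / n : ℝ)) with hw
  have hwc : Continuous w := hGc.rpow_const fun x => Or.inl (hG0 x).ne'
  have hw0 : ∀ y, 0 ≤ w y := fun y => Real.rpow_nonneg (hG0 y).le _
  have hwG : ∀ y, w y * G y = N ^ (1 / n - 1 : ℝ) * jap (n - 1) y := by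
    intro y
    have h1 : w y * G y = G y ^ (1 - 1 / n : ℝ) := by
      simp only [hw]
      rw [← Real.rpow_add_one (hG0 y).ne']; ring_nf
    rw [h1]
    simp only [hG]
    rw [Real.div_rpow (jap_pos _ _).le hN0.le, jap_rpow,
      show (1 / n - 1 : ℝ) = -(1 - 1 / n) by ring, Real.rpow_neg hN0.le]
    rw [show (n : ℝ) * (1 - 1 / n) = n - 1 by field_simp]
    ring
  have hJi : Integrable (jap (n - 1) : Euc n → ℝ) := integrable_jap (by linarith)
  obtain ⟨hwi, hwe⟩ := integral_comp_of_lintegral_comp hFc hTc hF0 hG0 htr hwc hw0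
    ((hJi.const_mul (N ^ (1 / n - 1 : ℝ))).congr (Eventually.of_forall fun y => (hwG y).symm))
  have hTG : ∀ y : Euc n, ‖y‖ ^ 2 * G y = (‖y‖ ^ 2 * jap n y) / N := fun y => by
    simp only [hG]; ring
  obtain ⟨hTi, hTe⟩ := integral_comp_of_lintegral_comp hFc hTc hF0 hG0 htr
    (h := fun y : Euc n => ‖y‖ ^ 2) (continuous_norm.pow 2) (fun y => sq_nonneg ‖y‖)
    (((integrable_normSq_mul_jap (by linarith)).div_const N).congr
      (Eventually.of_forall fun y => (hTG y).symm))
  simp_rw [hwG] at hwe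
  rw [integral_const_mul] at hwe
  simp_rw [hTG] at hTe
  rw [integral_div] at hTe
  change _ = P / N at hTe
  set α : ℝ := 2 * (n - 1) / (n - 2) with hα
  have hn2 : (n : ℝ) - 2 ≠ 0 := by linarith
  have hα0 : 0 < α := div_pos (by linarith) (by linarith)
  have hαq : q * (1 - 1 / n) = α := by rw [hq, hα]; field_simp
  have hα1 : (α - 1) * 2 = q := by rw [hα, hq]; field_simp; ring
  have hsqT : ∀ x, (f x ^ (α - 1) * ‖T x‖) ^ 2 = M * (‖T x‖ ^ 2 * F x) := by
    intro x
    rw [mul_pow, ← Real.rpow_mul_natCast (hf0 x).le]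
    push_cast
    rw [hα1]; simp only [hF]; field_simp
  have hTcn : Continuous fun x => f x ^ (α - 1) * ‖T x‖ := (hrpow _).mul hTc.norm
  have hTn0 : ∀ x, 0 ≤ f x ^ (α - 1) * ‖T x‖ := fun x =>
    mul_nonneg (Real.rpow_nonneg (hf0 x).le _) (norm_nonneg _)
  have hTsq : Integrable fun x => (f x ^ (α - 1) * ‖T x‖) ^ 2 :=
    (hTi.const_mul M).congr (Eventually.of_forall fun x => (hsqT x).symm)
  obtain ⟨hI2, hI2le⟩ := integral_mul_sq_le (hf.continuous_fderiv one_ne_zero).norm hTcn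
    (fun x => norm_nonneg _) hTn0 hfi hTsq
  have hf2 : Integrable fun x => f x ^ 2 := by
    refine ((integrable_jap (s := n - 2) (by linarith)).const_mul (C ^ 2)).mono'
      (hf.continuous.pow 2).aestronglyMeasurable (Eventually.of_forall fun x => ?_)
    rw [Real.norm_of_nonneg (sq_nonneg _)]
    calc f x ^ 2 ≤ (C * jap ((n - 2) / 2) x) ^ 2 := pow_le_pow_left₀ (hf0 x).le (hfC x) 2
      _ = _ := by rw [mul_pow, jap_sq]; ring_nf
  obtain ⟨hI1, -⟩ := integral_mul_sq_le hf.continuous hTcn (fun x => (hf0 x).le) hTn0 hf2 hTsq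
  simp_rw [hsqT] at hI2le
  rw [integral_const_mul, hTe] at hI2le
  set I1 := ∫ x, f x * (f x ^ (α - 1) * ‖T x‖) with hI1d
  set I2 := ∫ x, ‖fderiv ℝ f x‖ * (f x ^ (α - 1) * ‖T x‖) with hI2d
  set E := ∫ x, ‖fderiv ℝ f x‖ ^ 2 with hE
  obtain ⟨χ, B, hχ1, hχc, hχ0, hχle, hχd, hχt⟩ := exists_cutoff_seq n
  have hFα : ∀ x, F x ^ (1 - 1 / n : ℝ) = M ^ (-(1 - 1 / n : ℝ)) * f x ^ α := by
    intro x
    simp only [hF]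
    rw [Real.div_rpow (Real.rpow_nonneg (hf0 x).le _) hM0.le, ← Real.rpow_mul (hf0 x).le, hαq,
      Real.rpow_neg hM0.le]
    ring
  have hcut : ∀ k : ℕ, n * ∫ x, χ k x * (w (T x) * F x) ≤
      M ^ (-(1 - 1 / n : ℝ)) * (B / (k + 1) * I1 + α * I2) := by
    intro k
    have hψ1 : ContDiff ℝ 1 fun x => χ k x * f x ^ α :=
      (hχ1 k).mul (hf.rpow_const_of_ne fun x => (hf0 x).ne')
    have hψc : HasCompactSupport fun x => χ k x * f x ^ α := (hχc k).mul_right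
    have hibp := integral_mul_sum_diag hψ1 hψc hTc hdc hder
    have hsum : Continuous fun x => ∑ i, d i x := continuous_finsetSum _ fun i _ => hdc i
    have hfd : ∀ x, ‖fderiv ℝ (fun x => χ k x * f x ^ α) x (T x)‖ ≤
        B / (k + 1) * (f x * (f x ^ (α - 1) * ‖T x‖)) +
          α * (‖fderiv ℝ f x‖ * (f x ^ (α - 1) * ‖T x‖)) := by
      intro x
      have h1 := ((hχ1 k).differentiable one_ne_zero x).hasFDerivAt.mul
        ((hf.differentiable one_ne_zero x).hasFDerivAt.rpow_const (p := α)
          (Or.inl (hf0 x).ne'))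
      have h2 : fderiv ℝ (fun x => χ k x * f x ^ α) x =
          χ k x • (α * f x ^ (α - 1)) • fderiv ℝ f x + f x ^ α • fderiv ℝ (χ k) x := h1.fderiv
      have hfa : 0 < f x ^ (α - 1) := Real.rpow_pos_of_pos (hf0 x) _
      have hff : f x ^ α = f x * f x ^ (α - 1) := by
        rw [← Real.rpow_one_add' (hf0 x).le (by linarith)]; ring_nf
      rw [h2]
      refine (ContinuousLinearMap.le_opNorm _ _).trans ?_
      have h3 : ‖χ k x • (α * f x ^ (α - 1)) • fderiv ℝ f x + f x ^ α • fderiv ℝ (χ k) x‖ ≤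
          α * f x ^ (α - 1) * ‖fderiv ℝ f x‖ + f x ^ α * (B / (k + 1)) := by
        refine (norm_add_le _ _).trans (add_le_add ?_ ?_)
        · rw [norm_smul, norm_smul, Real.norm_of_nonneg (hχ0 k x),
            Real.norm_of_nonneg (mul_pos hα0 hfa).le]
          exact mul_le_of_le_one_left (by positivity) (hχle k x)
        · rw [norm_smul, Real.norm_of_nonneg (Real.rpow_nonneg (hf0 x).le _)]
          exact mul_le_mul_of_nonneg_left (hχd k x) (Real.rpow_nonneg (hf0 x).le _)
      refine (mul_le_mul_of_nonneg_right h3 (norm_nonneg _)).trans_eq ?_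
      rw [hff]; ring
    have hbi : Integrable fun x => B / (k + 1) * (f x * (f x ^ (α - 1) * ‖T x‖)) +
          α * (‖fderiv ℝ f x‖ * (f x ^ (α - 1) * ‖T x‖)) :=
      (hI1.const_mul _).add (hI2.const_mul _)
    calc n * ∫ x, χ k x * (w (T x) * F x)
        = ∫ x, χ k x * (n * (w (T x) * F x)) := by
          rw [← integral_const_mul]; congr 1; funext x; ring
      _ ≤ ∫ x, M ^ (-(1 - 1 / n : ℝ)) * ((χ k x * f x ^ α) * ∑ i, d i x) := by
          refine integral_mono ?_ ?_ fun x => ?_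
          · exact ((hχ1 k).continuous.mul (continuous_const.mul
              ((hwc.comp hTc).mul hFc))).integrable_of_hasCompactSupport (hχc k).mul_right
          · exact ((hψ1.continuous.mul hsum).integrable_of_hasCompactSupport
              hψc.mul_right).const_mul _
          · have := amgm_jacobian (by omega) (fun i => hdpos i x) (hG0 (T x)) (hprod x)
            rw [hFα] at this
            refine (mul_le_mul_of_nonneg_left this (hχ0 k x)).trans_eq ?_
            ring
      _ = M ^ (-(1 - 1 / n : ℝ)) * -∫ x, fderiv ℝ (fun x => χ k x * f x ^ α) x (T x) := by
          rw [integral_const_mul, hibp]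
      _ ≤ _ := by
          refine mul_le_mul_of_nonneg_left ?_ (Real.rpow_nonneg hM0.le _)
          rw [hI1d, hI2d, ← integral_const_mul, ← integral_const_mul,
            ← integral_add (hI1.const_mul _) (hI2.const_mul _)]
          refine (neg_le_abs _).trans ?_
          exact norm_integral_le_of_norm_le hbi (Eventually.of_forall hfd)
  have hlim1 : Tendsto (fun k : ℕ => (n : ℝ) * ∫ x, χ k x * (w (T x) * F x)) atTop
      (𝓝 (n * ∫ x, w (T x) * F x)) := by
    refine Tendsto.const_mul _ ?_
    refine tendsto_integral_of_dominated_convergence (fun x => w (T x) * F x)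
      (fun k => ((hχ1 k).continuous.mul ((hwc.comp hTc).mul hFc)).aestronglyMeasurable) hwi
      (fun k => Eventually.of_forall fun x => ?_) (Eventually.of_forall fun x => ?_)
    · rw [norm_mul, Real.norm_of_nonneg (hχ0 k x), Real.norm_of_nonneg
        (mul_nonneg (hw0 _) (hF0 x).le)]
      exact mul_le_of_le_one_left (mul_nonneg (hw0 _) (hF0 x).le) (hχle k x)
    · simpa using (hχt x).mul_const (w (T x) * F x)
  have hlim2 : Tendsto (fun k : ℕ => M ^ (-(1 - 1 / n : ℝ)) * (B / ((k : ℝ) + 1) * I1 + α * I2)) atTop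
      (𝓝 (M ^ (-(1 - 1 / n : ℝ)) * (0 * I1 + α * I2))) := by
    refine (((?_ : Tendsto _ _ _).mul_const _).add_const _).const_mul _
    exact tendsto_const_nhds.div_atTop
      (tendsto_natCast_atTop_atTop.atTop_add tendsto_const_nhds)
  have hmain := le_of_tendsto_of_tendsto' hlim1 hlim2 hcut
  rw [hwe, zero_mul, zero_add] at hmain
  have hJ := integral_jap_sub_one hn
  have hmain2 : 2 * (n - 1) * P * N ^ (1 / n - 1 : ℝ) ≤ M ^ (-(1 - 1 / n : ℝ)) * (α * I2) := by
    refine le_trans (le_of_eq ?_) hmain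
    rw [← hJ]; ring
  have hsq : (2 * (n - 1) * P * N ^ (1 / n - 1 : ℝ)) ^ 2 ≤
      (M ^ (-(1 - 1 / n : ℝ)) * α) ^ 2 * (E * (M * (P / N))) := by
    calc _ ≤ (M ^ (-(1 - 1 / n : ℝ)) * (α * I2)) ^ 2 := by
          refine pow_le_pow_left₀ ?_ hmain2 2
          have : 0 < (n : ℝ) - 1 := by linarith
          positivity
      _ = (M ^ (-(1 - 1 / n : ℝ)) * α) ^ 2 * I2 ^ 2 := by ring
      _ ≤ _ := by gcongr
  have e2q : 2 / q = 1 - 2 / n := by rw [hq]; field_simp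
  rw [e2q, Real.div_rpow hM0.le hN0.le]
  have eN : (N ^ (1 / n - 1 : ℝ)) ^ 2 = (N * N ^ (1 - 2 / n : ℝ))⁻¹ := by
    rw [← Real.rpow_mul_natCast hN0.le, ← Real.rpow_one_add' hN0.le, ← Real.rpow_neg hN0.le]
    · congr 1; push_cast; ring
    · have : 2 / (n : ℝ) < 1 := by rw [div_lt_one] <;> linarith
      linarith
  have eM : (M ^ (-(1 - 1 / n : ℝ))) ^ 2 = (M * M ^ (1 - 2 / n : ℝ))⁻¹ := by
    rw [← Real.rpow_mul_natCast hM0.le, ← Real.rpow_one_add' hM0.le, ← Real.rpow_neg hM0.le]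
    · congr 1; push_cast; ring
    · have : 2 / (n : ℝ) < 1 := by rw [div_lt_one] <;> linarith
      linarith
  rw [mul_pow, eN, mul_pow (M ^ (-(1 - 1 / n : ℝ))) α, eM] at hsq
  have hMp := Real.rpow_pos_of_pos hM0 (1 - 2 / n : ℝ)
  have hNp := Real.rpow_pos_of_pos hN0 (1 - 2 / n : ℝ)
  have hn1 : 0 < (n : ℝ) - 1 := by linarith
  have hn2' : 0 < (n : ℝ) - 2 := by linarith
  rw [hα] at hsq
  set X := M ^ (1 - 2 / n : ℝ)
  set Y := N ^ (1 - 2 / n : ℝ)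
  have hk : 0 < (4 * (n - 1 : ℝ) ^ 2 * P) / ((n - 2) ^ 2 * N * X) := by positivity
  refine le_of_mul_le_mul_left ?_ hk
  calc _ = (2 * ((n : ℝ) - 1) * P) ^ 2 * (N * Y)⁻¹ := by field_simp; ring
    _ ≤ _ := hsq
    _ = _ := by field_simp; ring

lemma norm_fderiv_bubble_sq {n : ℕ} (hn : 2 ≤ n) (x : Euc n) :
    ‖fderiv ℝ (jap (((n : ℝ) - 2) / 2)) x‖ ^ 2 = (n - 2) ^ 2 * (‖x‖ ^ 2 * jap n x) := by
  have hn' : (2 : ℝ) ≤ n := by exact_mod_cast hn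
  rw [norm_fderiv_jap (by linarith), mul_pow, mul_pow, jap_sq]
  ring_nf

lemma norm_fderiv_sqrt_sq_le {n : ℕ} {u g : Euc n → ℝ} {x : Euc n} (hu : DifferentiableAt ℝ u x)
    (hg : DifferentiableAt ℝ g x) (hx : g x ≠ 0) :
    ‖fderiv ℝ (fun y => √(u y ^ 2 + g y ^ 2)) x‖ ^ 2 ≤ ‖fderiv ℝ u x‖ ^ 2 + ‖fderiv ℝ g x‖ ^ 2 := by
  have hpos : 0 < u x ^ 2 + g x ^ 2 := by positivity
  have h := ((hu.hasFDerivAt.pow 2).add (hg.hasFDerivAt.pow 2)).sqrt hpos.ne'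
  have h' : fderiv ℝ (fun y => √(u y ^ 2 + g y ^ 2)) x =
      (u x / √(u x ^ 2 + g x ^ 2)) • fderiv ℝ u x + (g x / √(u x ^ 2 + g x ^ 2)) • fderiv ℝ g x := by
    refine HasFDerivAt.fderiv (h.congr_fderiv ?_)
    ext v
    simp
    field_simp
  have hs : 0 < √(u x ^ 2 + g x ^ 2) := Real.sqrt_pos.2 hpos
  have hsq : √(u x ^ 2 + g x ^ 2) ^ 2 = u x ^ 2 + g x ^ 2 := Real.sq_sqrt hpos.le
  set s := √(u x ^ 2 + g x ^ 2)
  set A := ‖fderiv ℝ u x‖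
  set B := ‖fderiv ℝ g x‖
  have hab : |u x / s| ^ 2 + |g x / s| ^ 2 = 1 := by
    rw [sq_abs, sq_abs, div_pow, div_pow, ← add_div, hsq, div_self hpos.ne']
  have hn : ‖fderiv ℝ (fun y => √(u y ^ 2 + g y ^ 2)) x‖ ≤ |u x / s| * A + |g x / s| * B := by
    rw [h']
    refine (norm_add_le _ _).trans ?_
    rw [norm_smul, norm_smul, Real.norm_eq_abs, Real.norm_eq_abs]
  calc _ ≤ (|u x / s| * A + |g x / s| * B) ^ 2 := by gcongr
    _ ≤ (|u x / s| ^ 2 + |g x / s| ^ 2) * (A ^ 2 + B ^ 2) := by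
      nlinarith [sq_nonneg (|u x / s| * B - |g x / s| * A)]
    _ = _ := by rw [hab, one_mul]

lemma integrable_norm_fderiv_sq {n : ℕ} {u : Euc n → ℝ} (hu : ContDiff ℝ 1 u)
    (huc : HasCompactSupport u) : Integrable fun x => ‖fderiv ℝ u x‖ ^ 2 := by
  have h1 : Continuous fun x => ‖fderiv ℝ u x‖ ^ 2 := (hu.continuous_fderiv one_ne_zero).norm.pow 2
  have h2 : HasCompactSupport fun x => ‖fderiv ℝ u x‖ ^ 2 :=
    (huc.fderiv (𝕜 := ℝ)).comp_left (g := fun L => ‖L‖ ^ 2) (by simp)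
  exact h1.integrable_of_hasCompactSupport h2

/-- The sharp Sobolev inequality for compactly supported functions. -/
theorem sobolev_of_hasCompactSupport {n : ℕ} (hn : 5 ≤ n) {q : ℝ}
    (hq : q = 2 * (n : ℝ) / ((n : ℝ) - 2)) {u : Euc n → ℝ} (hu : ContDiff ℝ 1 u)
    (huc : HasCompactSupport u) :
    (n - 2) ^ 2 * bubbleMoment n * ((∫ x, |u x| ^ q) / bubbleMass n) ^ (2 / q) ≤
      ∫ x, ‖fderiv ℝ u x‖ ^ 2 := by
  have hn' : (5 : ℝ) ≤ n := by exact_mod_cast hn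
  have hq0 : 0 < q := by rw [hq]; exact div_pos (by linarith) (by linarith)
  set g : Euc n → ℝ := jap (((n : ℝ) - 2) / 2) with hg
  have hgd : ContDiff ℝ 1 g := contDiff_jap _
  have hgp : ∀ x, 0 < g x := jap_pos _
  obtain ⟨C, hC⟩ : ∃ C, ∀ x, ‖u x / g x‖ ≤ C := by
    refine HasCompactSupport.exists_bound_of_continuous ?_
      (hu.continuous.div hgd.continuous fun x => (hgp x).ne')
    simp only [div_eq_mul_inv]
    exact huc.mul_right (f' := fun x => (g x)⁻¹)
  have hC0 : 0 ≤ C := (norm_nonneg _).trans (hC 0)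
  have hui : Integrable fun x => ‖fderiv ℝ u x‖ ^ 2 := integrable_norm_fderiv_sq hu huc
  have hgi : Integrable fun x => ‖fderiv ℝ g x‖ ^ 2 := by
    simp only [hg, norm_fderiv_bubble_sq (by omega : 2 ≤ n)]
    exact (integrable_normSq_mul_jap (by linarith)).const_mul _
  have key : ∀ δ : ℝ, 0 < δ →
      (n - 2) ^ 2 * bubbleMoment n * ((∫ x, |u x| ^ q) / bubbleMass n) ^ (2 / q) ≤
      (∫ x, ‖fderiv ℝ u x‖ ^ 2) + δ ^ 2 * ∫ x, ‖fderiv ℝ g x‖ ^ 2 := by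
    intro δ hδ
    set f : Euc n → ℝ := fun x => √(u x ^ 2 + (δ * g x) ^ 2) with hf
    have hpos : ∀ x, 0 < u x ^ 2 + (δ * g x) ^ 2 := fun x => by
      have := hgp x; positivity
    have hfd : ContDiff ℝ 1 f :=
      ((hu.pow 2).add ((contDiff_const.mul hgd).pow 2)).sqrt fun x => (hpos x).ne'
    have hf0 : ∀ x, 0 < f x := fun x => Real.sqrt_pos.2 (hpos x)
    have hfC : ∀ x, f x ≤ (C + δ) * g x := by
      intro x
      have h1 : |u x| ≤ C * g x := by
        have := hC x
        rwa [norm_div, Real.norm_of_nonneg (hgp x).le, div_le_iff₀ (hgp x)] at this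
      refine Real.sqrt_le_iff.2 ⟨by have := hgp x; positivity, ?_⟩
      have h2 : u x ^ 2 ≤ (C * g x) ^ 2 := by
        rw [← sq_abs]; gcongr
      have := hgp x
      have : 0 ≤ C * δ * g x ^ 2 := by positivity
      nlinarith
    have hle : ∀ x, ‖fderiv ℝ f x‖ ^ 2 ≤ ‖fderiv ℝ u x‖ ^ 2 + δ ^ 2 * ‖fderiv ℝ g x‖ ^ 2 := by
      intro x
      refine (norm_fderiv_sqrt_sq_le (hu.differentiable one_ne_zero x)
        ((hgd.differentiable one_ne_zero x).const_mul δ) (mul_pos hδ (hgp x)).ne').trans_eq ?_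
      rw [fderiv_const_mul (hgd.differentiable one_ne_zero x), norm_smul, mul_pow,
        Real.norm_eq_abs, sq_abs]
    have hfi : Integrable fun x => ‖fderiv ℝ f x‖ ^ 2 :=
      (hui.add (hgi.const_mul (δ ^ 2))).mono'
        ((hfd.continuous_fderiv one_ne_zero).norm.pow 2).aestronglyMeasurable
        (Eventually.of_forall fun x => by
          rw [Real.norm_of_nonneg (by positivity)]; exact hle x)
    have hfq : Integrable fun x => f x ^ q := by
      refine ((integrable_jap (s := n) (by linarith)).const_mul ((C + δ) ^ q)).mono'
        (hfd.continuous.rpow_const fun x => Or.inl (hf0 x).ne').aestronglyMeasurable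
        (Eventually.of_forall fun x => ?_)
      rw [Real.norm_of_nonneg (Real.rpow_nonneg (hf0 x).le _)]
      refine (Real.rpow_le_rpow (hf0 x).le (hfC x) hq0.le).trans_eq ?_
      rw [Real.mul_rpow (by positivity) (hgp x).le, hg, jap_rpow]
      congr 2
      rw [hq]; field_simp [show (n : ℝ) - 2 ≠ 0 by linarith]
    have huq : ∫ x, |u x| ^ q ≤ ∫ x, f x ^ q := by
      refine integral_mono_of_nonneg (Eventually.of_forall fun x => by positivity) hfq
        (Eventually.of_forall fun x => ?_)
      refine Real.rpow_le_rpow (abs_nonneg _) ?_ hq0.le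
      exact Real.abs_le_sqrt (by nlinarith [sq_nonneg (δ * g x)])
    have hN := bubbleMass_pos (n := n) (by omega)
    have hP := bubbleMoment_pos hn
    have hu0 : 0 ≤ ∫ x, |u x| ^ q := integral_nonneg fun x => by positivity
    calc _ ≤ (n - 2) ^ 2 * bubbleMoment n * ((∫ x, f x ^ q) / bubbleMass n) ^ (2 / q) := by
          gcongr
      _ ≤ _ := sobolev_of_pos hn hq hfd hf0 hfC hfi
      _ ≤ ∫ x, (‖fderiv ℝ u x‖ ^ 2 + δ ^ 2 * ‖fderiv ℝ g x‖ ^ 2) :=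
          integral_mono hfi (hui.add (hgi.const_mul _)) hle
      _ = _ := by rw [integral_add hui (hgi.const_mul _), integral_const_mul]
  have hlim : Tendsto (fun δ : ℝ => (∫ x, ‖fderiv ℝ u x‖ ^ 2) + δ ^ 2 * ∫ x, ‖fderiv ℝ g x‖ ^ 2)
      (𝓝[>] 0) (𝓝 (∫ x, ‖fderiv ℝ u x‖ ^ 2)) := by
    have : Continuous fun δ : ℝ => (∫ x, ‖fderiv ℝ u x‖ ^ 2) + δ ^ 2 * ∫ x, ‖fderiv ℝ g x‖ ^ 2 := by
      fun_prop
    simpa using (this.tendsto 0).mono_left nhdsWithin_le_nhds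
  exact ge_of_tendsto hlim (eventually_mem_nhdsWithin.mono fun δ hδ => key δ hδ)

lemma setIntegral_eq_integral_of_tsupport_subset {n : ℕ} {Ω : Set (Euc n)} {u : Euc n → ℝ}
    (hu : tsupport u ⊆ Ω) {f : Euc n → ℝ} (hf : ∀ x ∉ tsupport u, f x = 0) :
    ∫ x in Ω, f x = ∫ x, f x :=
  setIntegral_eq_integral_of_forall_compl_eq_zero fun x hx => hf x fun h => hx (hu h)

lemma fderiv_eq_zero_of_notMem_tsupport {n : ℕ} {u : Euc n → ℝ} {x : Euc n} (hx : x ∉ tsupport u) :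
    fderiv ℝ u x = 0 :=
  image_eq_zero_of_notMem_tsupport fun h => hx (tsupport_fderiv_subset ℝ h)

lemma IsTest.integral_rpow_pos {n : ℕ} {Ω : Set (Euc n)} {u : Euc n → ℝ} (hu : IsTest Ω u) {q : ℝ}
    (hq : 0 < q) : 0 < ∫ x, |u x| ^ q := by
  obtain ⟨hd, hc, -, h0⟩ := hu
  obtain ⟨x, hx⟩ : ∃ x, u x ≠ 0 := Function.ne_iff.1 h0
  have hcont : Continuous fun x => |u x| ^ q :=
    hd.continuous.abs.rpow_const fun _ => Or.inr hq.le
  refine hcont.integral_pos_of_hasCompactSupport_nonneg_nonzero ?_ (fun x => by positivity) (x := x) ?_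
  · refine hc.comp_left (g := fun t => |t| ^ q) ?_
    simp [hq.ne']
  · exact (Real.rpow_pos_of_pos (abs_pos.2 hx) _).ne'

lemma exists_isTest {n : ℕ} {Ω : Set (Euc n)} (hΩ : IsOpen Ω) {a : Euc n} (ha : a ∈ Ω) :
    ∃ u, IsTest Ω u := by
  obtain ⟨r, hr, hsub⟩ := Metric.nhds_basis_closedBall.mem_iff.1 (hΩ.mem_nhds ha)
  let b : ContDiffBump a := ⟨r / 2, r, by positivity, by linarith⟩
  refine ⟨b, b.contDiff, b.hasCompactSupport, by rw [b.tsupport_eq]; exact hsub, fun h => ?_⟩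
  have := b.one_of_mem_closedBall (Metric.mem_closedBall_self b.rIn_pos.le)
  rw [h] at this
  simp at this

theorem le_sobolevS_s8 {n : ℕ} (hn : 5 ≤ n) {q : ℝ} (hq : q = 2 * (n : ℝ) / ((n : ℝ) - 2))
    {Ω : Set (Euc n)} (hΩ : IsOpen Ω) {a : Euc n} (ha : a ∈ Ω) :
    (n - 2) ^ 2 * bubbleMoment n / bubbleMass n ^ (2 / q) ≤ SobolevS Ω q := by
  have hn' : (5 : ℝ) ≤ n := by exact_mod_cast hn
  have hq0 : 0 < q := by rw [hq]; exact div_pos (by linarith) (by linarith)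
  obtain ⟨u, hu⟩ := exists_isTest hΩ ha
  refine le_csInf ⟨_, u, hu, rfl⟩ ?_
  rintro _ ⟨u, hu, rfl⟩
  have hpos := hu.integral_rpow_pos hq0
  have h := sobolev_of_hasCompactSupport hn hq (hu.1.of_le (by exact_mod_cast le_top)) hu.2.1
  rw [setIntegral_eq_integral_of_tsupport_subset hu.2.2.1 fun x hx => by
      rw [norm_gradient, fderiv_eq_zero_of_notMem_tsupport hx]; simp,
    setIntegral_eq_integral_of_tsupport_subset hu.2.2.1 fun x hx => by
      rw [image_eq_zero_of_notMem_tsupport hx]; simp [hq0.ne'],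
    le_div_iff₀ (Real.rpow_pos_of_pos hpos _)]
  simp only [norm_gradient]
  rw [Real.div_rpow hpos.le (bubbleMass_pos (by omega)).le] at h
  refine le_trans (le_of_eq ?_) h
  ring

lemma IsTest.integral_sq_le {n : ℕ} {Ω : Set (Euc n)} (hΩ : Bornology.IsBounded Ω)
    {u : Euc n → ℝ} (hu : IsTest Ω u) {q : ℝ} (hq : 2 < q) :
    ∫ x in Ω, u x ^ 2 ≤
      (volume.real Ω) ^ (1 - 2 / q) * (∫ x in Ω, |u x| ^ q) ^ (2 / q) := by
  have : IsFiniteMeasure (volume.restrict Ω) := ⟨by simpa using hΩ.measure_lt_top⟩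
  have hconj : (q / 2).HolderConjugate (1 - 2 / q)⁻¹ := by
    rw [Real.holderConjugate_iff]
    refine ⟨by linarith, ?_⟩
    rw [inv_inv]
    field_simp
    ring
  have hcont : Continuous fun x => u x ^ 2 := hu.1.continuous.pow 2
  have hsupp : HasCompactSupport fun x => u x ^ 2 := hu.2.1.comp_left (g := fun t => t ^ 2) (by simp)
  have h := integral_mul_le_Lp_mul_Lq_of_nonneg (μ := volume.restrict Ω) hconj
    (f := fun x => u x ^ 2) (g := fun _ => 1)
    (Eventually.of_forall fun x => sq_nonneg _) (Eventually.of_forall fun x => zero_le_one)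
    ((hcont.memLp_of_hasCompactSupport hsupp).restrict Ω) (memLp_const _)
  have e : ∀ x, (u x ^ 2) ^ (q / 2) = |u x| ^ q := fun x => by
    rw [← sq_abs, ← Real.rpow_natCast, ← Real.rpow_mul (abs_nonneg _)]
    congr 1; push_cast; ring
  simp only [mul_one, e, Real.one_rpow, integral_const, smul_eq_mul, one_div, inv_inv, inv_div,
    measureReal_restrict_apply_univ] at h
  rwa [mul_comm] at h

lemma bddBelow_slam {n : ℕ} {Ω : Set (Euc n)} (hΩo : IsOpen Ω) (hΩ : Bornology.IsBounded Ω)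
    {p : Euc n → ℝ} (hp : ∀ x ∈ Ω, 0 ≤ p x) {q lam : ℝ} (hq : 2 < q) (hlam : 0 ≤ lam) :
    BddBelow {r : ℝ | ∃ u : Euc n → ℝ, IsTest Ω u ∧
      r = ((∫ x in Ω, p x * ‖gradient u x‖ ^ 2) - lam * ∫ x in Ω, (u x) ^ 2) /
        (∫ x in Ω, |u x| ^ q) ^ (2 / q)} := by
  refine ⟨-(lam * (volume.real Ω) ^ (1 - 2 / q)), ?_⟩
  rintro _ ⟨u, hu, rfl⟩
  have h1 := hu.integral_sq_le hΩ hq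
  have h2 : 0 ≤ ∫ x in Ω, p x * ‖gradient u x‖ ^ 2 :=
    setIntegral_nonneg hΩo.measurableSet fun x hx => mul_nonneg (hp x hx) (sq_nonneg _)
  have h3 : 0 < ∫ x in Ω, |u x| ^ q := by
    rw [setIntegral_eq_integral_of_tsupport_subset hu.2.2.1 fun x hx => by
      rw [image_eq_zero_of_notMem_tsupport hx]; simp [show q ≠ 0 by linarith]]
    exact hu.integral_rpow_pos (by linarith)
  rw [le_div_iff₀ (Real.rpow_pos_of_pos h3 _)]
  nlinarith

/-- The bubble `(1 + ‖x‖²)^(-(n-2)/2)`, rescaled around `a` and cut off by `φ`. -/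
def cutBubble {n : ℕ} (φ : Euc n → ℝ) (a : Euc n) (ε : ℝ) (x : Euc n) : ℝ :=
  φ x * jap (((n : ℝ) - 2) / 2) (ε⁻¹ • (x - a))

/-- The gradient of the cut-off bubble in the rescaled variable. -/
def scaledGrad {n : ℕ} (φ : Euc n → ℝ) (a : Euc n) (ε : ℝ) (y : Euc n) : Euc n →L[ℝ] ℝ :=
  φ (a + ε • y) • fderiv ℝ (jap (((n : ℝ) - 2) / 2)) y +
    (ε * jap (((n : ℝ) - 2) / 2) y) • fderiv ℝ φ (a + ε • y)

lemma contDiff_cutBubble {n : ℕ} {φ : Euc n → ℝ} {k : WithTop ℕ∞} (hφ : ContDiff ℝ k φ) (a : Euc n)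
    (ε : ℝ) : ContDiff ℝ k (cutBubble φ a ε) :=
  hφ.mul ((contDiff_jap _).comp ((contDiff_id.sub contDiff_const).const_smul _))

lemma cutBubble_apply {n : ℕ} (φ : Euc n → ℝ) (a : Euc n) {ε : ℝ} (hε : ε ≠ 0) (y : Euc n) :
    cutBubble φ a ε (a + ε • y) = φ (a + ε • y) * jap (((n : ℝ) - 2) / 2) y := by
  simp [cutBubble, smul_smul, hε]

lemma fderiv_cutBubble {n : ℕ} {φ : Euc n → ℝ} (hφ : Differentiable ℝ φ) (a : Euc n) {ε : ℝ}
    (hε : ε ≠ 0) (y : Euc n) :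
    fderiv ℝ (cutBubble φ a ε) (a + ε • y) = ε⁻¹ • scaledGrad φ a ε y := by
  have hj : HasFDerivAt (jap (((n : ℝ) - 2) / 2)) (fderiv ℝ (jap (((n : ℝ) - 2) / 2)) y)
      (ε⁻¹ • ((a + ε • y) - a)) := by
    have : ε⁻¹ • ((a + ε • y) - a) = y := by simp [smul_smul, hε]
    rw [this]
    exact ((contDiff_jap _ (k := 1)).differentiable one_ne_zero y).hasFDerivAt
  have h1 : HasFDerivAt (fun x : Euc n => ε⁻¹ • (x - a)) (ε⁻¹ • ContinuousLinearMap.id ℝ (Euc n))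
      (a + ε • y) := ((hasFDerivAt_id (a + ε • y)).sub_const a).const_smul ε⁻¹
  have h2 := (hφ (a + ε • y)).hasFDerivAt.mul (hj.comp (a + ε • y) h1)
  refine HasFDerivAt.fderiv (h2.congr_fderiv ?_)
  ext v
  simp [scaledGrad, smul_smul, hε]
  field_simp
  tauto

lemma integral_eq_integral_scale {n : ℕ} (F : Euc n → ℝ) (a : Euc n) {ε : ℝ} (hε : 0 < ε) :
    ∫ x, F x = ε ^ n * ∫ y, F (a + ε • y) := by
  have h := Measure.integral_comp_smul (μ := volume) (fun x : Euc n => F (a + x)) ε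
  rw [integral_add_left_eq_self (μ := volume) F a] at h
  rw [h, abs_of_nonneg (by positivity), finrank_euclideanSpace_fin, smul_eq_mul,
    mul_inv_cancel_left₀ (by positivity)]

section Bump

variable {n : ℕ} {a : Euc n} (b : ContDiffBump a)

lemma scaledGrad_eq {ε : ℝ} (hε : 0 < ε) {y : Euc n} (hy : ε * ‖y‖ < b.rIn) :
    scaledGrad b a ε y = fderiv ℝ (jap (((n : ℝ) - 2) / 2)) y := by
  have hmem : a + ε • y ∈ Metric.ball a b.rIn := by
    simpa [norm_smul, abs_of_pos hε] using hy
  have h1 : (b : Euc n → ℝ) =ᶠ[𝓝 (a + ε • y)] fun _ => 1 := by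
    filter_upwards [Metric.isOpen_ball.mem_nhds hmem] with x hx using
      b.one_of_mem_closedBall (Metric.ball_subset_closedBall hx)
  rw [scaledGrad, h1.fderiv_eq, h1.eq_of_nhds]
  simp

lemma scaledGrad_eq_zero {ε : ℝ} (hε : 0 < ε) {y : Euc n} (hy : b.rOut < ε * ‖y‖) :
    scaledGrad b a ε y = 0 := by
  have hmem : a + ε • y ∉ tsupport b := by
    rw [b.tsupport_eq]
    simpa [norm_smul, abs_of_pos hε] using hy
  rw [scaledGrad, fderiv_eq_zero_of_notMem_tsupport hmem, image_eq_zero_of_notMem_tsupport hmem]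
  simp

lemma norm_mul_norm_fderiv_bubble_le (hn : 2 ≤ n) (y : Euc n) :
    ‖y‖ * ‖fderiv ℝ (jap (((n : ℝ) - 2) / 2)) y‖ ≤ (n - 2) * jap (((n : ℝ) - 2) / 2) y := by
  have hn' : (2 : ℝ) ≤ n := by exact_mod_cast hn
  have h := normSq_mul_jap_le (((n : ℝ) - 2) / 2 + 1) y
  rw [add_sub_cancel_right] at h
  rw [norm_fderiv_jap (by linarith)]
  nlinarith

lemma exists_scaledGrad_bound (hn : 2 ≤ n) : ∃ C : ℝ, (n : ℝ) - 2 ≤ C ∧ ∀ ε : ℝ, 0 < ε → ∀ y,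
    ‖y‖ * ‖scaledGrad b a ε y‖ ≤ C * jap (((n : ℝ) - 2) / 2) y := by
  have hb : ContDiff ℝ 1 b := b.contDiff
  obtain ⟨B, hB⟩ : ∃ B, ∀ x, ‖‖x - a‖ * ‖fderiv ℝ b x‖‖ ≤ B := by
    refine HasCompactSupport.exists_bound_of_continuous ?_
      ((continuous_id.sub continuous_const).norm.mul (hb.continuous_fderiv one_ne_zero).norm)
    exact ((b.hasCompactSupport.fderiv (𝕜 := ℝ)).norm).mul_left
  have hB0 : 0 ≤ B := (norm_nonneg _).trans (hB 0)
  refine ⟨n - 2 + B, by linarith, fun ε hε y => ?_⟩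
  have h1 := norm_mul_norm_fderiv_bubble_le hn y
  have h2 : ε * ‖y‖ * ‖fderiv ℝ b (a + ε • y)‖ ≤ B := by
    refine le_trans (le_of_eq ?_) ((le_abs_self _).trans (hB (a + ε • y)))
    rw [add_sub_cancel_left, norm_smul, Real.norm_of_nonneg hε.le]
  have hg := jap_pos (((n : ℝ) - 2) / 2) y
  have h3 : ‖scaledGrad b a ε y‖ ≤ ‖fderiv ℝ (jap (((n : ℝ) - 2) / 2)) y‖ +
      ε * jap (((n : ℝ) - 2) / 2) y * ‖fderiv ℝ b (a + ε • y)‖ := by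
    refine (norm_add_le _ _).trans (add_le_add ?_ ?_)
    · rw [norm_smul, Real.norm_of_nonneg b.nonneg]
      exact mul_le_of_le_one_left (norm_nonneg _) b.le_one
    · rw [norm_smul, Real.norm_of_nonneg (by positivity)]
  calc _ ≤ ‖y‖ * (‖fderiv ℝ (jap (((n : ℝ) - 2) / 2)) y‖ +
        ε * jap (((n : ℝ) - 2) / 2) y * ‖fderiv ℝ b (a + ε • y)‖) := by gcongr
    _ = ‖y‖ * ‖fderiv ℝ (jap (((n : ℝ) - 2) / 2)) y‖ +
        (ε * ‖y‖ * ‖fderiv ℝ b (a + ε • y)‖) * jap (((n : ℝ) - 2) / 2) y := by ring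
    _ ≤ (n - 2) * jap (((n : ℝ) - 2) / 2) y + B * jap (((n : ℝ) - 2) / 2) y := by gcongr
    _ = _ := by ring

lemma eventually_mul_lt {r : ℝ} (hr : 0 < r) (c : ℝ) : ∀ᶠ ε : ℝ in 𝓝[>] 0, ε * c < r := by
  have : Continuous fun ε : ℝ => ε * c := by fun_prop
  have h := (this.tendsto 0).mono_left (nhdsWithin_le_nhds (s := Set.Ioi 0))
  rw [zero_mul] at h
  exact h.eventually_lt_const hr

lemma one_div_sq_le {ε r t : ℝ} (hε : 0 < ε) (hr : 0 < r) (h : r ≤ ε * t) :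
    1 / ε ^ 2 ≤ t ^ 2 / r ^ 2 := by
  rw [div_le_div_iff₀ (by positivity) (by positivity), one_mul, ← mul_pow]
  rw [mul_comm t]
  gcongr

/-- Asymptotics of the critical norm. -/
lemma tendsto_mass (hn : 5 ≤ n) {q : ℝ} (hq : q = 2 * (n : ℝ) / ((n : ℝ) - 2)) :
    Tendsto (fun ε : ℝ => ((∫ y, |cutBubble b a ε (a + ε • y)| ^ q) - bubbleMass n) / ε ^ 2)
      (𝓝[>] 0) (𝓝 0) := by
  have hn' : (5 : ℝ) ≤ n := by exact_mod_cast hn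
  have hq0 : 0 < q := by rw [hq]; exact div_pos (by linarith) (by linarith)
  have ejn : ∀ y : Euc n, jap (((n : ℝ) - 2) / 2) y ^ q = jap n y := fun y => by
    rw [jap_rpow]; congr 1; rw [hq]; field_simp [show (n : ℝ) - 2 ≠ 0 by linarith]
  have e : ∀ ε : ℝ, 0 < ε → ∀ y : Euc n, |cutBubble b a ε (a + ε • y)| ^ q =
      b (a + ε • y) ^ q * jap n y := fun ε hε y => by
    rw [cutBubble_apply _ _ hε.ne', abs_of_nonneg (mul_nonneg b.nonneg (jap_pos _ _).le),
      Real.mul_rpow b.nonneg (jap_pos _ _).le, ejn]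
  have hcb : ∀ ε : ℝ, Continuous fun y : Euc n => b (a + ε • y) ^ q := fun ε =>
    (b.continuous.comp (by fun_prop)).rpow_const fun _ => Or.inr hq0.le
  have hb1 : ∀ x, b x ^ q ≤ 1 := fun x => Real.rpow_le_one b.nonneg b.le_one hq0.le
  have hb0 : ∀ x, 0 ≤ b x ^ q := fun x => Real.rpow_nonneg b.nonneg _
  have hji : Integrable (jap n : Euc n → ℝ) := integrable_jap (by linarith)
  have hi : ∀ ε : ℝ, Integrable fun y : Euc n => b (a + ε • y) ^ q * jap n y := fun ε =>
    hji.mono' ((hcb ε).mul (continuous_jap _)).aestronglyMeasurable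
      (Eventually.of_forall fun y => by
        rw [Real.norm_of_nonneg (mul_nonneg (hb0 _) (jap_pos _ _).le)]
        exact mul_le_of_le_one_left (jap_pos _ _).le (hb1 _))
  have heq : ∀ᶠ ε : ℝ in 𝓝[>] 0, ∫ y, (b (a + ε • y) ^ q - 1) * jap n y / ε ^ 2 =
      ((∫ y, |cutBubble b a ε (a + ε • y)| ^ q) - bubbleMass n) / ε ^ 2 := by
    filter_upwards [self_mem_nhdsWithin] with ε hε
    simp_rw [e ε hε]
    rw [integral_div, bubbleMass, ← integral_sub (hi ε) hji]
    congr 2; ext y; ring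
  refine Tendsto.congr' heq ?_
  have hone : ∀ ε : ℝ, 0 < ε → ∀ y : Euc n, ε * ‖y‖ < b.rIn → b (a + ε • y) = 1 := by
    intro ε hε y hy
    refine b.one_of_mem_closedBall ?_
    simpa [norm_smul, abs_of_pos hε] using hy.le
  rw [show 𝓝 (0 : ℝ) = 𝓝 (∫ _ : Euc n, (0 : ℝ)) by simp]
  refine tendsto_integral_filter_of_dominated_convergence
    (fun y => ‖y‖ ^ 2 * jap n y / b.rIn ^ 2) ?_ ?_ ?_ ?_
  · exact Eventually.of_forall fun ε =>
      ((((hcb ε).sub continuous_const).mul (continuous_jap _)).div_const _).aestronglyMeasurable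
  · filter_upwards [self_mem_nhdsWithin] with ε (hε : 0 < ε)
    refine Eventually.of_forall fun y => ?_
    have hj := jap_pos n y
    rcases lt_or_ge (ε * ‖y‖) b.rIn with h | h
    · rw [hone ε hε y h]
      simp
      positivity
    · have := one_div_sq_le hε b.rIn_pos h
      have h1 : |b (a + ε • y) ^ q - 1| ≤ 1 := by
        rw [abs_le]; constructor <;> linarith [hb0 (a + ε • y), hb1 (a + ε • y)]
      rw [norm_div, norm_mul, Real.norm_eq_abs, Real.norm_of_nonneg hj.le,
        Real.norm_of_nonneg (sq_nonneg ε)]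
      calc _ ≤ 1 * jap n y / ε ^ 2 := by gcongr
        _ = jap n y * (1 / ε ^ 2) := by ring
        _ ≤ jap n y * (‖y‖ ^ 2 / b.rIn ^ 2) := by gcongr
        _ = _ := by ring
  · exact (integrable_normSq_mul_jap (by linarith)).div_const _
  · refine Eventually.of_forall fun y => tendsto_const_nhds.congr' ?_
    filter_upwards [self_mem_nhdsWithin, eventually_mul_lt b.rIn_pos ‖y‖] with ε hε h
    rw [hone ε hε y h]
    simp

lemma integral_cutBubble_rpow_le (hn : 5 ≤ n) {q : ℝ} (hq : q = 2 * (n : ℝ) / ((n : ℝ) - 2))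
    {ε : ℝ} (hε : 0 < ε) : ∫ y, |cutBubble b a ε (a + ε • y)| ^ q ≤ bubbleMass n := by
  have hn' : (5 : ℝ) ≤ n := by exact_mod_cast hn
  have hq0 : 0 < q := by rw [hq]; exact div_pos (by linarith) (by linarith)
  have ejn : ∀ y : Euc n, jap (((n : ℝ) - 2) / 2) y ^ q = jap n y := fun y => by
    rw [jap_rpow]; congr 1; rw [hq]; field_simp [show (n : ℝ) - 2 ≠ 0 by linarith]
  refine integral_mono_of_nonneg (Eventually.of_forall fun y => by positivity)
    (integrable_jap (by linarith)) (Eventually.of_forall fun y => ?_)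
  have hj := jap_pos (((n : ℝ) - 2) / 2) y
  simp only
  rw [← ejn, cutBubble_apply _ _ hε.ne', abs_of_nonneg (mul_nonneg b.nonneg hj.le)]
  exact Real.rpow_le_rpow (mul_nonneg b.nonneg hj.le)
    (mul_le_of_le_one_left hj.le b.le_one) hq0.le

/-- Convergence of the `L²` norms. -/
lemma tendsto_sq (hn : 5 ≤ n) :
    Tendsto (fun ε : ℝ => ∫ y, cutBubble b a ε (a + ε • y) ^ 2)
      (𝓝[>] 0) (𝓝 (∫ y : Euc n, jap (n - 2) y)) := by
  have hn' : (5 : ℝ) ≤ n := by exact_mod_cast hn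
  have e2 : ∀ y : Euc n, jap (((n : ℝ) - 2) / 2) y ^ 2 = jap (n - 2) y := fun y => by
    rw [jap_sq]; congr 1; ring
  refine tendsto_integral_filter_of_dominated_convergence (jap (n - 2)) ?_ ?_
    (integrable_jap (by linarith)) ?_
  · refine Eventually.of_forall fun ε => ?_
    have h : Continuous (cutBubble b a ε) := (contDiff_cutBubble (b.contDiff (n := 0)) a ε).continuous
    exact ((h.comp (by fun_prop)).pow 2).aestronglyMeasurable
  · filter_upwards [self_mem_nhdsWithin] with ε (hε : 0 < ε)
    refine Eventually.of_forall fun y => ?_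
    rw [Real.norm_of_nonneg (sq_nonneg _), cutBubble_apply _ _ hε.ne', mul_pow, e2]
    exact mul_le_of_le_one_left (jap_pos _ _).le (pow_le_one₀ b.nonneg b.le_one)
  · refine Eventually.of_forall fun y => tendsto_const_nhds.congr' ?_
    filter_upwards [self_mem_nhdsWithin, eventually_mul_lt b.rIn_pos ‖y‖] with ε (hε : 0 < ε) h
    rw [cutBubble_apply _ _ hε.ne', b.one_of_mem_closedBall, one_mul, e2]
    simpa [norm_smul, abs_of_pos hε] using h.le

end Bump

lemma bubble_energy_identity {n : ℕ} (hn : 5 ≤ n) :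
    (n - 2) ^ 2 * ∫ y : Euc n, ‖y‖ ^ 4 * jap n y =
      n * (n + 2) * (n - 2) / (4 * (n - 1)) * ∫ y : Euc n, jap (n - 2) y := by
  have hn' : (5 : ℝ) ≤ n := by exact_mod_cast hn
  have hi2 : Integrable fun y : Euc n => ‖y‖ ^ 2 * jap (n - 1) y :=
    integrable_normSq_mul_jap (by linarith)
  have hi4 : Integrable fun y : Euc n => ‖y‖ ^ 4 * jap n y := by
    refine hi2.mono' ((continuous_norm.pow 4).mul (continuous_jap n)).aestronglyMeasurable
      (Eventually.of_forall fun y => ?_)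
    rw [Real.norm_of_nonneg (mul_nonneg (by positivity) (jap_pos _ _).le)]
    have := normSq_mul_jap_le n y
    calc _ = ‖y‖ ^ 2 * (‖y‖ ^ 2 * jap n y) := by ring
      _ ≤ _ := by gcongr
  have h1 := integral_norm_pow_mul_jap (n := n) (s := n - 2) (by omega) 0 (by push_cast; linarith)
    (by simpa using integrable_jap (by linarith))
    (by rw [show (n : ℝ) - 2 + 1 = n - 1 by ring]; simpa using hi2)
  have h2 := integral_norm_pow_mul_jap (n := n) (s := n - 1) (by omega) 2 (by push_cast; linarith)
    hi2 (by simpa using hi4)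
  rw [show (n : ℝ) - 2 + 1 = n - 1 by ring] at h1
  simp only [pow_zero, one_mul, zero_add, Nat.cast_zero, add_zero, Nat.cast_ofNat,
    sub_add_cancel, Nat.reduceAdd] at h1 h2
  have h3 : (n : ℝ) - 1 ≠ 0 := by linarith
  set Q := ∫ y : Euc n, jap (n - 2) y
  set I2 := ∫ y : Euc n, ‖y‖ ^ 2 * jap (n - 1) y
  set I4 := ∫ y : Euc n, ‖y‖ ^ 4 * jap n y
  field_simp
  linear_combination (-(n : ℝ) - 2) * (n - 2) * h1 - 2 * (n - 2) ^ 2 * h2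

section Energy

variable {n : ℕ} {a : Euc n} (b : ContDiffBump a)

lemma tendsto_weight {p : Euc n → ℝ} {p₀ β : ℝ} (hpa : p a = p₀) (hA : CondA p a p₀ 2 β)
    (y : Euc n) :
    Tendsto (fun ε : ℝ => (p (a + ε • y) - p₀) / ε ^ 2) (𝓝[>] 0) (𝓝 (β * ‖y‖ ^ 2)) := by
  rcases eq_or_ne y 0 with rfl | hy
  · simp [hpa]
  have hcont : Continuous fun ε : ℝ => a + ε • y := by fun_prop
  have ht : Tendsto (fun ε : ℝ => a + ε • y) (𝓝[>] 0) (𝓝[≠] a) := by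
    refine tendsto_nhdsWithin_iff.2 ⟨?_, ?_⟩
    · simpa using (hcont.tendsto 0).mono_left (nhdsWithin_le_nhds (s := Set.Ioi 0))
    · filter_upwards [self_mem_nhdsWithin] with ε (hε : 0 < ε)
      simp [hy, hε.ne']
  refine ((hA.comp ht).mul_const (‖y‖ ^ 2)).congr' ?_
  filter_upwards [self_mem_nhdsWithin] with ε (hε : 0 < ε)
  have hy' : ‖y‖ ≠ 0 := norm_ne_zero_iff.2 hy
  simp only [Function.comp, add_sub_cancel_left, norm_smul, Real.norm_of_nonneg hε.le,
    Real.rpow_two]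
  field_simp

/-- Second-order expansion of the weighted Dirichlet energy. -/
lemma tendsto_energy (hn : 5 ≤ n) {Ω : Set (Euc n)} (hΩ : IsOpen Ω)
    (hb : Metric.closedBall a b.rOut ⊆ Ω) {p : Euc n → ℝ} (hpc : ContinuousOn p Ω) {p₀ β : ℝ}
    (hp₀ : 0 < p₀) (hpa : p a = p₀) (hA : CondA p a p₀ 2 β) {γ : ℝ} (hγ : 0 ≤ γ)
    (hbound : ∀ x ∈ Metric.closedBall a b.rOut, |p x - p₀| ≤ γ * ‖x - a‖ ^ 2) :
    Tendsto (fun ε : ℝ => ((∫ y, p (a + ε • y) * ‖scaledGrad b a ε y‖ ^ 2) -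
        p₀ * ((n - 2) ^ 2 * bubbleMoment n)) / ε ^ 2) (𝓝[>] 0)
      (𝓝 (β * ((n - 2) ^ 2 * ∫ y : Euc n, ‖y‖ ^ 4 * jap n y))) := by
  have hn' : (5 : ℝ) ≤ n := by exact_mod_cast hn
  set g : Euc n → ℝ := jap (((n : ℝ) - 2) / 2) with hg
  have hg0 : ∀ y, 0 < g y := jap_pos _
  have hgD : ∀ y, ‖fderiv ℝ g y‖ ^ 2 = (n - 2) ^ 2 * (‖y‖ ^ 2 * jap n y) :=
    norm_fderiv_bubble_sq (by omega)
  have hgsq : ∀ y, g y ^ 2 = jap (n - 2) y := fun y => by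
    rw [hg, jap_sq]; congr 1; ring
  have hgi : Integrable fun y => ‖fderiv ℝ g y‖ ^ 2 := by
    simp only [hgD]
    exact (integrable_normSq_mul_jap (by linarith)).const_mul _
  have hgint : ∫ y, ‖fderiv ℝ g y‖ ^ 2 = (n - 2) ^ 2 * bubbleMoment n := by
    simp only [hgD]
    rw [integral_const_mul, bubbleMoment]
  have hgc : Continuous fun y => ‖fderiv ℝ g y‖ ^ 2 :=
    ((contDiff_jap _ (k := 1)).continuous_fderiv one_ne_zero).norm.pow 2
  obtain ⟨C, hC, hL⟩ := exists_scaledGrad_bound b (show 2 ≤ n by omega)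
  have hC0 : 0 ≤ C := by linarith
  have hLsq : ∀ ε : ℝ, 0 < ε → ∀ y, ‖y‖ ^ 2 * ‖scaledGrad b a ε y‖ ^ 2 ≤ C ^ 2 * g y ^ 2 := by
    intro ε hε y
    rw [← mul_pow, ← mul_pow]
    exact pow_le_pow_left₀ (by positivity) (hL ε hε y) 2
  have hGsq : ∀ y, ‖y‖ ^ 2 * ‖fderiv ℝ g y‖ ^ 2 ≤ C ^ 2 * g y ^ 2 := by
    intro y
    rw [← mul_pow, ← mul_pow]
    refine pow_le_pow_left₀ (by positivity)
      ((norm_mul_norm_fderiv_bubble_le (by omega) y).trans ?_) 2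
    exact mul_le_mul_of_nonneg_right hC (hg0 y).le
  have hcont : ∀ ε : ℝ, 0 < ε → Continuous fun y => p (a + ε • y) * ‖scaledGrad b a ε y‖ ^ 2 := by
    intro ε hε
    have hbd : ContDiff ℝ 1 b := b.contDiff
    have hcb := contDiff_cutBubble hbd a ε
    have hsub : tsupport (fun x => p x * ‖fderiv ℝ (cutBubble b a ε) x‖ ^ 2) ⊆ Ω := by
      refine Set.Subset.trans (closure_minimal ?_ Metric.isClosed_closedBall) hb
      intro x hx
      by_contra hxb
      refine hx ?_
      have h0 : x ∉ tsupport (cutBubble b a ε) := fun h => hxb (by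
        rw [← b.tsupport_eq]
        exact tsupport_mul_subset_left h)
      simp [fderiv_eq_zero_of_notMem_tsupport h0]
    have h1 : Continuous fun x => p x * ‖fderiv ℝ (cutBubble b a ε) x‖ ^ 2 :=
      (hpc.mul ((hcb.continuous_fderiv one_ne_zero).norm.pow 2).continuousOn).continuous_of_tsupport_subset
        hΩ hsub
    have h2 := (h1.comp (show Continuous fun y : Euc n => a + ε • y by fun_prop)).const_mul (ε ^ 2)
    refine h2.congr fun y => ?_
    simp only [Function.comp]
    rw [fderiv_cutBubble (hbd.differentiable one_ne_zero) a hε.ne', norm_smul, mul_pow, norm_inv,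
      Real.norm_of_nonneg hε.le]
    field_simp
  have hmain : ∀ ε : ℝ, 0 < ε → ∀ y, |p (a + ε • y) - p₀| * ‖scaledGrad b a ε y‖ ^ 2 ≤
      γ * ε ^ 2 * (C ^ 2 * g y ^ 2) := by
    intro ε hε y
    rcases lt_or_ge b.rOut (ε * ‖y‖) with h | h
    · rw [scaledGrad_eq_zero b hε h]
      simp
      positivity
    · have h1 := hbound (a + ε • y) (by simpa [norm_smul, abs_of_pos hε] using h)
      rw [add_sub_cancel_left, norm_smul, Real.norm_of_nonneg hε.le] at h1
      calc _ ≤ γ * (ε * ‖y‖) ^ 2 * ‖scaledGrad b a ε y‖ ^ 2 := by gcongr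
        _ = γ * ε ^ 2 * (‖y‖ ^ 2 * ‖scaledGrad b a ε y‖ ^ 2) := by ring
        _ ≤ _ := by
          have := hLsq ε hε y
          gcongr
  have hdiff : ∀ ε : ℝ, 0 < ε → ∀ y, |‖scaledGrad b a ε y‖ ^ 2 - ‖fderiv ℝ g y‖ ^ 2| ≤
      ε ^ 2 * (2 * C ^ 2 / b.rIn ^ 2 * g y ^ 2) := by
    intro ε hε y
    have hr := b.rIn_pos
    rcases lt_or_ge (ε * ‖y‖) b.rIn with h | h
    · rw [scaledGrad_eq b hε h, ← hg]
      simp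
      positivity
    · have h1 := one_div_sq_le hε hr h
      have h2 := hLsq ε hε y
      have h3 := hGsq y
      have h4 : |‖scaledGrad b a ε y‖ ^ 2 - ‖fderiv ℝ g y‖ ^ 2| ≤
          ‖scaledGrad b a ε y‖ ^ 2 + ‖fderiv ℝ g y‖ ^ 2 := by
        rw [abs_le]
        constructor <;> nlinarith [sq_nonneg ‖scaledGrad b a ε y‖, sq_nonneg ‖fderiv ℝ g y‖]
      refine h4.trans ?_
      calc _ = ε ^ 2 * (1 / ε ^ 2 * (‖scaledGrad b a ε y‖ ^ 2 + ‖fderiv ℝ g y‖ ^ 2)) := by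
            field_simp
        _ ≤ ε ^ 2 * (‖y‖ ^ 2 / b.rIn ^ 2 *
            (‖scaledGrad b a ε y‖ ^ 2 + ‖fderiv ℝ g y‖ ^ 2)) := by gcongr
        _ = ε ^ 2 * ((‖y‖ ^ 2 * ‖scaledGrad b a ε y‖ ^ 2 + ‖y‖ ^ 2 * ‖fderiv ℝ g y‖ ^ 2) /
            b.rIn ^ 2) := by ring
        _ ≤ ε ^ 2 * ((C ^ 2 * g y ^ 2 + C ^ 2 * g y ^ 2) / b.rIn ^ 2) := by gcongr
        _ = _ := by ring
  have hsplit : ∀ ε : ℝ, 0 < ε → ∀ y,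
      |p (a + ε • y) * ‖scaledGrad b a ε y‖ ^ 2 - p₀ * ‖fderiv ℝ g y‖ ^ 2| ≤
        ε ^ 2 * ((γ * C ^ 2 + p₀ * (2 * C ^ 2 / b.rIn ^ 2)) * g y ^ 2) := by
    intro ε hε y
    have h1 := hmain ε hε y
    have h2 := hdiff ε hε y
    calc _ = |(p (a + ε • y) - p₀) * ‖scaledGrad b a ε y‖ ^ 2 +
          p₀ * (‖scaledGrad b a ε y‖ ^ 2 - ‖fderiv ℝ g y‖ ^ 2)| := by congr 1; ring
      _ ≤ |p (a + ε • y) - p₀| * ‖scaledGrad b a ε y‖ ^ 2 +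
          p₀ * |‖scaledGrad b a ε y‖ ^ 2 - ‖fderiv ℝ g y‖ ^ 2| := by
        refine (abs_add_le _ _).trans_eq ?_
        rw [abs_mul, abs_mul, abs_of_pos hp₀, abs_of_nonneg (sq_nonneg ‖scaledGrad b a ε y‖)]
      _ ≤ γ * ε ^ 2 * (C ^ 2 * g y ^ 2) + p₀ * (ε ^ 2 * (2 * C ^ 2 / b.rIn ^ 2 * g y ^ 2)) := by
        gcongr
      _ = _ := by ring
  have hgsqi : Integrable fun y => g y ^ 2 := by
    simp only [hgsq]
    exact integrable_jap (by linarith)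
  have heq : ∀ᶠ ε : ℝ in 𝓝[>] 0,
      ∫ y, (p (a + ε • y) * ‖scaledGrad b a ε y‖ ^ 2 - p₀ * ‖fderiv ℝ g y‖ ^ 2) / ε ^ 2 =
      ((∫ y, p (a + ε • y) * ‖scaledGrad b a ε y‖ ^ 2) -
        p₀ * ((n - 2) ^ 2 * bubbleMoment n)) / ε ^ 2 := by
    filter_upwards [self_mem_nhdsWithin] with ε (hε : 0 < ε)
    have hd : Integrable fun y => p (a + ε • y) * ‖scaledGrad b a ε y‖ ^ 2 -
        p₀ * ‖fderiv ℝ g y‖ ^ 2 :=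
      ((hgsqi.const_mul _).const_mul _).mono'
        ((hcont ε hε).sub (continuous_const.mul hgc)).aestronglyMeasurable
        (Eventually.of_forall (hsplit ε hε))
    have hi : Integrable fun y => p (a + ε • y) * ‖scaledGrad b a ε y‖ ^ 2 := by
      refine (hd.add (hgi.const_mul p₀)).congr (Eventually.of_forall fun y => ?_)
      simp
    rw [integral_div, integral_sub hi (hgi.const_mul _), integral_const_mul, hgint]
  refine Tendsto.congr' heq ?_
  have hlimeq : β * ((n - 2) ^ 2 * ∫ y : Euc n, ‖y‖ ^ 4 * jap n y) =
      ∫ y, β * ‖y‖ ^ 2 * ‖fderiv ℝ g y‖ ^ 2 := by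
    rw [← integral_const_mul, ← integral_const_mul]
    congr 1; ext y; rw [hgD]; ring
  rw [hlimeq]
  refine tendsto_integral_filter_of_dominated_convergence
    (fun y => (γ * C ^ 2 + p₀ * (2 * C ^ 2 / b.rIn ^ 2)) * g y ^ 2) ?_ ?_ (hgsqi.const_mul _) ?_
  · filter_upwards [self_mem_nhdsWithin] with ε (hε : 0 < ε)
    exact (((hcont ε hε).sub (continuous_const.mul hgc)).div_const _).aestronglyMeasurable
  · filter_upwards [self_mem_nhdsWithin] with ε (hε : 0 < ε)
    refine Eventually.of_forall fun y => ?_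
    rw [norm_div, Real.norm_of_nonneg (sq_nonneg ε), div_le_iff₀ (by positivity), Real.norm_eq_abs]
    exact (hsplit ε hε y).trans_eq (mul_comm _ _)
  · refine Eventually.of_forall fun y =>
      ((tendsto_weight hpa hA y).mul_const (‖fderiv ℝ g y‖ ^ 2)).congr' ?_
    filter_upwards [self_mem_nhdsWithin, eventually_mul_lt b.rIn_pos ‖y‖] with ε (hε : 0 < ε) h
    rw [scaledGrad_eq b hε h, ← hg]
    ring

end Energy

lemma isTest_cutBubble {n : ℕ} {Ω : Set (Euc n)} {a : Euc n} (b : ContDiffBump a)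
    (hb : Metric.closedBall a b.rOut ⊆ Ω) (ε : ℝ) : IsTest Ω (cutBubble b a ε) := by
  refine ⟨contDiff_cutBubble b.contDiff a ε, b.hasCompactSupport.mul_right,
    tsupport_mul_subset_left.trans (b.tsupport_eq.trans_subset hb), fun h => ?_⟩
  have h1 := congrFun h a
  rw [cutBubble, b.one_of_mem_closedBall (Metric.mem_closedBall_self b.rIn_pos.le), one_mul] at h1
  exact (jap_pos _ _).ne' h1

/-- The quotient of a cut-off bubble in the rescaled variable. -/
lemma quotient_cutBubble {n : ℕ} (hn : 5 ≤ n) {q : ℝ} (hq : q = 2 * (n : ℝ) / ((n : ℝ) - 2))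
    {Ω : Set (Euc n)} {a : Euc n} (b : ContDiffBump a) (hb : Metric.closedBall a b.rOut ⊆ Ω)
    (p : Euc n → ℝ) (lam : ℝ) {ε : ℝ} (hε : 0 < ε) :
    ((∫ x in Ω, p x * ‖gradient (cutBubble b a ε) x‖ ^ 2) -
        lam * ∫ x in Ω, (cutBubble b a ε x) ^ 2) /
        (∫ x in Ω, |cutBubble b a ε x| ^ q) ^ (2 / q) =
      ((∫ y, p (a + ε • y) * ‖scaledGrad b a ε y‖ ^ 2) -
        lam * (ε ^ 2 * ∫ y, cutBubble b a ε (a + ε • y) ^ 2)) /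
        (∫ y, |cutBubble b a ε (a + ε • y)| ^ q) ^ (2 / q) := by
  have hn' : (5 : ℝ) ≤ n := by exact_mod_cast hn
  have hq0 : 0 < q := by rw [hq]; exact div_pos (by linarith) (by linarith)
  have hu := isTest_cutBubble b hb ε
  have hbd : Differentiable ℝ b := (b.contDiff (n := 1)).differentiable one_ne_zero
  rw [setIntegral_eq_integral_of_tsupport_subset hu.2.2.1 fun x hx => by
      rw [norm_gradient, fderiv_eq_zero_of_notMem_tsupport hx]; simp,
    setIntegral_eq_integral_of_tsupport_subset hu.2.2.1 fun x hx => by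
      rw [image_eq_zero_of_notMem_tsupport hx]; simp,
    setIntegral_eq_integral_of_tsupport_subset hu.2.2.1 fun x hx => by
      rw [image_eq_zero_of_notMem_tsupport hx]; simp [hq0.ne']]
  rw [integral_eq_integral_scale (fun x => p x * ‖gradient (cutBubble b a ε) x‖ ^ 2) a hε,
    integral_eq_integral_scale (fun x => cutBubble b a ε x ^ 2) a hε,
    integral_eq_integral_scale (fun x => |cutBubble b a ε x| ^ q) a hε]
  have hgrad : ∀ y, p (a + ε • y) * ‖gradient (cutBubble b a ε) (a + ε • y)‖ ^ 2 =
      (ε ^ 2)⁻¹ * (p (a + ε • y) * ‖scaledGrad b a ε y‖ ^ 2) := fun y => by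
    rw [norm_gradient, fderiv_cutBubble hbd a hε.ne', norm_smul, mul_pow, norm_inv,
      Real.norm_of_nonneg hε.le, inv_pow]
    ring
  simp_rw [hgrad]
  rw [integral_const_mul, Real.mul_rpow (by positivity) (integral_nonneg fun y => by positivity)]
  have hpow : (ε ^ n) ^ (2 / q) = ε ^ n * (ε ^ 2)⁻¹ := by
    rw [← Real.rpow_natCast, ← Real.rpow_mul hε.le, ← Real.rpow_natCast ε 2, ← Real.rpow_neg hε.le,
      ← Real.rpow_add hε]
    congr 1
    rw [hq]
    have : (n : ℝ) - 2 ≠ 0 := by linarith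
    push_cast
    field_simp
    ring
  rw [hpow]
  have he : ε ^ n * (ε ^ 2)⁻¹ ≠ 0 := by positivity
  refine Eq.trans ?_ (mul_div_mul_left _ _ he)
  congr 1
  field_simp

/-- A cut-off bubble beats the level `p₀ S`. -/
lemma exists_quotient_lt {n : ℕ} (hn : 5 ≤ n) {Ω : Set (Euc n)} (hΩ : IsOpen Ω) {a : Euc n}
    (ha : a ∈ Ω) {p : Euc n → ℝ} (hpc : ContinuousOn p Ω) {p₀ : ℝ} (hp₀ : 0 < p₀)
    (hpa : p a = p₀) {β : ℝ} (hA : CondA p a p₀ 2 β) {q : ℝ}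
    (hq : q = 2 * (n : ℝ) / ((n : ℝ) - 2)) {lam : ℝ}
    (hlam : ((n : ℝ) - 2) * (n : ℝ) * ((n : ℝ) + 2) * β / (4 * ((n : ℝ) - 1)) < lam) :
    ∃ u, IsTest Ω u ∧
      ((∫ x in Ω, p x * ‖gradient u x‖ ^ 2) - lam * ∫ x in Ω, (u x) ^ 2) /
        (∫ x in Ω, |u x| ^ q) ^ (2 / q) <
      p₀ * ((n - 2) ^ 2 * bubbleMoment n / bubbleMass n ^ (2 / q)) := by
  have hn' : (5 : ℝ) ≤ n := by exact_mod_cast hn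
  have hq0 : 0 < q := by rw [hq]; exact div_pos (by linarith) (by linarith)
  have h2q : 2 / q ≤ 1 := by
    rw [div_le_one hq0, hq, le_div_iff₀ (by linarith)]
    linarith
  obtain ⟨b, hb, hbound⟩ : ∃ b : ContDiffBump a, Metric.closedBall a b.rOut ⊆ Ω ∧
      ∀ x ∈ Metric.closedBall a b.rOut, |p x - p₀| ≤ (|β| + 1) * ‖x - a‖ ^ 2 := by
    have h1 : ∀ᶠ x in 𝓝 a, x ≠ a → |(p x - p₀) / ‖x - a‖ ^ (2 : ℝ)| < |β| + 1 :=
      eventually_nhdsWithin_iff.1 (hA.abs.eventually_lt_const (lt_add_one _))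
    obtain ⟨r, hr, hsub⟩ := Metric.nhds_basis_closedBall.mem_iff.1 (inter_mem (hΩ.mem_nhds ha) h1)
    refine ⟨⟨r / 2, r, by positivity, by linarith⟩, fun x hx => (hsub hx).1, fun x hx => ?_⟩
    rcases eq_or_ne x a with rfl | hxa
    · simp [hpa]
    have := (hsub hx).2 hxa
    have hpos : 0 < ‖x - a‖ := norm_pos_iff.2 (sub_ne_zero.2 hxa)
    rw [Real.rpow_two, abs_div, abs_of_nonneg (sq_nonneg ‖x - a‖), div_lt_iff₀ (by positivity)] at this
    exact this.le
  have hE := tendsto_energy b hn hΩ hb hpc hp₀ hpa hA (by positivity) hbound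
  have hQ := tendsto_sq b hn
  have hY := tendsto_mass b hn hq
  rw [bubble_energy_identity hn] at hE
  have hQ0 : 0 < ∫ y : Euc n, jap (n - 2) y :=
    integral_pos_of_continuous_pos (integrable_jap (by linarith)) (fun y _ => jap_pos _ y) (by omega)
  have hN := bubbleMass_pos (n := n) (by omega)
  have hP := bubbleMoment_pos hn
  have hlim := (hE.sub (hQ.const_mul lam)).sub
    (hY.const_mul (p₀ * ((n - 2) ^ 2 * bubbleMoment n) / bubbleMass n))
  have hneg : β * (n * (n + 2) * (n - 2) / (4 * (n - 1)) * ∫ y : Euc n, jap (n - 2) y) -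
      lam * (∫ y : Euc n, jap (n - 2) y) -
      p₀ * ((n - 2) ^ 2 * bubbleMoment n) / bubbleMass n * 0 < 0 := by
    have := mul_lt_mul_of_pos_right hlam hQ0
    rw [mul_zero, sub_zero, sub_neg]
    refine lt_of_eq_of_lt ?_ this
    ring
  obtain ⟨ε, hlt, hε⟩ := ((hlim.eventually_lt_const hneg).and self_mem_nhdsWithin).exists
  replace hε : 0 < ε := hε
  have hu := isTest_cutBubble b hb ε
  refine ⟨_, hu, ?_⟩
  rw [quotient_cutBubble hn hq b hb p lam hε]
  have hA0 : 0 < ∫ y, |cutBubble b a ε (a + ε • y)| ^ q := by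
    have := hu.integral_rpow_pos hq0
    rw [integral_eq_integral_scale (fun x => |cutBubble b a ε x| ^ q) a hε] at this
    exact pos_of_mul_pos_right this (by positivity)
  have hAN := integral_cutBubble_rpow_le b hn hq hε
  set N := bubbleMass n
  set A := ∫ y, |cutBubble b a ε (a + ε • y)| ^ q
  set E := ∫ y, p (a + ε • y) * ‖scaledGrad b a ε y‖ ^ 2
  set Q := ∫ y, cutBubble b a ε (a + ε • y) ^ 2
  have hroot : A / N ≤ (A / N) ^ (2 / q) :=
    Real.self_le_rpow_of_le_one (by positivity) ((div_le_one hN).2 hAN) h2q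
  have hnum : E - lam * (ε ^ 2 * Q) < p₀ * ((n - 2) ^ 2 * bubbleMoment n) * (A / N) := by
    have h := mul_neg_of_neg_of_pos hlt (show 0 < ε ^ 2 by positivity)
    have e : ((E - p₀ * ((n - 2) ^ 2 * bubbleMoment n)) / ε ^ 2 - lam * Q -
        p₀ * ((n - 2) ^ 2 * bubbleMoment n) / N * ((A - N) / ε ^ 2)) * ε ^ 2 =
        E - lam * (ε ^ 2 * Q) - p₀ * ((n - 2) ^ 2 * bubbleMoment n) * (A / N) := by
      field_simp
      ring
    rw [e] at h
    linarith
  rw [div_lt_iff₀ (Real.rpow_pos_of_pos hA0 _)]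
  have hD : 0 ≤ p₀ * ((n - 2) ^ 2 * bubbleMoment n) := by positivity
  refine hnum.trans_le ((mul_le_mul_of_nonneg_left hroot hD).trans_eq ?_)
  rw [Real.div_rpow hA0.le hN.le]
  ring

theorem stmt_8 {n : ℕ} (hn : 5 ≤ n)
    (Ω : Set (Euc n)) (hΩo : IsOpen Ω) (hΩb : Bornology.IsBounded Ω)
    (a : Euc n) (ha : a ∈ Ω)
    (p : Euc n → ℝ) (hpc : ContinuousOn p (closure Ω))
    (p₀ : ℝ) (hp₀ : 0 < p₀) (hpa : p a = p₀) (hmin : ∀ x ∈ closure Ω, p₀ ≤ p x)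
    (β : ℝ) (hβ : 0 < β) (hA : CondA p a p₀ 2 β)
    (q : ℝ) (hq : q = 2 * (n : ℝ) / ((n : ℝ) - 2))
    (lam : ℝ) (hlam : ((n : ℝ) - 2) * (n : ℝ) * ((n : ℝ) + 2) * β / (4 * ((n : ℝ) - 1)) < lam) :
    Slam Ω p q lam < p₀ * SobolevS Ω q := by
  have hn' : (5 : ℝ) ≤ n := by exact_mod_cast hn
  have hn2 : 0 < (n : ℝ) - 2 := by linarith
  have hn1 : 0 < (n : ℝ) - 1 := by linarith
  have hq2 : 2 < q := by rw [hq, lt_div_iff₀ hn2]; linarith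
  have hlam0 : 0 ≤ lam := le_trans (by positivity) hlam.le
  obtain ⟨u, hu, hlt⟩ :=
    exists_quotient_lt hn hΩo ha (hpc.mono subset_closure) hp₀ hpa hA hq hlam
  have hbdd := bddBelow_slam (p := p) hΩo hΩb
    (fun x hx => hp₀.le.trans (hmin x (subset_closure hx))) hq2 hlam0
  exact ((csInf_le hbdd ⟨u, hu, rfl⟩).trans_lt hlt).trans_le
    (mul_le_mul_of_nonneg_left (le_sobolevS_s8 hn hq hΩo ha) hp₀.le)
end
end
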